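/- There exists a function f : ℕ × ℕ → ℕ with the following property: for every finite soluble group G and every automorphism ψ of G such that at most one prime divides both the order |ψ| of ψ and the order |G| of G, the Fitting height of G is at most f(|ψ|, |C_G(ψ)|). -/

import Mathlib

/-- The Fitting height of `G` is at most `N`: there is a chain of normal subgroups
`⊥ = H 0 ≤ H 1 ≤ … ≤ H N = ⊤` with all factors nilpotent. -/
def FittingHeightLE (G : Type*) [Group G] (N : ℕ) : Prop :=
  ∃ H : ℕ → Subgroup G, H 0 = ⊥ ∧ H N = ⊤ ∧ (∀ i, (H i).Normal) ∧ (∀ i, H i ≤ H (i + 1)) ∧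
    ∀ i < N, ∀ hn : ((H i).subgroupOf (H (i + 1))).Normal,
      letI := hn
      Group.IsNilpotent (H (i + 1) ⧸ (H i).subgroupOf (H (i + 1)))

/-- The number of fixed points of the automorphism `ψ` of `G`. -/
noncomputable def autFixedCard {G : Type*} [Group G] (ψ : MulAut G) : ℕ :=
  Nat.card {g : G // ψ g = g}

namespace FittingBound

open Subgroup
open scoped commutatorElement

section Residual

variable {Γ Δ : Type*} [Group Γ] [Group Δ]

/-- The lower central series of the subgroup `M`, as subgroups of the ambient group. -/
def lcs (M : Subgroup Γ) : ℕ → Subgroup Γ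
  | 0 => M
  | n + 1 => ⁅lcs M n, M⁆

/-- The derived series of the subgroup `M`, as subgroups of the ambient group. -/
def der (M : Subgroup Γ) : ℕ → Subgroup Γ
  | 0 => M
  | n + 1 => ⁅der M n, der M n⁆

/-- Solubility of a subgroup. -/
def Sol (M : Subgroup Γ) : Prop := ∃ n, der M n = ⊥

/-- The nilpotent residual of a subgroup of a finite group. -/
def res (M : Subgroup Γ) : Subgroup Γ := ⨅ n, lcs M n

/-- The lower nilpotent series of the subgroup `M`. -/
def L (M : Subgroup Γ) : ℕ → Subgroup Γ
  | 0 => M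
  | n + 1 => res (L M n)

theorem lcs_succ (M : Subgroup Γ) (n : ℕ) : lcs M (n + 1) = ⁅lcs M n, M⁆ := rfl
theorem der_succ (M : Subgroup Γ) (n : ℕ) : der M (n + 1) = ⁅der M n, der M n⁆ := rfl
theorem L_zero (M : Subgroup Γ) : L M 0 = M := rfl
theorem L_succ (M : Subgroup Γ) (n : ℕ) : L M (n + 1) = res (L M n) := rfl
theorem L_one (M : Subgroup Γ) : L M 1 = res M := rfl

theorem commutator_le_sub {A B M : Subgroup Γ} (hA : A ≤ M) (hB : B ≤ M) : ⁅A, B⁆ ≤ M := by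
  rw [Subgroup.commutator_le]
  intro a ha b hb
  rw [commutatorElement_def]
  exact M.mul_mem (M.mul_mem (M.mul_mem (hA ha) (hB hb)) (M.inv_mem (hA ha))) (M.inv_mem (hB hb))

theorem lcs_le_self (M : Subgroup Γ) (n : ℕ) : lcs M n ≤ M := by
  induction n with
  | zero => exact le_rfl
  | succ n ih => exact commutator_le_sub ih le_rfl

theorem lcs_succ_le (M : Subgroup Γ) (n : ℕ) : lcs M (n + 1) ≤ lcs M n := by
  induction n with
  | zero => exact commutator_le_sub le_rfl le_rfl
  | succ n ih => exact commutator_mono ih le_rfl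

theorem lcs_antitone (M : Subgroup Γ) : Antitone (lcs M) := antitone_nat_of_succ_le (lcs_succ_le M)

theorem lcs_mono {M N : Subgroup Γ} (h : M ≤ N) (n : ℕ) : lcs M n ≤ lcs N n := by
  induction n with
  | zero => exact h
  | succ n ih => exact commutator_mono ih h

theorem res_le_lcs (M : Subgroup Γ) (n : ℕ) : res M ≤ lcs M n := iInf_le _ n

theorem res_le (M : Subgroup Γ) : res M ≤ M := res_le_lcs M 0

theorem res_le_commutator (M : Subgroup Γ) : res M ≤ ⁅M, M⁆ := res_le_lcs M 1

theorem res_mono {M N : Subgroup Γ} (h : M ≤ N) : res M ≤ res N :=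
  iInf_mono fun n => lcs_mono h n

theorem L_succ_le (M : Subgroup Γ) (n : ℕ) : L M (n + 1) ≤ L M n := res_le _

theorem L_antitone (M : Subgroup Γ) : Antitone (L M) := antitone_nat_of_succ_le (L_succ_le M)

theorem L_le (M : Subgroup Γ) (n : ℕ) : L M n ≤ M := L_antitone M (Nat.zero_le n)

theorem L_mono {M N : Subgroup Γ} (h : M ≤ N) (n : ℕ) : L M n ≤ L N n := by
  induction n with
  | zero => exact h
  | succ n ih => exact res_mono ih

theorem L_add (M : Subgroup Γ) (i j : ℕ) : L M (i + j) = L (L M i) j := by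
  induction j with
  | zero => rfl
  | succ j ih => rw [← add_assoc, L_succ, ih, L_succ]

theorem L_eq_bot_mono {M : Subgroup Γ} {i j : ℕ} (h : i ≤ j) (hi : L M i = ⊥) : L M j = ⊥ :=
  le_bot_iff.1 (hi ▸ L_antitone M h)

theorem L_le_trans {M N : Subgroup Γ} {i j : ℕ} (h : i ≤ j) (hi : L M i ≤ N) : L M j ≤ N :=
  (L_antitone M h).trans hi

theorem exists_res_eq [Finite Γ] (M : Subgroup Γ) : ∃ n, ∀ m, n ≤ m → res M = lcs M m := by
  obtain ⟨n, hn⟩ := WellFoundedLT.antitone_chain_condition (lcs_antitone M)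
  refine ⟨n, fun m hm => le_antisymm (res_le_lcs M m) (le_iInf fun i => ?_)⟩
  have h1 : lcs M n = lcs M m := hn m hm
  rcases le_total n i with h | h
  · have h2 : lcs M n = lcs M i := hn i h
    rw [← h1, h2]
  · rw [← h1]; exact lcs_antitone M h

theorem commutator_res [Finite Γ] (M : Subgroup Γ) : ⁅res M, M⁆ = res M := by
  obtain ⟨n, hn⟩ := exists_res_eq M
  rw [hn n le_rfl, ← lcs_succ, ← hn n le_rfl, ← hn (n + 1) (Nat.le_succ n)]

theorem map_lcs (f : Γ →* Δ) (M : Subgroup Γ) (n : ℕ) : (lcs M n).map f = lcs (M.map f) n := by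
  induction n with
  | zero => rfl
  | succ n ih => rw [lcs_succ, map_commutator, ih, lcs_succ]

theorem map_der (f : Γ →* Δ) (M : Subgroup Γ) (n : ℕ) : (der M n).map f = der (M.map f) n := by
  induction n with
  | zero => rfl
  | succ n ih => rw [der_succ, map_commutator, ih, der_succ]

theorem map_res [Finite Γ] (f : Γ →* Δ) (M : Subgroup Γ) : (res M).map f = res (M.map f) := by
  obtain ⟨n, hn⟩ := exists_res_eq M
  apply le_antisymm
  · refine le_iInf fun i => ?_
    rw [← map_lcs]; exact map_mono (res_le_lcs M i)
  · rw [hn n le_rfl, map_lcs]; exact res_le_lcs _ _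

theorem map_L [Finite Γ] (f : Γ →* Δ) (M : Subgroup Γ) (n : ℕ) : (L M n).map f = L (M.map f) n := by
  induction n with
  | zero => rfl
  | succ n ih => rw [L_succ, map_res, ih, L_succ]

instance lcs_normal (M : Subgroup Γ) [M.Normal] (n : ℕ) : (lcs M n).Normal := by
  induction n with
  | zero => assumption
  | succ n ih => exact Subgroup.commutator_normal _ _

instance der_normal (M : Subgroup Γ) [M.Normal] (n : ℕ) : (der M n).Normal := by
  induction n with
  | zero => assumption
  | succ n ih => exact Subgroup.commutator_normal _ _

instance res_normal (M : Subgroup Γ) [M.Normal] : (res M).Normal :=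
  Subgroup.normal_iInf_normal fun n => lcs_normal M n

instance L_normal (M : Subgroup Γ) [M.Normal] (n : ℕ) : (L M n).Normal := by
  induction n with
  | zero => assumption
  | succ n ih => exact res_normal _

theorem res_le_of_lcs_le {M N : Subgroup Γ} {n : ℕ} (h : lcs M n ≤ N) : res M ≤ N :=
  (res_le_lcs M n).trans h

theorem L_le_sup [Finite Γ] {M M' C : Subgroup Γ} [C.Normal] (h : M ≤ M' ⊔ C) (n : ℕ) :
    L M n ≤ L M' n ⊔ C := by
  have h1 : M.map (QuotientGroup.mk' C) ≤ M'.map (QuotientGroup.mk' C) := by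
    rw [map_le_iff_le_comap, comap_map_eq, QuotientGroup.ker_mk']; exact h
  have h2 := L_mono h1 n
  rw [← map_L, ← map_L, map_le_iff_le_comap, comap_map_eq, QuotientGroup.ker_mk'] at h2
  exact h2

theorem L_le_ker [Finite Γ] {f : Γ →* Δ} {M : Subgroup Γ} {n : ℕ} :
    L M n ≤ f.ker ↔ L (M.map f) n = ⊥ := by
  rw [← map_L, Subgroup.map_eq_bot_iff]

theorem Sol.map {M : Subgroup Γ} (h : Sol M) (f : Γ →* Δ) : Sol (M.map f) := by
  obtain ⟨n, hn⟩ := h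
  exact ⟨n, by rw [← map_der, hn, Subgroup.map_bot]⟩

theorem der_mono {M N : Subgroup Γ} (h : M ≤ N) (n : ℕ) : der M n ≤ der N n := by
  induction n with
  | zero => exact h
  | succ n ih => exact commutator_mono ih ih

theorem Sol.mono {M N : Subgroup Γ} (h : Sol N) (hM : M ≤ N) : Sol M := by
  obtain ⟨n, hn⟩ := h
  exact ⟨n, le_bot_iff.1 (hn ▸ der_mono hM n)⟩

theorem Sol.of_map {M : Subgroup Γ} {f : Γ →* Δ} (hf : Function.Injective f)
    (h : Sol (M.map f)) : Sol M := by
  obtain ⟨n, hn⟩ := h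
  refine ⟨n, ?_⟩
  rwa [← map_der, map_eq_bot_iff_of_injective _ hf] at hn

theorem Sol.subgroupOf {M : Subgroup Γ} (h : Sol M) (S : Subgroup Γ) : Sol (M.subgroupOf S) := by
  apply Sol.of_map (f := S.subtype) S.subtype_injective
  rw [subgroupOf_map_subtype]
  exact h.mono inf_le_left

theorem der_top (n : ℕ) : der (⊤ : Subgroup Γ) n = derivedSeries Γ n := by
  induction n with
  | zero => rfl
  | succ n ih => rw [der_succ, ih, derivedSeries_succ]

theorem Sol.top [h : Group.IsSolvable Γ] : Sol (⊤ : Subgroup Γ) := by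
  obtain ⟨n, hn⟩ := h.solvable
  exact ⟨n, by rw [der_top, hn]⟩

theorem der_le_self (M : Subgroup Γ) (n : ℕ) : der M n ≤ M := by
  induction n with
  | zero => exact le_rfl
  | succ n ih => exact commutator_le_sub ih ih

theorem Sol.eq_bot {M : Subgroup Γ} (h : Sol M) (hM : M ≤ ⁅M, M⁆) : M = ⊥ := by
  obtain ⟨n, hn⟩ := h
  have : ∀ i, M ≤ der M i := by
    intro i
    induction i with
    | zero => exact le_rfl
    | succ i ih => exact hM.trans (commutator_mono ih ih)
  exact le_bot_iff.1 (hn ▸ this n)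

/-- A soluble subgroup not contained in `N` has a derived term outside `N` that is abelian
modulo `N`. -/
theorem Sol.exists_der {G : Subgroup Γ} (h : Sol G) {N : Subgroup Γ} (hN : ¬ G ≤ N) :
    ∃ i, ¬ der G i ≤ N ∧ ⁅der G i, der G i⁆ ≤ N := by
  classical
  have hex : ∃ n, der G n ≤ N := by
    obtain ⟨n, hn⟩ := h
    exact ⟨n, hn ▸ bot_le⟩
  have h0 : Nat.find hex ≠ 0 := by
    intro h0
    have := Nat.find_spec hex
    rw [h0] at this
    exact hN this
  obtain ⟨i, hi⟩ := Nat.exists_eq_succ_of_ne_zero h0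
  refine ⟨i, Nat.find_min hex (by omega), ?_⟩
  have := Nat.find_spec hex
  rwa [hi] at this

theorem L_card_lt [Finite Γ] {M : Subgroup Γ} (h : Sol M) (n : ℕ) :
    L M n = ⊥ ∨ Nat.card (L M n) + n ≤ Nat.card M := by
  induction n with
  | zero => right; simp [L_zero]
  | succ n ih =>
    rcases ih with ih | ih
    · left; exact L_eq_bot_mono (Nat.le_succ n) ih
    · by_cases hb : L M n = ⊥
      · left; exact L_eq_bot_mono (Nat.le_succ n) hb
      · right
        have hlt : L M (n + 1) < L M n := by
          refine lt_of_le_of_ne (L_succ_le M n) fun he => hb ?_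
          refine (h.mono (L_le M n)).eq_bot ?_
          calc L M n = L M (n + 1) := he.symm
            _ ≤ _ := res_le_commutator _
        have : Nat.card (L M (n + 1)) < Nat.card (L M n) := by
          have := Set.ncard_lt_ncard (SetLike.coe_ssubset_coe.2 hlt) (Set.toFinite _)
          simpa [← Nat.card_coe_set_eq] using this
        omega

theorem L_eq_bot_of_card_le [Finite Γ] {M : Subgroup Γ} (h : Sol M) {m : ℕ}
    (hm : Nat.card M ≤ m) : L M m = ⊥ := by
  rcases L_card_lt h m with h1 | h1
  · exact h1
  · have : 0 < Nat.card (L M m) := Nat.card_pos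
    omega

theorem L_le_ker_of_card_le [Finite Γ] [Finite Δ] (f : Γ →* Δ) {M : Subgroup Γ} (h : Sol M) {m : ℕ}
    (hm : Nat.card Δ ≤ m) : L M m ≤ f.ker :=
  L_le_ker.2 (L_eq_bot_of_card_le (h.map f) ((Subgroup.card_le_card_group _).trans hm))

theorem L_subgroupOf [Finite Γ] {S M : Subgroup Γ} (h : M ≤ S) (n : ℕ) :
    (L (M.subgroupOf S) n).map S.subtype = L M n := by
  rw [map_L, subgroupOf_map_subtype, inf_eq_left.2 h]

end Residual

end FittingBound

namespace FittingBound

open Subgroup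
open scoped commutatorElement

section Coprime

variable {Γ Δ : Type*} [Group Γ] [Group Δ]

/-- `Γ` is the product of the soluble normal subgroup `G` and a cyclic group of prime order `q`
not dividing `|G|`, generated by `a`. -/
structure Setup (G : Subgroup Γ) (a : Γ) (q : ℕ) : Prop where
  normal : G.Normal
  sol : Sol G
  prime : q.Prime
  pow : a ^ q = 1
  sup : G ⊔ zpowers a = ⊤
  cop : ¬ q ∣ Nat.card G

/-- The centralizer of `a` in `G`. -/
def fixedIn (G : Subgroup Γ) (a : Γ) : Subgroup Γ := G ⊓ centralizer {a}

theorem mem_fixedIn {G : Subgroup Γ} {a g : Γ} : g ∈ fixedIn G a ↔ g ∈ G ∧ a * g = g * a := by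
  rw [fixedIn, mem_inf, mem_centralizer_singleton_iff, eq_comm]

theorem fixedIn_le (G : Subgroup Γ) (a : Γ) : fixedIn G a ≤ G := inf_le_left

theorem fixedIn_comm_zpow {G : Subgroup Γ} {a g : Γ} (h : g ∈ fixedIn G a) (i : ℤ) :
    a ^ i * g = g * a ^ i := by
  have : Commute a g := (mem_fixedIn.1 h).2
  exact (this.zpow_left i).eq

theorem Setup.exists_mul {G : Subgroup Γ} {a : Γ} {q : ℕ} (h : Setup G a q) (γ : Γ) :
    ∃ g ∈ G, ∃ i : ℤ, γ = g * a ^ i := by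
  have := h.normal
  have h1 : γ ∈ G ⊔ zpowers a := by rw [h.sup]; trivial
  rw [← SetLike.mem_coe, Subgroup.normal_mul, Set.mem_mul] at h1
  obtain ⟨g, hg, y, hy, rfl⟩ := h1
  obtain ⟨i, rfl⟩ := mem_zpowers_iff.1 hy
  exact ⟨g, hg, i, rfl⟩

theorem Setup.restrict [Finite Γ] {G : Subgroup Γ} {a : Γ} {q : ℕ} (h : Setup G a q)
    {S : Subgroup Γ} (ha : a ∈ S) : Setup (G.subgroupOf S) (⟨a, ha⟩ : S) q where
  normal := by have := h.normal; infer_instance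
  sol := h.sol.subgroupOf S
  prime := h.prime
  pow := by ext; simp [h.pow]
  sup := by
    rw [eq_top_iff]
    rintro ⟨x, hx⟩ -
    obtain ⟨g, hg, i, rfl⟩ := h.exists_mul x
    have hgS : g ∈ S := by
      have := S.mul_mem hx (S.inv_mem (S.zpow_mem ha i))
      simpa using this
    have : (⟨g * a ^ i, hx⟩ : S) = ⟨g, hgS⟩ * (⟨a, ha⟩ : S) ^ i := by ext; simp
    rw [this]
    exact mul_mem_sup (mem_subgroupOf.2 hg) (zpow_mem (mem_zpowers _) i)
  cop := fun hd => h.cop (hd.trans (by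
    have : Nat.card (G.subgroupOf S) = Nat.card (G ⊓ S : Subgroup Γ) := by
      rw [← subgroupOf_map_subtype]
      exact (Subgroup.card_map_of_injective S.subtype_injective).symm
    rw [this]
    exact Subgroup.card_dvd_of_le inf_le_left))

theorem Setup.map [Finite Γ] {G : Subgroup Γ} {a : Γ} {q : ℕ} (h : Setup G a q)
    {f : Γ →* Δ} (hf : Function.Surjective f) : Setup (G.map f) (f a) q where
  normal := h.normal.map f hf
  sol := h.sol.map f
  prime := h.prime
  pow := by rw [← map_pow, h.pow, map_one]
  sup := by
    rw [← MonoidHom.map_zpowers, ← Subgroup.map_sup, h.sup, Subgroup.map_top_of_surjective f hf]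
  cop := fun hd => h.cop (hd.trans (Subgroup.card_map_dvd G f))

/-- An invariant coset of an invariant subgroup of coprime order has a fixed element. -/
theorem exists_fixed_of_coset [Finite Γ] {a : Γ} {q : ℕ} (hq : q.Prime) (ha : a ^ q = 1)
    {H : Subgroup Γ} (hH : ∀ h ∈ H, a * h * a⁻¹ ∈ H) (hc : ¬ q ∣ Nat.card H) {x : Γ}
    (hx : x⁻¹ * (a * x * a⁻¹) ∈ H) : ∃ h ∈ H, a * (x * h) = x * h * a := by
  have := Fact.mk hq
  classical
  have hH' : ∀ (n : ℕ), ∀ h ∈ H, a ^ n * h * (a ^ n)⁻¹ ∈ H := by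
    intro n
    induction n with
    | zero => intro h hh; simpa using hh
    | succ n ih =>
      intro h hh
      have := hH _ (ih h hh)
      convert this using 1
      rw [pow_succ']; group
  have hinv : a⁻¹ = a ^ (q - 1) := by
    rw [inv_eq_iff_mul_eq_one, ← pow_succ', Nat.sub_add_cancel hq.one_lt.le, ha]
  have hH2 : ∀ h ∈ H, a⁻¹ * h * a ∈ H := by
    intro h hh
    have := hH' (q - 1) h hh
    rwa [← hinv, inv_inv] at this
  let σ : Equiv.Perm H :=
    { toFun := fun h => ⟨x⁻¹ * (a * x * a⁻¹) * (a * h * a⁻¹), H.mul_mem hx (hH _ h.2)⟩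
      invFun := fun h => ⟨a⁻¹ * ((x⁻¹ * (a * x * a⁻¹))⁻¹ * h) * a,
        hH2 _ (H.mul_mem (H.inv_mem hx) h.2)⟩
      left_inv := fun h => by ext; simp [mul_assoc]
      right_inv := fun h => by ext; simp [mul_assoc] }
  have hσ : ∀ (n : ℕ) (h : H), (((σ ^ n) h : H) : Γ) = x⁻¹ * a ^ n * (x * h) * (a ^ n)⁻¹ := by
    intro n
    induction n with
    | zero => intro h; simp
    | succ n ih =>
      intro h
      rw [pow_succ', Equiv.Perm.mul_apply]
      change x⁻¹ * (a * x * a⁻¹) * (a * (((σ ^ n) h : H) : Γ) * a⁻¹) = _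
      rw [ih, pow_succ']; group
  have hσq : σ ^ q ^ 1 = 1 := by
    ext h
    rw [pow_one, hσ, ha]; simp
  have := Fintype.ofFinite H
  obtain ⟨h, hh⟩ := Equiv.Perm.exists_fixed_point_of_prime (p := q) (n := 1)
    (by rwa [← Nat.card_eq_fintype_card]) hσq
  refine ⟨h, h.2, ?_⟩
  have h2 : x⁻¹ * (a * x * a⁻¹) * (a * h * a⁻¹) = (h : Γ) := congrArg Subtype.val hh
  have h3 : x⁻¹ * (a * (x * h)) * a⁻¹ = h := by
    conv_rhs => rw [← h2]
    simp [mul_assoc]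
  rw [mul_inv_eq_iff_eq_mul, inv_mul_eq_iff_eq_mul] at h3
  rw [h3, mul_assoc]

theorem Setup.conj_mem {G : Subgroup Γ} {a : Γ} {q : ℕ} (h : Setup G a q) {g : Γ} (hg : g ∈ G)
    (γ : Γ) : γ * g * γ⁻¹ ∈ G := h.normal.conj_mem g hg γ

theorem not_dvd_card_of_le [Finite Γ] {G H : Subgroup Γ} {q : ℕ} (h : ¬ q ∣ Nat.card G)
    (hH : H ≤ G) : ¬ q ∣ Nat.card H := fun hd => h (hd.trans (Subgroup.card_dvd_of_le hH))

/-- Two fixed points of `a` in one `G`-orbit are conjugate under the centralizer of `a`. -/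
theorem Setup.exists_fixed_smul [Finite Γ] {G : Subgroup Γ} {a : Γ} {q : ℕ} (h : Setup G a q)
    {Ω : Type*} [MulAction Γ Ω] {ω ω' : Ω} (hω : a • ω = ω) (hω' : a • ω' = ω') {g : Γ}
    {N : Subgroup Γ} [N.Normal] (hN : N ≤ G) (hg : g ∈ N)
    (hgω : g • ω' = ω) : ∃ n ∈ N, n ∈ fixedIn G a ∧ n • ω' = ω := by
  have hinv : a⁻¹ • ω' = ω' := by rw [inv_smul_eq_iff, hω']
  have hX1 : ∀ y ∈ N ⊓ MulAction.stabilizer Γ ω',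
      a * y * a⁻¹ ∈ N ⊓ MulAction.stabilizer Γ ω' := by
    rintro y ⟨hy1, hy2⟩
    refine ⟨Normal.conj_mem inferInstance _ hy1 a, ?_⟩
    have h2 : y • ω' = ω' := hy2
    change (a * y * a⁻¹) • ω' = ω'
    rw [mul_smul, mul_smul, hinv, h2, hω']
  have hX2 : g⁻¹ * (a * g * a⁻¹) ∈ N ⊓ MulAction.stabilizer Γ ω' := by
    refine ⟨N.mul_mem (N.inv_mem hg) (Normal.conj_mem inferInstance _ hg a), ?_⟩
    change (g⁻¹ * (a * g * a⁻¹)) • ω' = ω'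
    rw [mul_smul, mul_smul, mul_smul, hinv, hgω, hω, inv_smul_eq_iff, hgω]
  obtain ⟨y, hy, hy2⟩ := exists_fixed_of_coset (H := N ⊓ MulAction.stabilizer Γ ω') (x := g)
    h.prime h.pow hX1 (not_dvd_card_of_le h.cop (inf_le_left.trans hN)) hX2
  have hN1 := N.mul_mem hg hy.1
  refine ⟨g * y, hN1, mem_fixedIn.2 ⟨hN hN1, hy2⟩, ?_⟩
  have h2 : y • ω' = ω' := hy.2
  rw [mul_smul, h2, hgω]

theorem commutator_zpowers_le {G : Subgroup Γ} [hG : G.Normal] (a : Γ) : ⁅G, zpowers a⁆ ≤ G :=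
  commutator_le_left _ _

theorem commutator_conj_left (h g x : Γ) : h * ⁅g, x⁆ * h⁻¹ = ⁅h * g, x⁆ * ⁅h, x⁆⁻¹ := by
  simp only [commutatorElement_def]; group

theorem Setup.comm_normal {G : Subgroup Γ} {a : Γ} {q : ℕ} (h : Setup G a q) :
    (⁅G, zpowers a⁆ : Subgroup Γ).Normal := by
  refine ⟨fun n hn γ => ?_⟩
  have hG := h.normal
  have key : ∀ γ : Γ, (∀ g ∈ G, ∀ x ∈ zpowers a, γ * ⁅g, x⁆ * γ⁻¹ ∈ ⁅G, zpowers a⁆) →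
      ∀ n ∈ ⁅G, zpowers a⁆, γ * n * γ⁻¹ ∈ ⁅G, zpowers a⁆ := by
    intro γ hγ n hn
    have : ⁅G, zpowers a⁆ ≤ (⁅G, zpowers a⁆).comap (MulAut.conj γ).toMonoidHom := by
      rw [Subgroup.commutator_le]
      intro g hg x hx
      exact hγ g hg x hx
    exact this hn
  obtain ⟨g, hg, i, rfl⟩ := h.exists_mul γ
  have h1 : a ^ i * n * (a ^ i)⁻¹ ∈ ⁅G, zpowers a⁆ := by
    refine key _ ?_ n hn
    intro g hg x hx
    have hxa : a ^ i * x * (a ^ i)⁻¹ = x := by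
      obtain ⟨j, rfl⟩ := mem_zpowers_iff.1 hx
      rw [← zpow_add, ← zpow_neg, ← zpow_add]; congr 1; ring
    have : a ^ i * ⁅g, x⁆ * (a ^ i)⁻¹ = ⁅a ^ i * g * (a ^ i)⁻¹, x⁆ := by
      conv_rhs => rw [← hxa]
      simp only [commutatorElement_def]; group
    rw [this]
    exact commutator_mem_commutator (hG.conj_mem _ hg _) hx
  have h2 := key g (fun g' hg' x hx => by
    rw [commutator_conj_left]
    exact mul_mem (commutator_mem_commutator (G.mul_mem hg hg') hx)
      (inv_mem (commutator_mem_commutator hg hx))) _ h1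
  convert h2 using 1
  group

theorem Setup.exists_fixed_mul [Finite Γ] {G : Subgroup Γ} {a : Γ} {q : ℕ} (h : Setup G a q)
    {g : Γ} (hg : g ∈ G) : ∃ k ∈ fixedIn G a, ∃ y ∈ ⁅G, zpowers a⁆, g = k * y := by
  have hG := h.normal
  have hQ := h.comm_normal
  have hle : ⁅G, zpowers a⁆ ≤ G := commutator_zpowers_le a
  obtain ⟨y, hy, hy2⟩ := exists_fixed_of_coset (H := ⁅G, zpowers a⁆) (x := g)
    h.prime h.pow (fun y hy => hQ.conj_mem y hy a) (not_dvd_card_of_le h.cop hle) (by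
      have : g⁻¹ * (a * g * a⁻¹) = ⁅g⁻¹, a⁆ := by simp [commutatorElement_def, mul_assoc]
      rw [this]
      exact commutator_mem_commutator (G.inv_mem hg) (mem_zpowers a))
  exact ⟨g * y, mem_fixedIn.2 ⟨G.mul_mem hg (hle hy), hy2⟩, y⁻¹, inv_mem hy, by group⟩

theorem Setup.comm_comm [Finite Γ] {G : Subgroup Γ} {a : Γ} {q : ℕ} (h : Setup G a q) :
    ⁅⁅G, zpowers a⁆, zpowers a⁆ = ⁅G, zpowers a⁆ := by
  have hG := h.normal
  have hQ := h.comm_normal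
  apply le_antisymm
  · exact commutator_mono (commutator_zpowers_le a) le_rfl
  · rw [Subgroup.commutator_le]
    intro g hg x hx
    obtain ⟨k, hk, y, hy, rfl⟩ := h.exists_fixed_mul hg
    obtain ⟨i, rfl⟩ := mem_zpowers_iff.1 hx
    have hc := fixedIn_comm_zpow hk i
    have : ⁅k * y, a ^ i⁆ = ⁅k * y * k⁻¹, a ^ i⁆ := by
      have hc' : k⁻¹ * a ^ i = a ^ i * k⁻¹ := by
        rw [inv_mul_eq_iff_eq_mul, ← mul_assoc, ← hc, mul_assoc, mul_inv_cancel, mul_one]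
      simp only [commutatorElement_def, mul_inv_rev, inv_inv]
      have e1 : k * y * k⁻¹ * a ^ i * (k * (y⁻¹ * k⁻¹)) * (a ^ i)⁻¹
          = k * y * (k⁻¹ * a ^ i) * k * (y⁻¹ * k⁻¹) * (a ^ i)⁻¹ := by simp only [mul_assoc]
      rw [e1, hc']
      simp [mul_assoc]
    rw [this]
    exact commutator_mem_commutator (hQ.conj_mem _ hy k) hx

end Coprime

end FittingBound

namespace FittingBound

open Subgroup Module
open scoped commutatorElement

section Reps

variable {Γ k X : Type} [Group Γ] [Field k] [AddCommGroup X] [Module k X]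

/-- A submodule stable under the representation `ρ`. -/
def Stable (ρ : Γ →* End k X) (W : Submodule k X) : Prop := ∀ γ, ∀ x ∈ W, ρ γ x ∈ W

/-- Irreducibility of a representation. -/
structure Irr (ρ : Γ →* End k X) : Prop where
  nontrivial : Nontrivial X
  simple : ∀ W, Stable ρ W → W = ⊥ ∨ W = ⊤

/-- The action of a subgroup on a subspace that it leaves invariant. -/
def subRep (ρ : Γ →* End k X) (S : Subgroup Γ) (W : Submodule k X)
    (h : ∀ s ∈ S, ∀ x ∈ W, ρ s x ∈ W) : S →* End k W where
  toFun s := (ρ s).restrict (h s s.2)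
  map_one' := by ext x; simp
  map_mul' s t := by ext x; simp

/-- A nontrivial system of imprimitivity for `ρ`. -/
structure SOI (ρ : Γ →* End k X) {ι : Type} [MulAction Γ ι] (W : ι → Submodule k X) : Prop where
  smul : ∀ γ i x, x ∈ W i → ρ γ x ∈ W (γ • i)
  ne_bot : ∀ i, W i ≠ ⊥
  indep : iSupIndep W
  sup : ⨆ i, W i = ⊤
  trans : ∀ i j : ι, ∃ γ : Γ, γ • i = j
  nontriv : ∃ i j : ι, i ≠ j

/-- A primitive representation: there is no nontrivial system of imprimitivity. -/
def Prim (ρ : Γ →* End k X) : Prop :=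
  ∀ (ι : Type) [MulAction Γ ι] (W : ι → Submodule k X), ¬ SOI ρ W

@[simp] theorem rho_inv_apply (ρ : Γ →* End k X) (γ : Γ) (x : X) : ρ γ⁻¹ (ρ γ x) = x := by
  rw [← Module.End.mul_apply, ← map_mul, inv_mul_cancel, map_one, Module.End.one_apply]

@[simp] theorem rho_apply_inv (ρ : Γ →* End k X) (γ : Γ) (x : X) : ρ γ (ρ γ⁻¹ x) = x := by
  rw [← Module.End.mul_apply, ← map_mul, mul_inv_cancel, map_one, Module.End.one_apply]

theorem rho_mul_apply (ρ : Γ →* End k X) (γ δ : Γ) (x : X) : ρ (γ * δ) x = ρ γ (ρ δ x) := by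
  rw [map_mul, Module.End.mul_apply]

theorem rho_injective (ρ : Γ →* End k X) (γ : Γ) : Function.Injective (ρ γ) :=
  Function.LeftInverse.injective (rho_inv_apply ρ γ)

namespace SOI

variable {ρ : Γ →* End k X} {ι : Type} [MulAction Γ ι] {W : ι → Submodule k X}

theorem isCompl (h : SOI ρ W) (i : ι) : IsCompl (W i) (⨆ j, ⨆ (_ : j ≠ i), W j) := by
  refine ⟨h.indep i, ?_⟩
  rw [codisjoint_iff, ← top_le_iff, ← h.sup]
  refine iSup_le fun j => ?_
  by_cases hj : j = i
  · subst hj; exact le_sup_left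
  · exact le_sup_of_le_right (le_iSup₂_of_le j hj le_rfl)

/-- The projection to a member of a system of imprimitivity. -/
noncomputable def proj (h : SOI ρ W) (i : ι) : X →ₗ[k] X := Submodule.projection _ _ (h.isCompl i)

theorem proj_self (h : SOI ρ W) {i : ι} {x : X} (hx : x ∈ W i) : h.proj i x = x :=
  (Submodule.projection_eq_self_iff (h.isCompl i) x).2 hx

theorem proj_ne (h : SOI ρ W) {i j : ι} (hij : j ≠ i) {x : X} (hx : x ∈ W j) : h.proj i x = 0 :=
  (Submodule.projection_apply_eq_zero_iff (h.isCompl i)).2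
    ((le_iSup₂_of_le (f := fun j (_ : j ≠ i) => W j) j hij le_rfl) hx)

theorem ext_on (h : SOI ρ W) {Y : Type} [AddCommGroup Y] [Module k Y] {f g : X →ₗ[k] Y}
    (hfg : ∀ i, ∀ x ∈ W i, f x = g x) : f = g := by
  have : ⨆ i, W i ≤ LinearMap.eqLocus f g := iSup_le fun i x hx => hfg i x hx
  rw [h.sup] at this
  ext x
  exact this trivial

theorem proj_rho (h : SOI ρ W) (γ : Γ) (i : ι) (x : X) :
    h.proj (γ • i) (ρ γ x) = ρ γ (h.proj i x) := by
  have : h.proj (γ • i) ∘ₗ ρ γ = ρ γ ∘ₗ h.proj i := by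
    refine h.ext_on fun j y hy => ?_
    simp only [LinearMap.comp_apply]
    by_cases hj : j = i
    · subst hj
      rw [h.proj_self (h.smul γ _ y hy), h.proj_self hy]
    · rw [h.proj_ne (fun he => hj (MulAction.injective γ he)) (h.smul γ _ y hy), h.proj_ne hj hy,
        map_zero]
  exact LinearMap.congr_fun this x

theorem finite [FiniteDimensional k X] (h : SOI ρ W) : Finite ι :=
  WellFoundedGT.finite_of_iSupIndep h.indep h.ne_bot

theorem card_le [FiniteDimensional k X] (h : SOI ρ W) : Nat.card ι ≤ finrank k X := by
  have := h.finite
  have := Fintype.ofFinite ι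
  classical
  have e := h.indep.subtype_ne_bot_le_finrank
  have e2 : Nat.card { i // W i ≠ ⊥ } = Nat.card ι :=
    Nat.card_congr (Equiv.subtypeUnivEquiv h.ne_bot)
  rw [← e2, Nat.card_eq_fintype_card]; exact e

theorem ne_top (h : SOI ρ W) (i : ι) : W i ≠ ⊤ := by
  intro ht
  have : ∃ j, j ≠ i := by
    obtain ⟨a, b, hab⟩ := h.nontriv
    by_cases ha : a = i
    · exact ⟨b, fun hb => hab (ha.trans hb.symm)⟩
    · exact ⟨a, ha⟩
  obtain ⟨j, hj⟩ := this
  obtain ⟨x, hx, hx0⟩ := Submodule.exists_mem_ne_zero_of_ne_bot (h.ne_bot j)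
  apply hx0
  rw [← h.proj_self (i := i) (x := x) (ht ▸ trivial), h.proj_ne hj hx]

theorem finrank_lt [FiniteDimensional k X] (h : SOI ρ W) (i : ι) :
    finrank k (W i) < finrank k X := Submodule.finrank_lt (h.ne_top i)

theorem stab_mem (h : SOI ρ W) (i : ι) :
    ∀ s ∈ MulAction.stabilizer Γ i, ∀ x ∈ W i, ρ s x ∈ W i := by
  intro s hs x hx
  have := h.smul s i x hx
  rwa [MulAction.mem_stabilizer_iff.1 hs] at this

/-- The action of the stabilizer of a member of a system of imprimitivity. -/
def sub (h : SOI ρ W) (i : ι) : MulAction.stabilizer Γ i →* End k (W i) :=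
  subRep ρ _ _ (h.stab_mem i)

theorem sub_irr (h : SOI ρ W) (hρ : Irr ρ) (i : ι) : Irr (h.sub i) := by
  refine ⟨Submodule.nontrivial_iff_ne_bot.2 (h.ne_bot i), fun U hU => ?_⟩
  by_contra hcon
  push Not at hcon
  obtain ⟨h0, h1⟩ := hcon
  set V : Submodule k X := ⨆ γ : Γ, (U.map (W i).subtype).map (ρ γ) with hV
  have hVs : Stable ρ V := by
    intro γ x hx
    have : V ≤ V.comap (ρ γ) := by
      refine iSup_le fun δ => ?_
      rintro _ ⟨y, hy, rfl⟩
      refine (le_iSup (fun γ : Γ => (U.map (W i).subtype).map (ρ γ)) (γ * δ)) ⟨y, hy, ?_⟩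
      rw [rho_mul_apply]
    exact this hx
  have hVt : V = ⊤ := by
    refine (hρ.simple V hVs).resolve_left fun hb => h0 ?_
    have : (U.map (W i).subtype).map (ρ 1) ≤ ⊥ := hb ▸ le_iSup
      (fun γ : Γ => (U.map (W i).subtype).map (ρ γ)) 1
    rw [eq_bot_iff]
    intro u hu
    have := this ⟨(u : X), ⟨u, hu, rfl⟩, rfl⟩
    simpa using this
  have hp : V ≤ (U.map (W i).subtype).comap (h.proj i) := by
    refine iSup_le fun δ => ?_
    rintro _ ⟨_, ⟨u, hu, rfl⟩, rfl⟩
    by_cases hδ : δ • i = i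
    · have hm : ρ δ u ∈ W i := h.stab_mem i δ hδ u u.2
      rw [Submodule.mem_comap, Submodule.subtype_apply, h.proj_self hm]
      exact ⟨⟨ρ δ u, hm⟩, hU ⟨δ, hδ⟩ u hu, rfl⟩
    · rw [Submodule.mem_comap, Submodule.subtype_apply, h.proj_ne hδ (h.smul δ i u u.2)]
      exact zero_mem _
  apply h1
  rw [eq_top_iff]
  rintro x -
  have hxV : (x : X) ∈ V := by rw [hVt]; trivial
  have := hp hxV
  rw [Submodule.mem_comap, h.proj_self x.2] at this
  obtain ⟨u, hu, hux⟩ := this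
  have : u = x := Subtype.ext hux
  exact this ▸ hu

/-- An element acts trivially as soon as it fixes every member of the system pointwise. -/
theorem mem_ker_of (h : SOI ρ W) {γ : Γ} (hγ : ∀ i, ∀ x ∈ W i, ρ γ x = x) : γ ∈ ρ.ker := by
  rw [MonoidHom.mem_ker]
  exact h.ext_on (f := ρ γ) (g := 1) hγ

end SOI

/-- The elements acting as scalars. -/
def scal (ρ : Γ →* End k X) : Subgroup Γ where
  carrier := {γ | ∃ c : k, ρ γ = c • 1}
  one_mem' := ⟨1, by simp⟩
  mul_mem' := by
    rintro x y ⟨c, hc⟩ ⟨d, hd⟩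
    exact ⟨c * d, by rw [map_mul, hc, hd, smul_mul_smul_comm, one_mul]⟩
  inv_mem' := by
    rintro x ⟨c, hc⟩
    refine ⟨c⁻¹, ?_⟩
    ext v
    by_cases h0 : c = 0
    · have hz : ∀ w : X, w = 0 := fun w => by
        have := rho_inv_apply ρ x w
        rw [hc, h0] at this
        simpa using this.symm
      rw [hz (ρ x⁻¹ v), hz ((c⁻¹ • (1 : End k X)) v)]
    · apply rho_injective ρ x
      rw [rho_apply_inv, hc]
      simp [smul_smul, h0]

theorem mem_scal {ρ : Γ →* End k X} {γ : Γ} : γ ∈ scal ρ ↔ ∃ c : k, ρ γ = c • 1 := Iff.rfl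

theorem conj_eq_of_scal {ρ : Γ →* End k X} {z : Γ} (hz : z ∈ scal ρ) (γ : Γ) :
    ρ (γ * z * γ⁻¹) = ρ z := by
  obtain ⟨c, hc⟩ := hz
  ext v
  rw [rho_mul_apply, rho_mul_apply, hc]
  simp

instance scal_normal (ρ : Γ →* End k X) : (scal ρ).Normal := by
  refine ⟨fun z hz γ => ?_⟩
  obtain ⟨c, hc⟩ := hz
  exact ⟨c, by rw [conj_eq_of_scal ⟨c, hc⟩, hc]⟩

theorem ker_le_scal (ρ : Γ →* End k X) : ρ.ker ≤ scal ρ := fun γ hγ =>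
  ⟨1, by rw [MonoidHom.mem_ker.1 hγ, one_smul]⟩

theorem commutator_scal_le (ρ : Γ →* End k X) : ⁅scal ρ, (⊤ : Subgroup Γ)⁆ ≤ ρ.ker := by
  rw [Subgroup.commutator_le]
  intro z hz γ _
  rw [MonoidHom.mem_ker, commutatorElement_def]
  have : z * γ * z⁻¹ * γ⁻¹ = z * (γ * z⁻¹ * γ⁻¹) := by group
  rw [this, map_mul, conj_eq_of_scal (inv_mem hz), ← map_mul, mul_inv_cancel, map_one]

/-- A commuting set of operators has a common eigenvector. -/
theorem exists_common_eigenvector [IsAlgClosed k] [FiniteDimensional k X] [Nontrivial X]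
    {Z : Type} (f : Z → End k X) (hf : ∀ y z, Commute (f y) (f z)) :
    ∃ v : X, v ≠ 0 ∧ ∀ z, ∃ c : k, f z v = c • v := by
  obtain ⟨V, hV, hmin⟩ := WellFounded.has_min (wellFounded_lt (α := Submodule k X))
    {V | V ≠ ⊥ ∧ ∀ z, ∀ v ∈ V, f z v ∈ V} ⟨⊤, top_ne_bot, fun _ _ _ => trivial⟩
  obtain ⟨hV0, hVs⟩ := hV
  obtain ⟨v, hv, hv0⟩ := Submodule.exists_mem_ne_zero_of_ne_bot hV0
  refine ⟨v, hv0, fun z => ?_⟩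
  have : Nontrivial V := Submodule.nontrivial_iff_ne_bot.2 hV0
  obtain ⟨c, hc⟩ := Module.End.exists_eigenvalue ((f z).restrict (hVs z))
  obtain ⟨w, hw⟩ := hc.exists_hasEigenvector
  have hwz : f z w = c • (w : X) := congrArg Subtype.val hw.apply_eq_smul
  have hle : V ≤ (f z).eigenspace c := by
    by_contra hcon
    refine hmin (V ⊓ (f z).eigenspace c) ⟨?_, ?_⟩ ?_
    · refine Submodule.ne_bot_iff _ |>.2 ⟨w, ⟨w.2, Module.End.mem_eigenspace_iff.2 hwz⟩, ?_⟩
      simpa using hw.2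
    · rintro y u ⟨hu1, hu2⟩
      refine ⟨hVs y u hu1, ?_⟩
      rw [SetLike.mem_coe, Module.End.mem_eigenspace_iff] at hu2 ⊢
      rw [← Module.End.mul_apply, (hf z y).eq, Module.End.mul_apply, hu2, map_smul]
    · exact lt_of_le_of_ne inf_le_left fun he => hcon (inf_eq_left.1 he)
  exact ⟨c, Module.End.mem_eigenspace_iff.1 (hle hv)⟩

/-- In a primitive irreducible representation every normal subgroup that acts commutatively
acts by scalars. -/
theorem le_scal_of_commute [IsAlgClosed k] [FiniteDimensional k X] {ρ : Γ →* End k X}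
    (hρ : Irr ρ) (hp : Prim ρ) {Z : Subgroup Γ} [hZ : Z.Normal]
    (hc : ∀ y ∈ Z, ∀ z ∈ Z, Commute (ρ y) (ρ z)) : Z ≤ scal ρ := by
  have := hρ.nontrivial
  obtain ⟨v, hv0, hv⟩ := exists_common_eigenvector (fun z : Z => ρ z)
    (fun y z => hc y y.2 z z.2)
  choose χ hχ using hv
  let E : (Z → k) → Submodule k X := fun μ => ⨅ z : Z, (ρ z).eigenspace (μ z)
  have hmem : ∀ μ x, x ∈ E μ ↔ ∀ z : Z, ρ z x = μ z • x := by
    intro μ x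
    simp [E, Submodule.mem_iInf]
  have hind : iSupIndep E := by
    refine (Module.End.independent_iInf_maxGenEigenspace_of_forall_mapsTo (fun z : Z => ρ z)
      ?_).mono ?_
    · intro y z φ
      exact Module.End.mapsTo_maxGenEigenspace_of_comm (hc z z.2 y y.2) φ
    · intro μ
      exact iInf_mono fun z => ((ρ z).genEigenspace (μ z)).monotone le_top
  let act : MulAction Γ (Z → k) :=
    { smul := fun γ μ z => μ ⟨γ⁻¹ * z * γ, by simpa using hZ.conj_mem z z.2 γ⁻¹⟩
      one_smul := fun μ => by
        funext z
        change μ _ = μ z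
        congr 1; ext; simp
      mul_smul := fun γ δ μ => by
        funext z
        change μ _ = μ _
        congr 1; ext; simp [mul_assoc] }
  have hact : ∀ γ (μ : Z → k) (z : Z), (γ • μ) z =
    μ ⟨γ⁻¹ * z * γ, by simpa using hZ.conj_mem z z.2 γ⁻¹⟩ := fun _ _ _ => rfl
  have hperm : ∀ γ μ x, x ∈ E μ → ρ γ x ∈ E (γ • μ) := by
    intro γ μ x hx
    rw [hmem] at hx ⊢
    intro z
    rw [hact, ← map_smul, ← hx, ← rho_mul_apply, ← rho_mul_apply]
    congr 2
    simp [mul_assoc]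
  let W : MulAction.orbit Γ χ → Submodule k X := fun i => E i
  have hvχ : v ∈ E χ := (hmem χ v).2 hχ
  have hsup : ⨆ i, W i = ⊤ := by
    refine (hρ.simple _ fun γ x hx => ?_).resolve_left fun hb => hv0 ?_
    · have : ⨆ i, W i ≤ (⨆ i, W i).comap (ρ γ) := by
        refine iSup_le fun i y hy => ?_
        exact (le_iSup W (γ • i)) (hperm γ i y hy)
      exact this hx
    · have : v ∈ ⨆ i, W i := (le_iSup W ⟨χ, MulAction.mem_orbit_self χ⟩) hvχ
      rw [hb] at this
      simpa using this
  have htriv : ∀ i j : MulAction.orbit Γ χ, i = j := by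
    by_contra hcon
    push Not at hcon
    refine hp (MulAction.orbit Γ χ) W ⟨fun γ i x hx => hperm γ i x hx, ?_,
      hind.comp Subtype.val_injective, hsup, fun i j => MulAction.exists_smul_eq Γ i j, hcon⟩
    rintro ⟨_, ⟨γ, rfl⟩⟩
    exact (Submodule.ne_bot_iff _).2 ⟨ρ γ v, hperm γ χ v hvχ, fun h0 => hv0
      (rho_injective ρ γ (h0.trans (map_zero _).symm))⟩
  have htop : E χ = ⊤ := by
    rw [eq_top_iff, ← hsup]
    refine iSup_le fun i => ?_
    rw [htriv i ⟨χ, MulAction.mem_orbit_self χ⟩]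
  intro z hz
  refine ⟨χ ⟨z, hz⟩, ?_⟩
  ext x
  have : x ∈ E χ := htop ▸ trivial
  exact (hmem χ x).1 this ⟨z, hz⟩

end Reps

end FittingBound

namespace FittingBound

open Subgroup Module
open scoped commutatorElement

section Chief

variable {Γ : Type*} [Group Γ]

/-- `P / N` is a chief factor. -/
structure IsChief (N P : Subgroup Γ) : Prop where
  normal_left : N.Normal
  normal_right : P.Normal
  lt : N < P
  eq_or : ∀ Q : Subgroup Γ, Q.Normal → N ≤ Q → Q ≤ P → Q = N ∨ Q = P

theorem exists_chief_le [Finite Γ] {S P : Subgroup Γ} [hS : S.Normal] [hP : P.Normal]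
    (h : S < P) : ∃ N, S ≤ N ∧ IsChief N P := by
  obtain ⟨N, ⟨hN1, hN2, hN3⟩, hmax⟩ := WellFounded.has_min
    (wellFounded_gt (α := Subgroup Γ)) {N | S ≤ N ∧ N < P ∧ N.Normal} ⟨S, le_rfl, h, hS⟩
  refine ⟨N, hN1, hN3, hP, hN2, fun Q hQ hNQ hQP => ?_⟩
  by_contra hcon
  push Not at hcon
  exact hmax Q ⟨hN1.trans hNQ, lt_of_le_of_ne hQP hcon.2, hQ⟩ (lt_of_le_of_ne hNQ hcon.1.symm)

theorem commutator_le_iff {A B N : Subgroup Γ} [N.Normal] :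
    ⁅A, B⁆ ≤ N ↔
      A ≤ (centralizer (B.map (QuotientGroup.mk' N) : Set (Γ ⧸ N))).comap (QuotientGroup.mk' N) := by
  rw [← map_le_iff_le_comap, ← commutator_eq_bot_iff_le_centralizer, ← map_commutator,
    Subgroup.map_eq_bot_iff, QuotientGroup.ker_mk']

theorem sup_commutator_le {A B C N : Subgroup Γ} [N.Normal] (h1 : ⁅A, C⁆ ≤ N) (h2 : ⁅B, C⁆ ≤ N) :
    ⁅A ⊔ B, C⁆ ≤ N := by
  rw [commutator_le_iff] at *
  exact sup_le h1 h2

theorem commutator_sup_le {A B C N : Subgroup Γ} [N.Normal] (h1 : ⁅C, A⁆ ≤ N) (h2 : ⁅C, B⁆ ≤ N) :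
    ⁅C, A ⊔ B⁆ ≤ N := by
  rw [commutator_comm] at *
  exact sup_commutator_le h1 h2

theorem three_subgroups {A B C N : Subgroup Γ} [N.Normal] (h1 : ⁅⁅B, C⁆, A⁆ ≤ N)
    (h2 : ⁅⁅C, A⁆, B⁆ ≤ N) : ⁅⁅A, B⁆, C⁆ ≤ N := by
  rw [← QuotientGroup.ker_mk' N, ← Subgroup.map_eq_bot_iff] at *
  simp only [map_commutator] at *
  exact commutator_commutator_eq_bot_of_rotate h1 h2

/-- Iterated commutators `[B, J, …, J]`. -/
def bser (B J : Subgroup Γ) : ℕ → Subgroup Γ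
  | 0 => B
  | n + 1 => ⁅bser B J n, J⁆

instance bser_normal (B J : Subgroup Γ) [B.Normal] [J.Normal] (n : ℕ) : (bser B J n).Normal := by
  induction n with
  | zero => assumption
  | succ n ih => exact Subgroup.commutator_normal _ _

theorem bser_antitone (B J : Subgroup Γ) [B.Normal] [J.Normal] : Antitone (bser B J) :=
  antitone_nat_of_succ_le fun _ => commutator_le_left _ _

theorem commutator_bser_lcs (B J : Subgroup Γ) [B.Normal] [J.Normal] (i j : ℕ) :
    ⁅bser B J i, lcs J j⁆ ≤ bser B J (i + j + 1) := by
  induction j generalizing i with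
  | zero => exact le_rfl
  | succ j ih =>
    rw [lcs_succ, commutator_comm]
    apply three_subgroups
    · rw [commutator_comm J]
      have := ih (i + 1)
      have e : i + 1 + j + 1 = i + (j + 1) + 1 := by ring
      rw [e] at this
      exact this
    · exact commutator_mono (ih i) le_rfl

/-- If `J` centralizes every chief factor between `S` and `B` then `[B, J, …, J] ≤ S`. -/
theorem exists_bser_le [Finite Γ] {B J S : Subgroup Γ} [B.Normal] [J.Normal] [S.Normal]
    (hSB : S ≤ B) (h : ∀ N P, IsChief N P → S ≤ N → P ≤ B → ⁅P, J⁆ ≤ N) :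
    ∃ l, bser B J l ≤ S := by
  obtain ⟨n, hn⟩ := WellFoundedLT.antitone_chain_condition (bser_antitone B J)
  refine ⟨n, ?_⟩
  have hst : bser B J n = ⁅bser B J n, J⁆ := hn (n + 1) (Nat.le_succ n)
  by_contra hcon
  have hlt : S < S ⊔ bser B J n := left_lt_sup.2 hcon
  obtain ⟨N, hSN, hN⟩ := exists_chief_le hlt
  have h1 := h N _ hN hSN (sup_le hSB (bser_antitone B J (Nat.zero_le n)))
  have h2 : bser B J n ≤ N := by
    rw [hst]; exact (commutator_mono le_sup_right le_rfl).trans h1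
  exact hN.lt.not_ge (sup_le hSN h2)

end Chief

section Primitive

variable {Γ k X : Type} [Group Γ] [Field k] [AddCommGroup X] [Module k X]

/-- `B` is a maximal normal subgroup of `Γ` contained in `G` that is abelian modulo scalars. -/
structure MaxAb (ρ : Γ →* End k X) (G B : Subgroup Γ) : Prop where
  normal : B.Normal
  le : B ≤ G
  scal_le : G ⊓ scal ρ ≤ B
  comm : ⁅B, B⁆ ≤ scal ρ
  max : ∀ B' : Subgroup Γ, B'.Normal → B ≤ B' → B' ≤ G → ⁅B', B'⁆ ≤ scal ρ → B' = B

theorem exists_maxAb [Finite Γ] (ρ : Γ →* End k X) (G : Subgroup Γ) [G.Normal] :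
    ∃ B, MaxAb ρ G B := by
  obtain ⟨B, ⟨h1, h2, h3, h4⟩, hmax⟩ := WellFounded.has_min
    (wellFounded_gt (α := Subgroup Γ))
    {B | B.Normal ∧ B ≤ G ∧ G ⊓ scal ρ ≤ B ∧ ⁅B, B⁆ ≤ scal ρ}
    ⟨G ⊓ scal ρ, inferInstance, inf_le_left, le_rfl,
      (commutator_mono inf_le_right le_top).trans ((commutator_scal_le ρ).trans (ker_le_scal ρ))⟩
  refine ⟨B, h1, h2, h3, h4, fun B' hB' hle hG hc => ?_⟩
  by_contra hne
  exact hmax B' ⟨hB', hG, h3.trans hle, hc⟩ (lt_of_le_of_ne hle (Ne.symm hne))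

/-- The elements commuting with `B` in the representation `ρ`. -/
def repCent (ρ : Γ →* End k X) (B : Subgroup Γ) : Subgroup Γ where
  carrier := {c | ∀ b ∈ B, Commute (ρ c) (ρ b)}
  one_mem' := fun b _ => by rw [map_one]; exact Commute.one_left _
  mul_mem' := fun {x y} hx hy b hb => by rw [map_mul]; exact (hx b hb).mul_left (hy b hb)
  inv_mem' := fun {x} hx b hb => by
    have h : ρ x * ρ b = ρ b * ρ x := hx b hb
    have e : ρ x⁻¹ * ρ x = 1 := by rw [← map_mul, inv_mul_cancel, map_one]
    have e' : ρ x * ρ x⁻¹ = 1 := by rw [← map_mul, mul_inv_cancel, map_one]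
    calc ρ x⁻¹ * ρ b = ρ x⁻¹ * (ρ b * ρ x) * ρ x⁻¹ := by
          rw [mul_assoc, mul_assoc, e', mul_one]
      _ = ρ b * ρ x⁻¹ := by rw [← h, ← mul_assoc, e, one_mul]

theorem commute_iff_mem_ker {ρ : Γ →* End k X} {x y : Γ} :
    Commute (ρ x) (ρ y) ↔ ⁅x, y⁆ ∈ ρ.ker := by
  rw [MonoidHom.mem_ker, commutatorElement_def]
  constructor
  · intro h
    have e : x * y * x⁻¹ * y⁻¹ = x * y * (y * x)⁻¹ := by group
    rw [e, map_mul, map_mul, h.eq, ← map_mul, ← map_mul, mul_inv_cancel, map_one]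
  · intro h
    have e : x * y = x * y * x⁻¹ * y⁻¹ * (y * x) := by group
    have := congrArg ρ e
    rw [map_mul ρ (x * y * x⁻¹ * y⁻¹), h, one_mul, map_mul, map_mul] at this
    exact this

instance repCent_normal (ρ : Γ →* End k X) (B : Subgroup Γ) [hB : B.Normal] :
    (repCent ρ B).Normal := by
  refine ⟨fun c hc γ b hb => ?_⟩
  have := hc _ (hB.conj_mem b hb γ⁻¹)
  rw [commute_iff_mem_ker] at *
  have h2 := (MonoidHom.normal_ker ρ).conj_mem _ this γ
  convert h2 using 1
  simp only [commutatorElement_def]; group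

theorem MaxAb.mem_scal_of_commute [Finite Γ] [IsAlgClosed k] [FiniteDimensional k X]
    {ρ : Γ →* End k X} (hρ : Irr ρ) (hp : Prim ρ) {G B : Subgroup Γ} [G.Normal] (hG : Sol G)
    (hB : MaxAb ρ G B) {c : Γ} (hc : c ∈ G) (hcB : ∀ b ∈ B, Commute (ρ c) (ρ b)) :
    c ∈ scal ρ := by
  have := hB.normal
  suffices h : G ⊓ repCent ρ B ≤ scal ρ from h ⟨hc, hcB⟩
  by_contra hcon
  obtain ⟨i, hi1, hi2⟩ := (hG.mono inf_le_left : Sol (G ⊓ repCent ρ B)).exists_der hcon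
  set R := der (G ⊓ repCent ρ B) i with hR
  have hRC : R ≤ G ⊓ repCent ρ B := der_le_self _ _
  have hRB : ⁅R, B⁆ ≤ scal ρ := by
    rw [Subgroup.commutator_le]
    intro r hr b hb
    exact ker_le_scal ρ (commute_iff_mem_ker.1 ((hRC hr).2 b hb))
  have hRn : R.Normal := der_normal _ _
  have hmax := hB.max (B ⊔ R) inferInstance le_sup_left (sup_le hB.le (hRC.trans inf_le_left))
    (sup_commutator_le (commutator_sup_le hB.comm (by rw [commutator_comm]; exact hRB))
      (commutator_sup_le hRB hi2))
  have hRleB : R ≤ B := hmax ▸ le_sup_right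
  apply hi1
  have : (B ⊓ repCent ρ B) ≤ scal ρ :=
    le_scal_of_commute hρ hp (fun y hy z hz => hy.2 z hz.1)
  exact (le_inf hRleB (hRC.trans inf_le_right)).trans this

/-- A normal subgroup centralizing all chief factors below `B` acts nilpotently. -/
theorem MaxAb.res_le_ker [Finite Γ] [IsAlgClosed k] [FiniteDimensional k X]
    {ρ : Γ →* End k X} (hρ : Irr ρ) (hp : Prim ρ) {G B J : Subgroup Γ} [G.Normal] (hG : Sol G)
    (hB : MaxAb ρ G B) [J.Normal] (hJ : J ≤ G)
    (h : ∀ N P, IsChief N P → G ⊓ scal ρ ≤ N → P ≤ B → ⁅P, J⁆ ≤ N) : res J ≤ ρ.ker := by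
  have := hB.normal
  obtain ⟨l, hl⟩ := exists_bser_le hB.scal_le h
  have h1 : ⁅B, lcs J l⁆ ≤ ρ.ker := by
    refine (commutator_bser_lcs B J 0 l).trans ?_
    rw [zero_add]
    exact (commutator_mono (hl.trans inf_le_right) le_top).trans (commutator_scal_le ρ)
  have h2 : lcs J l ≤ scal ρ := fun c hc =>
    hB.mem_scal_of_commute hρ hp hG (hJ (lcs_le_self _ _ hc)) fun b hb =>
      (commute_iff_mem_ker.2 (h1 (commutator_mem_commutator hb hc))).symm
  exact res_le_of_lcs_le (n := l + 1)
    ((commutator_mono h2 le_top).trans (commutator_scal_le ρ))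

end Primitive

end FittingBound

namespace FittingBound

open Subgroup Module
open scoped commutatorElement TensorProduct

section ChiefRep

variable {Γ : Type} [Group Γ]

theorem IsChief.comm_le {N P : Subgroup Γ} (h : IsChief N P) (hP : Sol P) : ⁅P, P⁆ ≤ N := by
  have := h.normal_left
  have := h.normal_right
  obtain ⟨i, hi1, hi2⟩ := hP.exists_der h.lt.not_ge
  have : der P i ⊔ N = P := by
    refine (h.eq_or _ inferInstance le_sup_right (sup_le (der_le_self P i) h.lt.le)).resolve_left ?_
    intro he
    exact hi1 (he ▸ le_sup_left)
  rw [← this]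
  have hN : ∀ A : Subgroup Γ, ⁅N, A⁆ ≤ N := fun A => commutator_le_left N A
  have hN' : ∀ A : Subgroup Γ, ⁅A, N⁆ ≤ N := fun A => commutator_le_right A N
  exact sup_commutator_le (commutator_sup_le hi2 (hN' _)) (hN _)

/-- The representation `ρ` is generated by an equivariant image of the chief factor `P / N`. -/
structure ChiefRep {k X : Type} [Field k] [AddCommGroup X] [Module k X] (N P : Subgroup Γ)
    (ρ : Γ →* End k X) (j : Γ → X) : Prop where
  irr : Irr ρ
  mul : ∀ x ∈ P, ∀ y ∈ P, j (x * y) = j x + j y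
  conj : ∀ γ, ∀ x ∈ P, j (γ * x * γ⁻¹) = ρ γ (j x)
  zero : ∀ x ∈ P, (j x = 0 ↔ x ∈ N)
  span : Submodule.span k (j '' P) = ⊤

/-- A nonzero modular representation over a prime field has an irreducible quotient of its
scalar extension. -/
theorem exists_irr_quotient {k₀ V : Type} [Field k₀] [AddCommGroup V] [Module k₀ V]
    [FiniteDimensional k₀ V] [Nontrivial V] (τ : Γ →* End k₀ V) (k : Type) [Field k]
    [Algebra k₀ k] :
    ∃ (X : Type) (_ : AddCommGroup X) (_ : Module k X) (_ : FiniteDimensional k X)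
      (ρ : Γ →* End k X) (j : V →+ X), Irr ρ ∧ (∀ γ v, j (τ γ v) = ρ γ (j v)) ∧
      Submodule.span k (Set.range j) = ⊤ := by
  let Y := k ⊗[k₀] V
  let σ : Γ →* End k Y :=
    { toFun := fun γ => (τ γ).baseChange k
      map_one' := by ext; simp
      map_mul' := fun γ δ => by ext; simp }
  have hσ : ∀ γ c v, σ γ (c ⊗ₜ v) = c ⊗ₜ τ γ v := fun γ c v => rfl
  have : Nontrivial Y := inferInstance
  obtain ⟨U, ⟨hU1, hU2⟩, hmax⟩ := WellFounded.has_min (wellFounded_gt (α := Submodule k Y))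
    {U | U ≠ ⊤ ∧ Stable σ U} ⟨⊥, bot_ne_top, fun γ x hx => by
      rw [Submodule.mem_bot] at hx ⊢; rw [hx, map_zero]⟩
  let ρ : Γ →* End k (Y ⧸ U) :=
    { toFun := fun γ => U.mapQ U (σ γ) (hU2 γ)
      map_one' := by ext; simp
      map_mul' := fun γ δ => by ext; simp }
  have hρ : ∀ γ y, ρ γ (U.mkQ y) = U.mkQ (σ γ y) := fun γ y => rfl
  refine ⟨Y ⧸ U, inferInstance, inferInstance, inferInstance, ρ,
    (U.mkQ.toAddMonoidHom).comp ((TensorProduct.mk k₀ k V 1).toAddMonoidHom), ?_, ?_, ?_⟩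
  · refine ⟨Submodule.Quotient.nontrivial_iff.2 hU1, fun W hW => ?_⟩
    have hWs : Stable σ (W.comap U.mkQ) := by
      intro γ y hy
      rw [Submodule.mem_comap] at hy ⊢
      rw [← hρ]
      exact hW γ _ hy
    have hle : U ≤ W.comap U.mkQ := Submodule.le_comap_mkQ U W
    by_cases ht : W.comap U.mkQ = ⊤
    · right
      rw [← Submodule.map_comap_eq_of_surjective U.mkQ_surjective W, ht, Submodule.map_top,
        Submodule.range_mkQ]
    · left
      have := eq_of_le_of_not_lt hle (hmax _ ⟨ht, hWs⟩)
      rw [← Submodule.map_comap_eq_of_surjective U.mkQ_surjective W, ← this, Submodule.mkQ_map_self]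
  · intro γ v
    rfl
  · rw [eq_top_iff]
    rintro z -
    obtain ⟨y, rfl⟩ := U.mkQ_surjective z
    induction y using TensorProduct.induction_on with
    | zero => rw [map_zero]; exact zero_mem _
    | add y₁ y₂ h1 h2 => rw [map_add]; exact add_mem h1 h2
    | tmul c v =>
      have : (c ⊗ₜ[k₀] v : Y) = c • (1 ⊗ₜ[k₀] v) := by
        rw [TensorProduct.smul_tmul', smul_eq_mul, mul_one]
      rw [this, map_smul]
      exact Submodule.smul_mem _ _ (Submodule.subset_span ⟨v, rfl⟩)

theorem mul_pow_mem_of_comm {N P : Subgroup Γ} [hN : N.Normal] (hc : ⁅P, P⁆ ≤ N) {x y : Γ}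
    (hx : x ∈ P) (hy : y ∈ P) (n : ℕ) :
    (QuotientGroup.mk ((x * y) ^ n) : Γ ⧸ N) = QuotientGroup.mk (x ^ n * y ^ n) := by
  have h : Commute (QuotientGroup.mk x : Γ ⧸ N) (QuotientGroup.mk y) := by
    have h1 : ⁅x, y⁆ ∈ N := hc (commutator_mem_commutator hx hy)
    rw [← QuotientGroup.eq_one_iff] at h1
    have h2 : ⁅(x : Γ ⧸ N), (y : Γ ⧸ N)⁆ = 1 := h1
    exact commutatorElement_eq_one_iff_commute.1 h2
  simp only [QuotientGroup.mk_pow, QuotientGroup.mk_mul]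
  exact h.mul_pow n

theorem IsChief.exists_prime [Finite Γ] {N P : Subgroup Γ} (h : IsChief N P) (hc : ⁅P, P⁆ ≤ N) :
    ∃ t : ℕ, t.Prime ∧ t ∣ N.relIndex P ∧ ∀ x ∈ P, x ^ t ∈ N := by
  have := h.normal_left
  have hPn := h.normal_right
  have h1 : N.relIndex P ≠ 1 := fun h1 => h.lt.not_ge (relIndex_eq_one.1 h1)
  obtain ⟨t, ht, htd⟩ := Nat.exists_prime_and_dvd h1
  refine ⟨t, ht, htd, ?_⟩
  let Q : Subgroup Γ :=
    { carrier := {x | x ∈ P ∧ x ^ t ∈ N}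
      one_mem' := ⟨P.one_mem, by simp⟩
      mul_mem' := fun {x y} hx hy => ⟨P.mul_mem hx.1 hy.1, by
        rw [← QuotientGroup.eq_one_iff, mul_pow_mem_of_comm hc hx.1 hy.1,
          QuotientGroup.eq_one_iff]
        exact N.mul_mem hx.2 hy.2⟩
      inv_mem' := fun {x} hx => ⟨P.inv_mem hx.1, by rw [inv_pow]; exact N.inv_mem hx.2⟩ }
  have hQn : Q.Normal := ⟨fun x hx γ => ⟨hPn.conj_mem x hx.1 γ, by
    rw [conj_pow]; exact h.normal_left.conj_mem _ hx.2 γ⟩⟩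
  have hQ : Q = P := by
    refine (h.eq_or Q hQn (fun x hx => ⟨h.lt.le hx, N.pow_mem hx t⟩) fun x hx => hx.1).resolve_left
      fun he => ?_
    have := Fact.mk ht
    obtain ⟨x, hx⟩ := exists_prime_orderOf_dvd_card' (G := P ⧸ N.subgroupOf P) t htd
    obtain ⟨y, rfl⟩ := QuotientGroup.mk_surjective x
    have hy : (y : Γ) ∈ Q := by
      refine ⟨y.2, ?_⟩
      have := pow_orderOf_eq_one (QuotientGroup.mk y : P ⧸ N.subgroupOf P)
      rw [hx, ← QuotientGroup.mk_pow, QuotientGroup.eq_one_iff, mem_subgroupOf] at this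
      simpa using this
    rw [he] at hy
    have h2 : (QuotientGroup.mk y : P ⧸ N.subgroupOf P) = 1 := by
      rwa [QuotientGroup.eq_one_iff, mem_subgroupOf]
    rw [h2, orderOf_one] at hx
    exact ht.one_lt.ne hx
  intro x hx
  rw [← hQ] at hx
  exact hx.2

/-- A group acting on an elementary abelian group acts linearly on its additive version. -/
def zmodRep (t : ℕ) {Q : Type} [CommGroup Q] [Module (ZMod t) (Additive Q)]
    (c : Γ →* Monoid.End Q) : Γ →* End (ZMod t) (Additive Q) where
  toFun γ := (MonoidHom.toAdditive (c γ)).toZModLinearMap t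
  map_one' := by rw [map_one]; rfl
  map_mul' γ δ := by rw [map_mul]; rfl

theorem exists_irr_quotient_zmod {t : ℕ} [Fact t.Prime] {Q : Type} [CommGroup Q] [Finite Q]
    [Nontrivial Q] (hQ : ∀ v : Q, v ^ t = 1) (c : Γ →* Monoid.End Q) :
    ∃ (X : Type) (_ : AddCommGroup X) (_ : Module (AlgebraicClosure (ZMod t)) X)
      (_ : FiniteDimensional (AlgebraicClosure (ZMod t)) X)
      (ρ : Γ →* End (AlgebraicClosure (ZMod t)) X) (j : Additive Q →+ X), Irr ρ ∧
      (∀ γ v, j (Additive.ofMul (c γ v)) = ρ γ (j (Additive.ofMul v))) ∧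
      Submodule.span (AlgebraicClosure (ZMod t)) (Set.range j) = ⊤ := by
  let md : Module (ZMod t) (Additive Q) := AddCommGroup.zmodModule (n := t) fun v =>
    congrArg Additive.ofMul (hQ (Additive.toMul v))
  have : FiniteDimensional (ZMod t) (Additive Q) := Module.Finite.of_finite
  obtain ⟨X, i1, i2, i3, ρ, j, hirr, hj, hspan⟩ :=
    exists_irr_quotient (zmodRep t c) (AlgebraicClosure (ZMod t))
  exact ⟨X, i1, i2, i3, ρ, j, hirr, fun γ v => hj γ (Additive.ofMul v), hspan⟩

theorem IsChief.exists_chiefRep [Finite Γ] {N P : Subgroup Γ} (h : IsChief N P)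
    (hc : ⁅P, P⁆ ≤ N) : ∃ t : ℕ, t.Prime ∧ t ∣ N.relIndex P ∧ (∀ x ∈ P, x ^ t ∈ N) ∧
      ∃ (k : Type) (_ : Field k) (_ : IsAlgClosed k) (_ : CharP k t) (X : Type)
        (_ : AddCommGroup X) (_ : Module k X) (_ : FiniteDimensional k X)
        (ρ : Γ →* End k X) (j : Γ → X), ChiefRep N P ρ j := by
  obtain ⟨t, ht, htd, htp⟩ := h.exists_prime hc
  refine ⟨t, ht, htd, htp, ?_⟩
  have := Fact.mk ht
  have hNn := h.normal_left
  have hPn := h.normal_right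
  let Q := P ⧸ N.subgroupOf P
  let cg : CommGroup Q :=
    { (inferInstance : Group Q) with
      mul_comm := by
        intro a b
        obtain ⟨x, rfl⟩ := QuotientGroup.mk_surjective a
        obtain ⟨y, rfl⟩ := QuotientGroup.mk_surjective b
        rw [← QuotientGroup.mk_mul, ← QuotientGroup.mk_mul, QuotientGroup.eq, mem_subgroupOf]
        have := hc (commutator_mem_commutator (P.inv_mem y.2) (P.inv_mem x.2))
        simpa [commutatorElement_def, mul_assoc] using this }
  have : Finite Q := inferInstance
  have : Nontrivial Q := by
    obtain ⟨x, hx, hxN⟩ := SetLike.exists_of_lt h.lt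
    refine ⟨(QuotientGroup.mk ⟨x, hx⟩ : Q), 1, fun he => hxN ?_⟩
    have : (QuotientGroup.mk ⟨x, hx⟩ : Q) = 1 := he
    rwa [QuotientGroup.eq_one_iff, mem_subgroupOf] at this
  let cj (γ : Γ) : P →* P := (MulAut.conjNormal γ : MulAut P).toMonoidHom
  have hcj : ∀ γ (x : P), ((cj γ x : P) : Γ) = γ * x * γ⁻¹ := fun γ x => rfl
  let cq (γ : Γ) : Q →* Q := QuotientGroup.map _ _ (cj γ) (fun x hx => by
    rw [mem_comap, mem_subgroupOf, hcj]
    exact hNn.conj_mem _ hx γ)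
  have hcq : ∀ γ (x : P), cq γ (QuotientGroup.mk x) = QuotientGroup.mk (cj γ x) := fun γ x => rfl
  let ce : Γ →* Monoid.End Q :=
    { toFun := cq
      map_one' := MonoidHom.ext fun v => by
        obtain ⟨x, rfl⟩ := QuotientGroup.mk_surjective v
        change _ = (QuotientGroup.mk x : Q)
        rw [hcq]; congr 1; ext; rw [hcj]; simp
      map_mul' := fun γ δ => MonoidHom.ext fun v => by
        obtain ⟨x, rfl⟩ := QuotientGroup.mk_surjective v
        change _ = cq γ (cq δ (QuotientGroup.mk x))
        rw [hcq, hcq, hcq]; congr 1; ext; simp only [hcj]; group }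
  have hexp : ∀ v : Q, v ^ t = 1 := by
    intro v
    obtain ⟨x, rfl⟩ := QuotientGroup.mk_surjective v
    rw [← QuotientGroup.mk_pow, QuotientGroup.eq_one_iff, mem_subgroupOf]
    exact htp x x.2
  let k := AlgebraicClosure (ZMod t)
  obtain ⟨X, i1, i2, i3, ρ, j, hirr, hj, hspan⟩ := exists_irr_quotient_zmod hexp ce
  classical
  let jj : Γ → X := fun x => if hx : x ∈ P then j (Additive.ofMul (QuotientGroup.mk ⟨x, hx⟩ : Q)) else 0
  have hjj : ∀ x (hx : x ∈ P), jj x = j (Additive.ofMul (QuotientGroup.mk ⟨x, hx⟩ : Q)) :=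
    fun x hx => dif_pos hx
  have hmul : ∀ x ∈ P, ∀ y ∈ P, jj (x * y) = jj x + jj y := by
    intro x hx y hy
    rw [hjj _ hx, hjj _ hy, hjj _ (P.mul_mem hx hy), ← map_add]
    rfl
  have hconj : ∀ γ, ∀ x ∈ P, jj (γ * x * γ⁻¹) = ρ γ (jj x) := by
    intro γ x hx
    rw [hjj _ hx, hjj _ (hPn.conj_mem x hx γ), ← hj]
    rfl
  have hsp : Submodule.span k (jj '' P) = ⊤ := by
    rw [eq_top_iff, ← hspan, Submodule.span_le]
    rintro _ ⟨v, rfl⟩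
    obtain ⟨x, hx⟩ := QuotientGroup.mk_surjective (Additive.toMul v)
    refine Submodule.subset_span ⟨x, x.2, ?_⟩
    rw [hjj _ x.2]
    congr 1
  have hN0 : ∀ x ∈ N, jj x = 0 := by
    intro x hx
    rw [hjj _ (h.lt.le hx)]
    have : (QuotientGroup.mk ⟨x, h.lt.le hx⟩ : Q) = 1 := by
      rwa [QuotientGroup.eq_one_iff, mem_subgroupOf]
    rw [this, ofMul_one, map_zero]
  let R : Subgroup Γ :=
    { carrier := {x | x ∈ P ∧ jj x = 0}
      one_mem' := ⟨P.one_mem, hN0 1 N.one_mem⟩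
      mul_mem' := fun {x y} hx hy => ⟨P.mul_mem hx.1 hy.1, by
        rw [hmul _ hx.1 _ hy.1, hx.2, hy.2, add_zero]⟩
      inv_mem' := fun {x} hx => ⟨P.inv_mem hx.1, by
        have := hmul _ hx.1 _ (P.inv_mem hx.1)
        rwa [mul_inv_cancel, hN0 1 N.one_mem, hx.2, zero_add, eq_comm] at this⟩ }
  have hRn : R.Normal := ⟨fun x hx γ => ⟨hPn.conj_mem x hx.1 γ, by
    rw [hconj γ x hx.1, hx.2, map_zero]⟩⟩
  have hR : R = N := by
    refine (h.eq_or R hRn (fun x hx => ⟨h.lt.le hx, hN0 x hx⟩) fun x hx => hx.1).resolve_right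
      fun he => ?_
    have : Submodule.span k (jj '' P) = ⊥ := by
      rw [Submodule.span_eq_bot]
      rintro _ ⟨x, hx, rfl⟩
      rw [SetLike.mem_coe, ← he] at hx
      exact hx.2
    have hnt := hirr.nontrivial
    rw [hsp] at this
    exact top_ne_bot this
  refine ⟨k, inferInstance, inferInstance, charP_of_injective_algebraMap
    (algebraMap (ZMod t) k).injective t, X, i1, i2, i3, ρ, jj, hirr, hmul, hconj, ?_, hsp⟩
  intro x hx
  constructor
  · intro h0
    rw [← hR]; exact ⟨hx, h0⟩
  · exact hN0 x

section Consequences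

variable {k X : Type} [Field k] [AddCommGroup X] [Module k X] {N P : Subgroup Γ}
  {ρ : Γ →* End k X} {j : Γ → X}

theorem ChiefRep.map_one (h : ChiefRep N P ρ j) : j 1 = 0 := (h.zero 1 P.one_mem).2 N.one_mem

theorem ChiefRep.map_inv (h : ChiefRep N P ρ j) {x : Γ} (hx : x ∈ P) : j x⁻¹ = - j x := by
  have := h.mul x hx x⁻¹ (P.inv_mem hx)
  rw [mul_inv_cancel, h.map_one] at this
  exact (neg_eq_of_add_eq_zero_right this.symm).symm

theorem ChiefRep.commutator (h : ChiefRep N P ρ j) (hP : P.Normal) (γ : Γ) {x : Γ} (hx : x ∈ P) :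
    j ⁅γ, x⁆ = ρ γ (j x) - j x := by
  rw [commutatorElement_def, h.mul _ (hP.conj_mem x hx γ) _ (P.inv_mem hx), h.conj γ x hx,
    h.map_inv hx, sub_eq_add_neg]

theorem commutatorElement_mem_right {P : Subgroup Γ} (hP : P.Normal) (γ : Γ) {x : Γ} (hx : x ∈ P) :
    ⁅γ, x⁆ ∈ P := P.mul_mem (hP.conj_mem x hx γ) (P.inv_mem hx)

theorem ChiefRep.comm_mem_iff (h : ChiefRep N P ρ j) (hP : P.Normal) (γ : Γ) {x : Γ}
    (hx : x ∈ P) : ⁅γ, x⁆ ∈ N ↔ ρ γ (j x) = j x := by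
  rw [← h.zero _ (commutatorElement_mem_right hP γ hx), h.commutator hP γ hx, sub_eq_zero]

theorem ChiefRep.commutator_le (h : ChiefRep N P ρ j) (hP : P.Normal) {J : Subgroup Γ}
    (hJ : J ≤ ρ.ker) : ⁅P, J⁆ ≤ N := by
  rw [commutator_comm, Subgroup.commutator_le]
  intro γ hγ x hx
  rw [h.comm_mem_iff hP γ hx, MonoidHom.mem_ker.1 (hJ hγ), Module.End.one_apply]

/-- In coprime characteristic the fixed vectors of `a` are spanned by images of fixed elements. -/
theorem ChiefRep.fixed_mem_span [Finite Γ] (h : ChiefRep N P ρ j) (hN : N.Normal) (hP : P.Normal)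
    (hNP : N ≤ P) {a : Γ} {q : ℕ} (hq : q.Prime) (ha : a ^ q = 1) (hqN : ¬ q ∣ Nat.card N)
    (hk : (q : k) ≠ 0) {v : X} (hv : ρ a v = v) :
    v ∈ Submodule.span k (j '' {x | x ∈ P ∧ a * x = x * a}) := by
  set F := Submodule.span k (j '' {x | x ∈ P ∧ a * x = x * a}) with hF
  let T : X →ₗ[k] X := ∑ s ∈ Finset.range q, ρ (a ^ s)
  have hT : ∀ x, T x = ∑ s ∈ Finset.range q, ρ (a ^ s) x := fun x => by
    simp [T, LinearMap.sum_apply]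
  have hTa : ∀ x, ρ a (T x) = T x := by
    intro x
    rw [hT, map_sum]
    have : ∀ s, ρ a (ρ (a ^ s) x) = ρ (a ^ (s + 1)) x := fun s => by
      rw [pow_succ', rho_mul_apply]
    simp only [this]
    have e1 := Finset.sum_range_succ (fun s => ρ (a ^ s) x) q
    have e2 := Finset.sum_range_succ' (fun s => ρ (a ^ s) x) q
    rw [ha] at e1
    rw [pow_zero] at e2
    exact add_right_cancel (e2.symm.trans e1)
  have hprod : ∀ x ∈ P, ∀ n : ℕ, ∃ y ∈ P, j y = ∑ s ∈ Finset.range n, ρ (a ^ s) (j x) := by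
    intro x hx n
    induction n with
    | zero => exact ⟨1, P.one_mem, by simp [h.map_one]⟩
    | succ n ih =>
      obtain ⟨y, hy, hy2⟩ := ih
      have hc := hP.conj_mem x hx (a ^ n)
      exact ⟨_, P.mul_mem hy hc, by rw [h.mul _ hy _ hc, hy2, h.conj _ x hx, Finset.sum_range_succ]⟩
  have hTF : ∀ x, T x ∈ F := by
    intro x
    have hx : x ∈ Submodule.span k (j '' P) := by rw [h.span]; trivial
    have : Submodule.span k (j '' P) ≤ F.comap T := by
      rw [Submodule.span_le]
      rintro _ ⟨x, hx, rfl⟩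
      obtain ⟨y, hy, hy2⟩ := hprod x hx q
      rw [← hT] at hy2
      have hya : a * y * a⁻¹ ∈ P := hP.conj_mem y hy a
      have hyN : y⁻¹ * (a * y * a⁻¹) ∈ N := by
        rw [← h.zero _ (P.mul_mem (P.inv_mem hy) hya), h.mul _ (P.inv_mem hy) _ hya, h.map_inv hy,
          h.conj a y hy, hy2, hTa, neg_add_cancel]
      obtain ⟨n, hn, hn2⟩ := exists_fixed_of_coset hq ha (fun n hn => hN.conj_mem n hn a) hqN hyN
      have hnP := hNP hn
      change T (j x) ∈ F
      have e : T (j x) = j (y * n) := by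
        rw [h.mul _ hy _ hnP, (h.zero n hnP).2 hn, add_zero, hy2]
      rw [e]
      exact Submodule.subset_span ⟨y * n, ⟨P.mul_mem hy hnP, hn2⟩, rfl⟩
    exact this hx
  have hTv : T v = (q : k) • v := by
    have : ∀ s : ℕ, ρ (a ^ s) v = v := by
      intro s
      induction s with
      | zero => simp
      | succ s ih => rw [pow_succ', rho_mul_apply, ih, hv]
    rw [hT]
    rw [Finset.sum_congr rfl fun s _ => this s, Finset.sum_const, Finset.card_range,
      Nat.cast_smul_eq_nsmul]
  have : v = (q : k)⁻¹ • T v := by rw [hTv, smul_smul, inv_mul_cancel₀ hk, one_smul]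
  rw [this]
  exact F.smul_mem _ (hTF v)

/-- Few commutators modulo `N` mean small rank of `ρ g - 1`. -/
theorem ChiefRep.finrank_range_le (h : ChiefRep N P ρ j) (hP : P.Normal) (hNP : N ≤ P)
    {g : Γ} {F : Finset Γ} (hF : ∀ x ∈ P, ∃ f ∈ F, f⁻¹ * ⁅g, x⁆ ∈ N) :
    finrank k (LinearMap.range (ρ g - 1)) ≤ F.card := by
  classical
  have hle : LinearMap.range (ρ g - 1) ≤ Submodule.span k ((F.image j : Finset X) : Set X) := by
    rw [LinearMap.range_eq_map, ← h.span, Submodule.map_span, Submodule.span_le]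
    rintro _ ⟨_, ⟨x, hx, rfl⟩, rfl⟩
    apply Submodule.subset_span
    obtain ⟨f, hf, hfx⟩ := hF x hx
    have hgx := commutatorElement_mem_right hP g hx
    have hfP : f ∈ P := by
      have := P.mul_mem hgx (P.inv_mem (hNP hfx))
      rwa [mul_inv_rev, inv_inv, mul_inv_cancel_left] at this
    rw [Finset.coe_image]
    refine ⟨f, hf, ?_⟩
    have e := (h.zero _ (hNP hfx)).2 hfx
    rw [h.mul _ (P.inv_mem hfP) _ hgx, h.map_inv hfP, h.commutator hP g hx, neg_add_eq_zero] at e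
    rw [e]; simp
  have hfin : FiniteDimensional k (Submodule.span k ((F.image j : Finset X) : Set X)) :=
    FiniteDimensional.span_finset k _
  exact (Submodule.finrank_mono hle).trans ((finrank_span_finset_le_card _).trans
    Finset.card_image_le)

end Consequences

end ChiefRep

end FittingBound

namespace FittingBound

open Subgroup Module

section Projective

variable {𝔾 k X : Type} [Group 𝔾] [Field k] [AddCommGroup X] [Module k X]

/-- A projective representation. -/
structure ProjRep (R : 𝔾 → End k X) : Prop where
  unit : ∀ g, IsUnit (R g)
  mul : ∀ g h, ∃ z : k, R (g * h) = z • (R g * R h)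

/-- Nondegeneracy of the commutator pairing on `P`. -/
def NonDeg (R : 𝔾 → End k X) (P : Subgroup 𝔾) : Prop :=
  ∀ y ∈ P, (∀ x ∈ P, Commute (R x) (R y)) → y = 1

namespace ProjRep

variable {R : 𝔾 → End k X}

theorem conj_unique (hR : ProjRep R) {g : 𝔾} {f₁ f₂ : End k X} (h : f₁ * R g = f₂ * R g) :
    f₁ = f₂ := (hR.unit g).mul_left_injective h

/-- The conjugation action on endomorphisms attached to a projective representation. -/
noncomputable def conjMap (hR : ProjRep R) (g : 𝔾) : End k (End k X) :=
  (LinearMap.mulLeft k (R g)).comp (LinearMap.mulRight k (↑(hR.unit g).unit⁻¹ : End k X))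

theorem conjMap_mul_self (hR : ProjRep R) (g : 𝔾) (f : End k X) :
    hR.conjMap g f * R g = R g * f := by
  have : (↑(hR.unit g).unit⁻¹ : End k X) * R g = 1 := (hR.unit g).val_inv_mul
  simp only [conjMap, LinearMap.comp_apply, LinearMap.mulLeft_apply, LinearMap.mulRight_apply]
  rw [mul_assoc, mul_assoc, this, mul_one]

theorem conjMap_eq_iff (hR : ProjRep R) {g : 𝔾} {f f' : End k X} :
    hR.conjMap g f = f' ↔ R g * f = f' * R g := by
  rw [← hR.conjMap_mul_self]
  exact ⟨fun h => by rw [h], fun h => hR.conj_unique h⟩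

theorem mul_eq [Nontrivial X] (hR : ProjRep R) (g h : 𝔾) :
    ∃ z : k, z ≠ 0 ∧ R (g * h) = z • (R g * R h) := by
  obtain ⟨z, hz⟩ := hR.mul g h
  refine ⟨z, ?_, hz⟩
  rintro rfl
  rw [zero_smul] at hz
  have := hR.unit (g * h)
  rw [hz] at this
  exact not_isUnit_zero this

theorem one_eq [Nontrivial X] (hR : ProjRep R) : ∃ z : k, z ≠ 0 ∧ R 1 = z • 1 := by
  obtain ⟨z, hz, h⟩ := hR.mul_eq 1 1
  rw [mul_one] at h
  refine ⟨z⁻¹, inv_ne_zero hz, ?_⟩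
  have : (1 : End k X) * R 1 = (z • R 1) * R 1 := by rw [one_mul, smul_mul_assoc]; exact h
  have := hR.conj_unique this
  rw [this, smul_smul, inv_mul_cancel₀ hz, one_smul]

/-- Conjugation is an honest representation. -/
noncomputable def conjHom [Nontrivial X] (hR : ProjRep R) : 𝔾 →* End k (End k X) where
  toFun := hR.conjMap
  map_one' := by
    obtain ⟨z, -, hz⟩ := hR.one_eq
    refine LinearMap.ext fun f => ?_
    rw [Module.End.one_apply, conjMap_eq_iff, hz]
    simp
  map_mul' g h := by
    refine LinearMap.ext fun f => ?_
    obtain ⟨z, -, hz⟩ := hR.mul_eq g h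
    rw [Module.End.mul_apply, conjMap_eq_iff, hz, smul_mul_assoc, mul_smul_comm, ← mul_assoc,
      conjMap_mul_self, mul_assoc, mul_assoc, conjMap_mul_self]

variable [Nontrivial X]

theorem conjHom_eq_iff (hR : ProjRep R) {g : 𝔾} {f f' : End k X} :
    hR.conjHom g f = f' ↔ R g * f = f' * R g := hR.conjMap_eq_iff

theorem conjHom_mul (hR : ProjRep R) (g : 𝔾) (f f' : End k X) :
    hR.conjHom g (f * f') = hR.conjHom g f * hR.conjHom g f' := by
  have h1 : hR.conjHom g f' * R g = R g * f' := hR.conjMap_mul_self g f'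
  have h2 : hR.conjHom g f * R g = R g * f := hR.conjMap_mul_self g f
  rw [conjHom_eq_iff, mul_assoc, h1, ← mul_assoc, ← mul_assoc, h2]

theorem conjHom_self (hR : ProjRep R) (g h : 𝔾) :
    ∃ c : k, c ≠ 0 ∧ hR.conjHom g (R h) = c • R (g * h * g⁻¹) := by
  obtain ⟨z, hz, h1⟩ := hR.mul_eq g h
  obtain ⟨w, hw, h2⟩ := hR.mul_eq (g * h * g⁻¹) g
  rw [inv_mul_cancel_right, h1] at h2
  refine ⟨z⁻¹ * w, mul_ne_zero (inv_ne_zero hz) hw, ?_⟩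
  rw [conjHom_eq_iff, smul_mul_assoc, mul_smul, ← h2, smul_smul, inv_mul_cancel₀ hz, one_smul]

theorem ne_zero (hR : ProjRep R) (g : 𝔾) : R g ≠ 0 := (hR.unit g).ne_zero

/-- The commutator pairing. -/
noncomputable def pair (hR : ProjRep R) (x y : 𝔾) : k :=
  Classical.epsilon fun c => hR.conjHom x (R y) = c • R y

theorem pair_spec (hR : ProjRep R) {x y : 𝔾} (h : x * y = y * x) :
    hR.conjHom x (R y) = hR.pair x y • R y := by
  refine Classical.epsilon_spec (p := fun c => hR.conjHom x (R y) = c • R y) ?_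
  obtain ⟨c, -, hc⟩ := hR.conjHom_self x y
  rw [h, mul_inv_cancel_right] at hc
  exact ⟨c, hc⟩

theorem pair_unique (hR : ProjRep R) {x y : 𝔾} (h : x * y = y * x) {c : k}
    (hc : hR.conjHom x (R y) = c • R y) : hR.pair x y = c := by
  rw [hR.pair_spec h] at hc
  exact smul_left_injective k (hR.ne_zero y) hc

theorem pair_ne_zero (hR : ProjRep R) {x y : 𝔾} (h : x * y = y * x) : hR.pair x y ≠ 0 := by
  obtain ⟨c, hc0, hc⟩ := hR.conjHom_self x y
  rw [h, mul_inv_cancel_right] at hc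
  rwa [hR.pair_unique h hc]

theorem pair_mul_left (hR : ProjRep R) {x x' y : 𝔾} (h : x * y = y * x) (h' : x' * y = y * x') :
    hR.pair (x * x') y = hR.pair x y * hR.pair x' y := by
  apply hR.pair_unique
  · rw [mul_assoc, h', ← mul_assoc, h, mul_assoc]
  · rw [map_mul, Module.End.mul_apply, hR.pair_spec h', map_smul, hR.pair_spec h, smul_smul,
      mul_comm]

theorem pair_mul_right (hR : ProjRep R) {x y y' : 𝔾} (h : x * y = y * x) (h' : x * y' = y' * x) :
    hR.pair x (y * y') = hR.pair x y * hR.pair x y' := by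
  apply hR.pair_unique
  · rw [← mul_assoc, h, mul_assoc, h', mul_assoc]
  · obtain ⟨z, hz⟩ := hR.mul y y'
    rw [hz, map_smul, hR.conjHom_mul, hR.pair_spec h', hR.pair_spec h, smul_mul_smul_comm,
      smul_comm]

theorem pair_one_right (hR : ProjRep R) (x : 𝔾) : hR.pair x 1 = 1 := by
  apply hR.pair_unique (by simp)
  obtain ⟨z, -, hz⟩ := hR.one_eq
  rw [one_smul, conjHom_eq_iff, hz]; simp

theorem pair_eq_one_iff (hR : ProjRep R) {x y : 𝔾} (h : x * y = y * x) :
    hR.pair x y = 1 ↔ Commute (R x) (R y) := by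
  constructor
  · intro h1
    have := hR.pair_spec h
    rwa [h1, one_smul, conjHom_eq_iff] at this
  · intro h1
    exact hR.pair_unique h (by rw [one_smul, conjHom_eq_iff]; exact h1)

theorem pair_swap (hR : ProjRep R) {x y : 𝔾} (h : x * y = y * x) :
    hR.pair y x = (hR.pair x y)⁻¹ := by
  apply hR.pair_unique h.symm
  have := hR.pair_spec h
  rw [conjHom_eq_iff, smul_mul_assoc] at this
  rw [conjHom_eq_iff, smul_mul_assoc, this, smul_smul, inv_mul_cancel₀ (hR.pair_ne_zero h),
    one_smul]

theorem pair_inv_left (hR : ProjRep R) {x y : 𝔾} (h : x * y = y * x) :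
    hR.pair x⁻¹ y = (hR.pair x y)⁻¹ := by
  have h' : x⁻¹ * y = y * x⁻¹ := (Commute.inv_left (a := x) (b := y) h)
  have := hR.pair_mul_left h h'
  rw [mul_inv_cancel, hR.pair_swap (x := y) (by simp), pair_one_right, inv_one] at this
  exact (inv_eq_of_mul_eq_one_right this.symm).symm

theorem pair_conj (hR : ProjRep R) (g : 𝔾) {x y : 𝔾} (h : x * y = y * x) :
    hR.pair (g * x * g⁻¹) (g * y * g⁻¹) = hR.pair x y := by
  have h' : (g * x * g⁻¹) * (g * y * g⁻¹) = (g * y * g⁻¹) * (g * x * g⁻¹) := by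
    have : g * (x * y) * g⁻¹ = g * (y * x) * g⁻¹ := by rw [h]
    simpa [mul_assoc] using this
  apply hR.pair_unique h'
  obtain ⟨c, hc0, hc⟩ := hR.conjHom_self g y
  have e : R (g * y * g⁻¹) = c⁻¹ • hR.conjHom g (R y) := by
    rw [hc, smul_smul, inv_mul_cancel₀ hc0, one_smul]
  rw [e, map_smul, ← Module.End.mul_apply, ← map_mul, inv_mul_cancel_right, map_mul,
    Module.End.mul_apply, hR.pair_spec h, map_smul, smul_comm]


theorem pair_inv_right (hR : ProjRep R) {x y : 𝔾} (h : x * y = y * x) :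
    hR.pair x y⁻¹ = (hR.pair x y)⁻¹ := by
  rw [← hR.pair_swap h, hR.pair_swap (x := y⁻¹) (Commute.inv_left (a := y) (b := x) h.symm),
    hR.pair_inv_left h.symm, inv_inv]

variable {P : Subgroup 𝔾}

theorem pair_pow_left (hR : ProjRep R) {x y : 𝔾} (h : x * y = y * x) (n : ℕ) :
    hR.pair (x ^ n) y = hR.pair x y ^ n := by
  induction n with
  | zero => rw [pow_zero, pow_zero, hR.pair_swap (x := y) (by simp), pair_one_right, inv_one]
  | succ n ih =>
    have h' : x ^ n * y = y * x ^ n := (Commute.pow_left (a := x) (b := y) h n)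
    rw [pow_succ, pow_succ, hR.pair_mul_left h' h, ih]

theorem sum_pair (hR : ProjRep R) [Fintype P] (hP : ∀ x ∈ P, ∀ y ∈ P, x * y = y * x)
    (hnd : NonDeg R P) {y : 𝔾} (hy : y ∈ P) (hy1 : y ≠ 1) : ∑ x : P, hR.pair x y = 0 := by
  have : ∃ x ∈ P, hR.pair x y ≠ 1 := by
    by_contra hcon
    push Not at hcon
    exact hy1 (hnd y hy fun x hx => (hR.pair_eq_one_iff (hP x hx y hy)).1 (hcon x hx))
  obtain ⟨x₀, hx₀, h₀⟩ := this
  have e : ∑ x : P, hR.pair x y = hR.pair x₀ y * ∑ x : P, hR.pair x y := by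
    rw [Finset.mul_sum, ← Equiv.sum_comp (Equiv.mulLeft (⟨x₀, hx₀⟩ : P))]
    refine Finset.sum_congr rfl fun x _ => ?_
    exact hR.pair_mul_left (hP x₀ hx₀ y hy) (hP x x.2 y hy)
  have : (hR.pair x₀ y - 1) * ∑ x : P, hR.pair x y = 0 := by rw [sub_mul, ← e]; ring
  exact (mul_eq_zero.1 this).resolve_left (sub_ne_zero.2 h₀)

theorem card_ne_zero [Finite 𝔾] (hR : ProjRep R) (hP : ∀ x ∈ P, ∀ y ∈ P, x * y = y * x)
    (hnd : NonDeg R P) : (Nat.card P : k) ≠ 0 := by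
  intro h0
  obtain ⟨t, ht⟩ := CharP.exists k
  have hd : t ∣ Nat.card P := (CharP.cast_eq_zero_iff k t _).1 h0
  have htp : t.Prime := by
    rcases CharP.char_is_prime_or_zero k t with h | h
    · exact h
    · rw [h, zero_dvd_iff] at hd
      exact absurd hd Nat.card_pos.ne'
  have := Fact.mk htp
  obtain ⟨y, hy⟩ := exists_prime_orderOf_dvd_card' t hd
  have h1 : (y : 𝔾) = 1 := by
    refine hnd y y.2 fun x hx => (hR.pair_eq_one_iff (hP x hx y y.2)).1 ?_
    have hyx := hP y y.2 x hx
    have e := hR.pair_pow_left hyx t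
    have hyt : (y : 𝔾) ^ t = 1 := by rw [← hy, ← Subgroup.coe_pow, pow_orderOf_eq_one]; rfl
    rw [hyt, hR.pair_swap (x := x) (by simp), pair_one_right, inv_one] at e
    have e2 : (hR.pair (y : 𝔾) x - 1) ^ t = 0 := by rw [sub_pow_char, ← e, one_pow, sub_self]
    rw [hR.pair_swap hyx, sub_eq_zero.1 (pow_eq_zero_iff htp.ne_zero |>.1 e2), inv_one]
  have : y = 1 := Subtype.ext h1
  rw [this, orderOf_one] at hy
  exact htp.one_lt.ne hy

/-- The weight spaces of the conjugation action of `P`. -/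
def weight (hR : ProjRep R) (P : Subgroup 𝔾) (y : 𝔾) : Submodule k (End k X) where
  carrier := {f | ∀ x ∈ P, hR.conjHom x f = hR.pair x y • f}
  add_mem' := fun {f g} hf hg x hx => by rw [map_add, hf x hx, hg x hx, smul_add]
  zero_mem' := fun x _ => by simp
  smul_mem' := fun c f hf x hx => by rw [map_smul, hf x hx, smul_comm]

/-- Projection to a weight space. -/
noncomputable def weightProj (hR : ProjRep R) (P : Subgroup 𝔾) [Fintype P] (y : 𝔾) :
    End k (End k X) :=
  (Nat.card P : k)⁻¹ • ∑ x : P, (hR.pair x y)⁻¹ • hR.conjHom x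

theorem weightProj_apply (hR : ProjRep R) [Fintype P] (y : 𝔾) (f : End k X) :
    hR.weightProj P y f = (Nat.card P : k)⁻¹ • ∑ x : P, (hR.pair x y)⁻¹ • hR.conjHom x f := by
  simp [weightProj, LinearMap.sum_apply]

theorem weightProj_mem (hR : ProjRep R) [Fintype P] (hP : ∀ x ∈ P, ∀ y ∈ P, x * y = y * x)
    {y : 𝔾} (hy : y ∈ P) (f : End k X) : hR.weightProj P y f ∈ hR.weight P y := by
  intro x₀ hx₀
  rw [weightProj_apply, map_smul, smul_comm]
  congr 1
  rw [map_sum, Finset.smul_sum, ← Equiv.sum_comp (Equiv.mulLeft (⟨x₀, hx₀⟩ : P)) fun x : P =>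
    hR.pair x₀ y • (hR.pair x y)⁻¹ • hR.conjHom x f]
  refine Finset.sum_congr rfl fun x _ => ?_
  have e : ((Equiv.mulLeft (⟨x₀, hx₀⟩ : P) x : P) : 𝔾) = x₀ * x := rfl
  rw [e, map_smul, hR.pair_mul_left (hP x₀ hx₀ y hy) (hP x x.2 y hy), map_mul,
    Module.End.mul_apply, smul_smul, mul_inv, ← mul_assoc,
    mul_inv_cancel₀ (hR.pair_ne_zero (hP x₀ hx₀ y hy)), one_mul]

theorem weightProj_of_mem [Finite 𝔾] (hR : ProjRep R) [Fintype P]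
    (hP : ∀ x ∈ P, ∀ y ∈ P, x * y = y * x) (hnd : NonDeg R P) {y : 𝔾} (hy : y ∈ P)
    {f : End k X} (hf : f ∈ hR.weight P y) : hR.weightProj P y f = f := by
  rw [weightProj_apply]
  have : ∀ x : P, (hR.pair x y)⁻¹ • hR.conjHom x f = f := fun x => by
    rw [hf x x.2, smul_smul, inv_mul_cancel₀ (hR.pair_ne_zero (hP x x.2 y hy)), one_smul]
  rw [Finset.sum_congr rfl fun x _ => this x, Finset.sum_const, Finset.card_univ,
    ← Nat.card_eq_fintype_card, ← Nat.cast_smul_eq_nsmul k, smul_smul,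
    inv_mul_cancel₀ (hR.card_ne_zero hP hnd), one_smul]

theorem weightProj_of_mem_ne (hR : ProjRep R) [Fintype P]
    (hP : ∀ x ∈ P, ∀ y ∈ P, x * y = y * x) (hnd : NonDeg R P) {y y' : 𝔾} (hy : y ∈ P)
    (hy' : y' ∈ P) (hne : y' ≠ y) {f : End k X} (hf : f ∈ hR.weight P y') :
    hR.weightProj P y f = 0 := by
  rw [weightProj_apply]
  have : ∀ x : P, (hR.pair x y)⁻¹ • hR.conjHom x f = hR.pair x (y⁻¹ * y') • f := fun x => by
    rw [hf x x.2, smul_smul, hR.pair_mul_right (hP x x.2 _ (P.inv_mem hy)) (hP x x.2 y' hy'),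
      hR.pair_inv_right (hP x x.2 y hy)]
  rw [Finset.sum_congr rfl fun x _ => this x, ← Finset.sum_smul,
    hR.sum_pair hP hnd (P.mul_mem (P.inv_mem hy) hy')
      (fun h => hne (inv_mul_eq_one.1 h).symm), zero_smul, smul_zero]

theorem sum_weightProj [Finite 𝔾] (hR : ProjRep R) [Fintype P]
    (hP : ∀ x ∈ P, ∀ y ∈ P, x * y = y * x) (hnd : NonDeg R P) (f : End k X) :
    ∑ y : P, hR.weightProj P y f = f := by
  classical
  simp only [weightProj_apply]
  rw [← Finset.smul_sum, Finset.sum_comm]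
  have : ∀ x : P, ∑ y : P, (hR.pair x y)⁻¹ • hR.conjHom x f =
      if x = 1 then (Nat.card P : k) • f else 0 := by
    intro x
    rw [← Finset.sum_smul]
    have e : ∀ y : P, (hR.pair x y)⁻¹ = hR.pair y x := fun y =>
      (hR.pair_swap (hP x x.2 y y.2)).symm
    rw [Finset.sum_congr rfl fun y _ => e y]
    split_ifs with h
    · subst h
      have : ∀ y : P, hR.pair (y : 𝔾) ((1 : P) : 𝔾) = 1 := fun y => hR.pair_one_right _
      rw [Finset.sum_congr rfl fun y _ => this y]
      simp
    · rw [hR.sum_pair hP hnd x.2 (fun h1 => h (Subtype.ext h1)), zero_smul]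
  rw [Finset.sum_congr rfl fun x _ => this x]
  simp only [Finset.sum_ite_eq', Finset.mem_univ, if_true]
  rw [smul_smul, inv_mul_cancel₀ (hR.card_ne_zero hP hnd), one_smul]

theorem finrank_weight [FiniteDimensional k X] (hR : ProjRep R)
    (hP : ∀ x ∈ P, ∀ y ∈ P, x * y = y * x) {y : 𝔾} (hy : y ∈ P) :
    finrank k (hR.weight P y) = finrank k (hR.weight P 1) := by
  have hmap : (hR.weight P 1).map (LinearMap.mulLeft k (R y)) = hR.weight P y := by
    ext f
    constructor
    · rintro ⟨f, hf, rfl⟩ x hx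
      rw [LinearMap.mulLeft_apply, hR.conjHom_mul, hf x hx, hR.pair_spec (hP x hx y hy),
        pair_one_right, one_smul, smul_mul_assoc]
    · intro hf
      obtain ⟨S, hS⟩ := (hR.unit y).exists_right_inv
      obtain ⟨S', hS'⟩ := (hR.unit y).exists_left_inv
      refine ⟨S * f, fun x hx => ?_, by
        rw [LinearMap.mulLeft_apply, ← mul_assoc, hS, one_mul]⟩
      rw [pair_one_right, one_smul]
      apply (hR.unit y).mul_right_injective
      dsimp only
      have e := hf x hx
      have e2 : f = R y * (S * f) := by rw [← mul_assoc, hS, one_mul]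
      rw [e2, hR.conjHom_mul, hR.pair_spec (hP x hx y hy), smul_mul_assoc, ← e2] at e
      have e3 := smul_right_injective _ (hR.pair_ne_zero (hP x hx y hy)) e
      rw [e3]; exact e2
  rw [← hmap]
  exact (Submodule.equivMapOfInjective (LinearMap.mulLeft k (R y))
    (hR.unit y).mul_right_injective _).finrank_eq.symm

theorem finrank_sq [Finite 𝔾] [FiniteDimensional k X] (hR : ProjRep R)
    (hP : ∀ x ∈ P, ∀ y ∈ P, x * y = y * x) (hnd : NonDeg R P) :
    finrank k X ^ 2 = Nat.card P * finrank k (hR.weight P 1) := by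
  classical
  have := Fintype.ofFinite P
  let e : End k X ≃ₗ[k] ((y : P) → hR.weight P y) :=
    { toFun := fun f y => ⟨hR.weightProj P y f, hR.weightProj_mem hP y.2 f⟩
      map_add' := fun f g => by ext1 y; exact Subtype.ext (map_add _ _ _)
      map_smul' := fun c f => by ext1 y; exact Subtype.ext (map_smul _ _ _)
      invFun := fun v => ∑ y : P, (v y : End k X)
      left_inv := fun f => hR.sum_weightProj hP hnd f
      right_inv := fun v => by
        ext1 y
        apply Subtype.ext
        change hR.weightProj P y (∑ y : P, (v y : End k X)) = v y
        rw [map_sum, Finset.sum_eq_single y]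
        · exact hR.weightProj_of_mem hP hnd y.2 (v y).2
        · intro y' _ hne
          exact hR.weightProj_of_mem_ne hP hnd y.2 y'.2 (fun h => hne (Subtype.ext h)) (v y').2
        · intro h; exact absurd (Finset.mem_univ _) h }
  have h1 := e.finrank_eq
  rw [Module.finrank_linearMap, Module.finrank_pi_fintype,
    Finset.sum_congr rfl fun y _ => hR.finrank_weight hP y.2] at h1
  rw [sq, h1, Finset.sum_const, Finset.card_univ, Nat.card_eq_fintype_card, smul_eq_mul]

theorem weightProj_conj (hR : ProjRep R) [Fintype P] (hP : ∀ x ∈ P, ∀ y ∈ P, x * y = y * x)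
    {δ : 𝔾} (hδ : ∀ x ∈ P, δ * x * δ⁻¹ ∈ P) (hδ' : ∀ x ∈ P, δ⁻¹ * x * δ ∈ P)
    {y : 𝔾} (hy : y ∈ P) {f : End k X} (hf : hR.conjHom δ f = f) :
    hR.weightProj P (δ * y * δ⁻¹) f = hR.conjHom δ (hR.weightProj P y f) := by
  rw [weightProj_apply, weightProj_apply, map_smul]
  congr 1
  rw [map_sum]
  let e : P ≃ P :=
    { toFun := fun x => ⟨δ * x * δ⁻¹, hδ x x.2⟩
      invFun := fun x => ⟨δ⁻¹ * x * δ, hδ' x x.2⟩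
      left_inv := fun x => Subtype.ext (by simp [mul_assoc])
      right_inv := fun x => Subtype.ext (by simp [mul_assoc]) }
  rw [← Equiv.sum_comp e]
  refine Finset.sum_congr rfl fun x _ => ?_
  have ex : ((e x : P) : 𝔾) = δ * x * δ⁻¹ := rfl
  rw [ex, hR.pair_conj δ (hP x x.2 y hy), map_smul]
  congr 1
  have h2 : hR.conjHom (δ * x * δ⁻¹) (hR.conjHom δ f) = hR.conjHom δ (hR.conjHom x f) := by
    rw [← Module.End.mul_apply, ← map_mul, inv_mul_cancel_right, map_mul, Module.End.mul_apply]
  rwa [hf] at h2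

theorem finrank_weight_pos (hR : ProjRep R) [FiniteDimensional k X] (P : Subgroup 𝔾) :
    1 ≤ finrank k (hR.weight P 1) := by
  have h1 : (1 : End k X) ∈ hR.weight P 1 := fun x _ => by
    rw [pair_one_right, one_smul, conjHom_eq_iff, mul_one, one_mul]
  have : Nontrivial (hR.weight P 1) :=
    ⟨⟨1, h1⟩, 0, fun h => one_ne_zero (congrArg Subtype.val h)⟩
  exact finrank_pos

/-- Operators commuting with a group whose orbits on `P ∖ 1` are long form a small space. -/
theorem finrank_commutant_le [Finite 𝔾] [FiniteDimensional k X] (hR : ProjRep R)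
    (hP : ∀ x ∈ P, ∀ y ∈ P, x * y = y * x) (hnd : NonDeg R P) {Δ : Subgroup 𝔾}
    (hΔ : ∀ δ ∈ Δ, ∀ x ∈ P, δ * x * δ⁻¹ ∈ P) {s : ℕ}
    (hs : ∀ y ∈ P, y ≠ 1 → s ≤ Set.ncard {y' | ∃ δ ∈ Δ, y' = δ * y * δ⁻¹})
    {V : Submodule k (End k X)} (hV : ∀ f ∈ V, ∀ δ ∈ Δ, Commute (R δ) f) :
    s * finrank k V + finrank k (hR.weight P 1) ≤
      (s + Nat.card P) * finrank k (hR.weight P 1) := by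
  classical
  have := Fintype.ofFinite P
  let st : Setoid P :=
    { r := fun y y' => ∃ δ ∈ Δ, (y' : 𝔾) = δ * y * δ⁻¹
      iseqv :=
        { refl := fun y => ⟨1, Δ.one_mem, by simp⟩
          symm := fun {y y'} ⟨δ, hδ, h⟩ => ⟨δ⁻¹, Δ.inv_mem hδ, by rw [h]; group⟩
          trans := fun {y y' y''} ⟨δ, hδ, h⟩ ⟨ε, hε, h'⟩ =>
            ⟨ε * δ, Δ.mul_mem hε hδ, by rw [h', h]; group⟩ } }
  let Q := Quotient st
  have := Fintype.ofFinite Q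
  have hfV : ∀ f ∈ V, ∀ δ ∈ Δ, hR.conjHom δ f = f := fun f hf δ hδ =>
    hR.conjHom_eq_iff.2 (hV f hf δ hδ)
  let Φ : V →ₗ[k] ((o : Q) → hR.weight P o.out) :=
    { toFun := fun f o => ⟨hR.weightProj P o.out f, hR.weightProj_mem hP o.out.2 f⟩
      map_add' := fun f g => by ext1 y; exact Subtype.ext (map_add _ _ _)
      map_smul' := fun c f => by ext1 y; exact Subtype.ext (map_smul _ _ _) }
  have hΦ : Function.Injective Φ := by
    rw [injective_iff_map_eq_zero]
    intro f hf
    apply Subtype.ext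
    rw [← hR.sum_weightProj hP hnd (f : End k X)]
    refine Finset.sum_eq_zero fun y _ => ?_
    obtain ⟨δ, hδ, h⟩ : st.r (⟦y⟧ : Q).out y := Quotient.exact (Quotient.out_eq _)
    rw [h, hR.weightProj_conj hP (hΔ δ hδ)
      (fun x hx => by simpa using hΔ δ⁻¹ (Δ.inv_mem hδ) x hx) (Subtype.prop _) (hfV f f.2 δ hδ)]
    have := congrArg Subtype.val (congrFun hf (⟦y⟧ : Q))
    change hR.weightProj P _ (f : End k X) = 0 at this
    rw [this, map_zero]
  have h1 := LinearMap.finrank_le_finrank_of_injective hΦ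
  rw [Module.finrank_pi_fintype, Finset.sum_congr rfl fun o _ => hR.finrank_weight hP (Subtype.prop _),
    Finset.sum_const, Finset.card_univ, smul_eq_mul] at h1
  have h2 : s * Fintype.card Q + 1 ≤ s + Nat.card P := by
    have e1 : Fintype.card P = ∑ o : Q, Fintype.card {y : P // (⟦y⟧ : Q) = o} := by
      rw [← Fintype.card_sigma]
      exact Fintype.card_congr (Equiv.sigmaFiberEquiv _).symm
    have e2 : ∀ o : Q, o ≠ ⟦1⟧ → s ≤ Fintype.card {y : P // (⟦y⟧ : Q) = o} := by
      intro o ho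
      have hne : (o.out : 𝔾) ≠ 1 := by
        intro h
        apply ho
        rw [← Quotient.out_eq o]
        congr 1
        exact Subtype.ext h
      refine (hs _ (Subtype.prop _) hne).trans ?_
      rw [← Nat.card_coe_set_eq, ← Nat.card_eq_fintype_card]
      refine Nat.card_le_card_of_injective
        (fun y => ⟨⟨y.1, ?_⟩, ?_⟩) ?_
      · obtain ⟨δ, hδ, h⟩ := y.2
        rw [h]; exact hΔ δ hδ _ (Subtype.prop _)
      · obtain ⟨δ, hδ, h⟩ := y.2
        conv_rhs => rw [← Quotient.out_eq o]
        exact (Quotient.sound (s := st) ⟨δ, hδ, h⟩).symm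
      · intro y y' h
        exact Subtype.ext (congrArg (fun z => ((z.1 : P) : 𝔾)) h)
    have e3 : 1 ≤ Fintype.card {y : P // (⟦y⟧ : Q) = ⟦1⟧} := Fintype.card_pos_iff.2 ⟨⟨1, rfl⟩⟩
    rw [Nat.card_eq_fintype_card, e1, ← Finset.add_sum_erase _ _ (Finset.mem_univ (⟦1⟧ : Q))]
    have e4 := Finset.card_nsmul_le_sum (Finset.univ.erase (⟦1⟧ : Q))
      (fun o : Q => Fintype.card {y : P // (⟦y⟧ : Q) = o}) s
      (fun o ho => e2 o (Finset.ne_of_mem_erase ho))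
    rw [Finset.card_erase_of_mem (Finset.mem_univ _), Finset.card_univ, smul_eq_mul] at e4
    have e5 : 1 ≤ Fintype.card Q := Fintype.card_pos_iff.2 ⟨⟦1⟧⟩
    obtain ⟨c, hc⟩ := Nat.exists_eq_add_of_le e5
    rw [hc] at e4 ⊢
    rw [Nat.add_sub_cancel_left, mul_comm] at e4
    rw [mul_add, mul_one, add_assoc, add_comm (s * c)]
    exact Nat.add_le_add_left (Nat.add_le_add e3 e4) s
  calc s * finrank k V + finrank k (hR.weight P 1)
      ≤ s * (Fintype.card Q * finrank k (hR.weight P 1)) + finrank k (hR.weight P 1) := by gcongr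
    _ = (s * Fintype.card Q + 1) * finrank k (hR.weight P 1) := by ring
    _ ≤ _ := by gcongr

end ProjRep

end Projective

end FittingBound

namespace FittingBound

open Subgroup Module

section Decomposition

variable {k X : Type} [Field k] [AddCommGroup X] [Module k X]

/-- The space of operators commuting with `A`. -/
def commutant (A : End k X) : Submodule k (End k X) where
  carrier := {f | Commute A f}
  add_mem' := fun hf hg => Commute.add_right hf hg
  zero_mem' := Commute.zero_right A
  smul_mem' := fun c _ hf => Commute.smul_right hf c

theorem mem_commutant {A f : End k X} : f ∈ commutant A ↔ Commute A f := Iff.rfl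

variable {ι : Type} {W : ι → Submodule k X}

theorem decomp_isCompl (hi : iSupIndep W) (hs : ⨆ i, W i = ⊤) (i : ι) :
    IsCompl (W i) (⨆ j, ⨆ (_ : j ≠ i), W j) := by
  refine ⟨hi i, codisjoint_iff.2 (eq_top_iff.2 ?_)⟩
  rw [← hs]
  refine iSup_le fun j => ?_
  by_cases h : j = i
  · subst h; exact le_sup_left
  · exact (le_iSup₂ (f := fun j (_ : j ≠ i) => W j) j h).trans le_sup_right

/-- Sum over the components of a decomposition of operators on them. -/
theorem sum_finrank_commutant_le [FiniteDimensional k X] [Fintype ι] (hi : iSupIndep W)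
    (hs : ⨆ i, W i = ⊤) (U : End k X) (hU : ∀ i, ∀ x ∈ W i, U x ∈ W i) {V : Submodule k (End k X)}
    (hV : ∀ f : End k X, Commute U f → (∀ i, ∀ x ∈ W i, f x ∈ W i) → f ∈ V) :
    ∑ i, finrank k (commutant (U.restrict (hU i))) ≤ finrank k V := by
  classical
  let p (i : ι) : X →ₗ[k] W i := Submodule.projectionOnto _ _ (decomp_isCompl hi hs i)
  have hp1 : ∀ i (x : W i), p i x = x := fun i x => Submodule.projectionOnto_apply_left _ x
  have hp0 : ∀ i j, j ≠ i → ∀ x ∈ W j, p i x = 0 := fun i j hij x hx =>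
    Submodule.projectionOnto_apply_of_mem_right _
      (le_iSup₂ (f := fun j (_ : j ≠ i) => W j) j hij hx)
  have hext : ∀ f g : End k X, (∀ i, ∀ x ∈ W i, f x = g x) → f = g := by
    intro f g h
    refine LinearMap.ext fun x => ?_
    have : (⊤ : Submodule k X) ≤ LinearMap.eqLocus f g := by
      rw [← hs]; exact iSup_le fun i x hx => h i x hx
    exact this (Submodule.mem_top (x := x))
  let Ψ : ((i : ι) → commutant (U.restrict (hU i))) →ₗ[k] End k X :=
    { toFun := fun f => ∑ i, (W i).subtype ∘ₗ (f i : End k (W i)) ∘ₗ p i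
      map_add' := fun f g => by
        rw [← Finset.sum_add_distrib]
        refine Finset.sum_congr rfl fun i _ => ?_
        ext x; simp
      map_smul' := fun c f => by
        rw [RingHom.id_apply, Finset.smul_sum]
        refine Finset.sum_congr rfl fun i _ => ?_
        ext x; simp }
  have hΨ : ∀ f i (x : W i), Ψ f x = (f i : End k (W i)) x := by
    intro f i x
    change (∑ i, (W i).subtype ∘ₗ (f i : End k (W i)) ∘ₗ p i) (x : X) = _
    rw [LinearMap.sum_apply, Finset.sum_eq_single i]
    · simp [hp1]
    · intro j _ hj
      simp [hp0 j i hj.symm x x.2]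
    · intro h; exact absurd (Finset.mem_univ _) h
  have hΨV : ∀ f, Ψ f ∈ V := by
    intro f
    refine hV _ ?_ fun i x hx => ?_
    · refine hext _ _ fun i x hx => ?_
      rw [Module.End.mul_apply, Module.End.mul_apply, hΨ f i ⟨x, hx⟩, hΨ f i ⟨U x, hU i x hx⟩]
      have := LinearMap.congr_fun (mem_commutant.1 (f i).2).eq ⟨x, hx⟩
      exact congrArg Subtype.val this
    · rw [hΨ f i ⟨x, hx⟩]; exact Subtype.prop _
  have hinj : Function.Injective (Ψ.codRestrict V hΨV) := by
    intro f g h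
    have h' : Ψ f = Ψ g := congrArg Subtype.val h
    funext i
    refine Subtype.ext (LinearMap.ext fun x => Subtype.ext ?_)
    rw [← hΨ f i x, ← hΨ g i x, h']
  have := LinearMap.finrank_le_finrank_of_injective hinj
  rwa [Module.finrank_pi_fintype] at this

theorem finrank_eq_sum_decomp [FiniteDimensional k X] [Fintype ι] (hi : iSupIndep W)
    (hs : ⨆ i, W i = ⊤) : finrank k X = ∑ i, finrank k (W i) := by
  classical
  have h := DirectSum.isInternal_submodule_of_iSupIndep_of_iSup_eq_top hi hs
  rw [← (LinearEquiv.ofBijective (DirectSum.coeLinearMap W) h).finrank_eq]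
  exact Module.finrank_directSum _ _

theorem iSup_eigenspace_of_pow [IsAlgClosed k] [FiniteDimensional k X] {A : End k X} {q : ℕ}
    (hq : (q : k) ≠ 0) (hA : A ^ q = 1) : ⨆ μ, A.eigenspace μ = ⊤ := by
  have hss : A.IsSemisimple := by
    refine Module.End.isSemisimple_of_squarefree_aeval_eq_zero
      (p := (Polynomial.X ^ q - 1 : Polynomial k)) ?_ ?_
    · exact (Polynomial.X_pow_sub_one_separable_iff.2 hq).squarefree
    · simp [hA]
  rw [← Module.End.iSup_maxGenEigenspace_eq_top A]
  refine iSup_congr fun μ => ?_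
  exact (hss.isFinitelySemisimple.maxGenEigenspace_eq_eigenspace μ).symm

theorem finrank_ker_pow_le [FiniteDimensional k X] (T : End k X) (n : ℕ) :
    finrank k (LinearMap.ker (T ^ n)) ≤ n * finrank k (LinearMap.ker T) := by
  induction n with
  | zero => simp [Module.End.one_eq_id]
  | succ n ih =>
    have h : ∀ x ∈ LinearMap.ker (T ^ (n + 1)), T x ∈ LinearMap.ker (T ^ n) := by
      intro x hx
      rw [LinearMap.mem_ker, pow_succ, Module.End.mul_apply] at hx
      exact hx
    have h1 := LinearMap.finrank_range_add_finrank_ker (T.restrict h)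
    have h2 : finrank k (LinearMap.range (T.restrict h)) ≤ finrank k (LinearMap.ker (T ^ n)) :=
      Submodule.finrank_le _
    have h3 : finrank k (LinearMap.ker (T.restrict h)) ≤ finrank k (LinearMap.ker T) := by
      let φ : LinearMap.ker (T.restrict h) →ₗ[k] LinearMap.ker T :=
        { toFun := fun x => ⟨x.1.1, congrArg Subtype.val x.2⟩
          map_add' := fun _ _ => rfl
          map_smul' := fun _ _ => rfl }
      exact LinearMap.finrank_le_finrank_of_injective (f := φ) fun x y hxy =>
        Subtype.ext (Subtype.ext (congrArg (fun z : LinearMap.ker T => (z : X)) hxy))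
    rw [add_mul, one_mul]
    omega

theorem eigen_decomp [IsAlgClosed k] [FiniteDimensional k X] {A : End k X} {q : ℕ}
    (hq : (q : k) ≠ 0) (hA : A ^ q = 1) :
    iSupIndep (fun μ : Polynomial.nthRootsFinset q (1 : k) => A.eigenspace (μ : k)) ∧
    ⨆ μ : Polynomial.nthRootsFinset q (1 : k), A.eigenspace (μ : k) = ⊤ := by
  refine ⟨(Module.End.eigenspaces_iSupIndep A).comp Subtype.val_injective, ?_⟩
  have hq0 : 0 < q := Nat.pos_of_ne_zero (by rintro rfl; simp at hq)
  rw [eq_top_iff, ← iSup_eigenspace_of_pow hq hA]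
  refine iSup_le fun μ => ?_
  by_cases hμ : μ ∈ Polynomial.nthRootsFinset q (1 : k)
  · exact le_iSup (fun μ : Polynomial.nthRootsFinset q (1 : k) => A.eigenspace (μ : k)) ⟨μ, hμ⟩
  · intro x hx
    rw [Module.End.mem_eigenspace_iff] at hx
    have : ∀ i : ℕ, (A ^ i) x = μ ^ i • x := by
      intro i
      induction i with
      | zero => simp
      | succ i ih => rw [pow_succ', Module.End.mul_apply, ih, map_smul, hx, smul_smul, pow_succ]
    have h := this q
    rw [hA, Module.End.one_apply] at h
    rw [Polynomial.mem_nthRootsFinset hq0] at hμ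
    have h0 : (1 - μ ^ q) • x = 0 := by rw [sub_smul, one_smul, ← h, sub_self]
    rcases smul_eq_zero.1 h0 with h1 | h1
    · exact absurd (sub_eq_zero.1 h1).symm hμ
    · rw [h1]; exact Submodule.zero_mem _

theorem finrank_commutant_one [FiniteDimensional k X] :
    finrank k (commutant (1 : End k X)) = finrank k X ^ 2 := by
  have : commutant (1 : End k X) = ⊤ := by
    rw [eq_top_iff]; intro f _; exact Commute.one_left f
  rw [this, finrank_top, Module.finrank_linearMap, sq]

theorem sum_sq_le_commutant [IsAlgClosed k] [FiniteDimensional k X] {A : End k X} {q : ℕ}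
    (hq : (q : k) ≠ 0) (hA : A ^ q = 1) :
    ∑ μ : Polynomial.nthRootsFinset q (1 : k), finrank k (A.eigenspace (μ : k)) ^ 2 ≤
      finrank k (commutant A) := by
  obtain ⟨hi, hs⟩ := eigen_decomp hq hA
  refine le_trans (le_of_eq ?_) (sum_finrank_commutant_le hi hs 1 (fun i x hx => hx)
    (V := commutant A) fun f _ hf => ?_)
  · refine Finset.sum_congr rfl fun μ _ => ?_
    rw [← finrank_commutant_one]
    rfl
  · have : (⊤ : Submodule k X) ≤ LinearMap.eqLocus (A * f) (f * A) := by
      rw [← hs]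
      refine iSup_le fun μ x hx => ?_
      have h1 := hf μ x hx
      rw [Module.End.mem_eigenspace_iff] at h1 hx
      change A (f x) = f (A x)
      rw [h1, hx, map_smul]
    exact LinearMap.ext fun x => this (Submodule.mem_top (x := x))

theorem finrank_sq_le_commutant_of_pow [IsAlgClosed k] [FiniteDimensional k X] {A : End k X} {q : ℕ}
    (hq : (q : k) ≠ 0) (hA : A ^ q = 1) : finrank k X ^ 2 ≤ q * finrank k (commutant A) := by
  obtain ⟨hi, hs⟩ := eigen_decomp hq hA
  rw [finrank_eq_sum_decomp hi hs]
  refine sq_sum_le_card_mul_sum_sq.trans (Nat.mul_le_mul ?_ (sum_sq_le_commutant hq hA))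
  classical
  rw [Finset.card_univ, Fintype.card_coe]
  exact (Multiset.toFinset_card_le _).trans (Polynomial.card_nthRoots q (1 : k))

/-- An operator with few eigenvalues, or nearly unipotent, has a large commutant. -/
theorem finrank_sq_le_commutant [IsAlgClosed k] [FiniteDimensional k X] {U : End k X} {r : ℕ}
    (hr : r.Prime) {c : k} (hc : c ≠ 0) (hU : U ^ r = c • 1) :
    finrank k X ^ 2 ≤ r * finrank k (commutant U) := by
  obtain ⟨b, hb⟩ := IsAlgClosed.exists_pow_nat_eq c hr.pos
  have hb0 : b ≠ 0 := by rintro rfl; exact hc (by rw [← hb, zero_pow hr.ne_zero])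
  have hU' : (b⁻¹ • U) ^ r = 1 := by
    rw [smul_pow, hU, smul_smul, inv_pow, hb, inv_mul_cancel₀ hc, one_smul]
  have hcm : commutant (b⁻¹ • U) ≤ commutant U := by
    intro f hf
    have := (mem_commutant.1 hf).smul_left b
    rwa [smul_smul, mul_inv_cancel₀ hb0, one_smul] at this
  by_cases hr0 : (r : k) = 0
  · rcases subsingleton_or_nontrivial X with hX | hX
    · rw [Module.finrank_zero_of_subsingleton]; simp
    have := Fact.mk hr
    have hch : CharP k r := by
      obtain ⟨t, ht⟩ := CharP.exists k
      have hd : t ∣ r := (CharP.cast_eq_zero_iff k t r).1 hr0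
      rcases (Nat.dvd_prime hr).1 hd with h | h
      · subst h; exact absurd rfl (CharP.char_ne_one k 1)
      · rwa [h] at ht
    have : CharP (End k X) r :=
      charP_of_injective_algebraMap (FaithfulSMul.algebraMap_injective k (End k X)) r
    set N : End k X := b⁻¹ • U with hN
    have hN' : (N - 1) ^ r = 0 := by
      rw [sub_pow_char_of_commute (p := r) (Commute.one_right N), hU', one_pow, sub_self]
    let T : End k (End k X) := LinearMap.mulLeft k (N - 1) - LinearMap.mulRight k (N - 1)
    have hT : T ^ r = 0 := by
      have hcomm : Commute (LinearMap.mulLeft k (N - 1)) (LinearMap.mulRight k (N - 1)) :=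
        LinearMap.ext fun f => by simp [mul_assoc]
      have : CharP (End k (End k X)) r := by
        exact charP_of_injective_algebraMap
          (FaithfulSMul.algebraMap_injective k (End k (End k X))) r
      rw [sub_pow_char_of_commute (p := r) hcomm, LinearMap.pow_mulLeft, LinearMap.pow_mulRight, hN']
      ext; simp
    have h1 := finrank_ker_pow_le T r
    rw [hT, LinearMap.ker_zero, finrank_top, Module.finrank_linearMap, ← sq] at h1
    refine h1.trans (Nat.mul_le_mul_left r (Submodule.finrank_mono fun f hf => hcm ?_))
    rw [LinearMap.mem_ker, LinearMap.sub_apply, LinearMap.mulLeft_apply, LinearMap.mulRight_apply,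
      sub_mul, mul_sub, one_mul, mul_one, sub_sub_sub_cancel_right, sub_eq_zero] at hf
    exact hf
  · exact (finrank_sq_le_commutant_of_pow hr0 hU').trans
      (Nat.mul_le_mul_left r (Submodule.finrank_mono hcm))

/-- Eigenvalue count for a commuting pair of operators. -/
theorem eigen_count [IsAlgClosed k] [FiniteDimensional k X] {A : End k X} {q : ℕ}
    (hq : (q : k) ≠ 0) (hA : A ^ q = 1) :
    ∃ S n' : ℕ, finrank k X = finrank k (A.eigenspace 1) + n' ∧ n' ^ 2 + S ≤ q * S ∧
      finrank k (A.eigenspace 1) ^ 2 + S ≤ finrank k (commutant A) ∧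
      finrank k X ^ 2 ≤ q * (finrank k (A.eigenspace 1) ^ 2 + S) ∧
      ∀ (U : End k X) (r : ℕ) (c : k), r.Prime → c ≠ 0 → Commute A U → U ^ r = c • 1 →
        (∀ x, A x = x → U x = x) →
        r * finrank k (A.eigenspace 1) ^ 2 + S ≤
          r * finrank k (commutant A ⊓ commutant U : Submodule k (End k X)) := by
  classical
  obtain ⟨hi, hs⟩ := eigen_decomp hq hA
  have hq0 : 0 < q := Nat.pos_of_ne_zero (by rintro rfl; simp at hq)
  have h1m : (1 : k) ∈ Polynomial.nthRootsFinset q (1 : k) := by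
    rw [Polynomial.mem_nthRootsFinset hq0, one_pow]
  let o : Polynomial.nthRootsFinset q (1 : k) := ⟨1, h1m⟩
  have hcard : (Finset.univ : Finset (Polynomial.nthRootsFinset q (1 : k))).card ≤ q := by
    rw [Finset.card_univ, Fintype.card_coe]
    exact (Multiset.toFinset_card_le _).trans (Polynomial.card_nthRoots q (1 : k))
  have hsq := sum_sq_le_commutant hq hA
  have hdim := finrank_eq_sum_decomp hi hs
  have hcs : finrank k X ^ 2 ≤ q * ∑ μ : Polynomial.nthRootsFinset q (1 : k),
      finrank k (A.eigenspace (μ : k)) ^ 2 := by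
    rw [hdim]
    exact sq_sum_le_card_mul_sum_sq.trans (Nat.mul_le_mul_right _ hcard)
  rw [← Finset.add_sum_erase _ _ (Finset.mem_univ o)] at hsq hdim hcs
  refine ⟨∑ μ ∈ Finset.univ.erase o, finrank k (A.eigenspace (μ : k)) ^ 2,
    ∑ μ ∈ Finset.univ.erase o, finrank k (A.eigenspace (μ : k)), hdim, ?_, hsq, hcs, ?_⟩
  · have h1 := sq_sum_le_card_mul_sum_sq (s := Finset.univ.erase o)
      (f := fun μ => finrank k (A.eigenspace (μ : k)))
    have h2 : (Finset.univ.erase o).card + 1 ≤ q := by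
      rw [Finset.card_erase_add_one (Finset.mem_univ o)]; exact hcard
    calc _ ≤ (Finset.univ.erase o).card * (∑ μ ∈ Finset.univ.erase o,
          finrank k (A.eigenspace (μ : k)) ^ 2) + _ := Nat.add_le_add_right h1 _
      _ = ((Finset.univ.erase o).card + 1) * _ := (Nat.succ_mul _ _).symm
      _ ≤ _ := Nat.mul_le_mul_right _ h2
  · intro U r c hr hc hAU hU hfix
    have hUW : ∀ μ : Polynomial.nthRootsFinset q (1 : k), ∀ x ∈ A.eigenspace (μ : k),
        U x ∈ A.eigenspace (μ : k) := by
      intro μ x hx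
      rw [Module.End.mem_eigenspace_iff] at hx ⊢
      have := LinearMap.congr_fun hAU.eq x
      rw [Module.End.mul_apply, Module.End.mul_apply, hx, map_smul] at this
      exact this
    have hmain := sum_finrank_commutant_le hi hs U hUW (V := commutant A ⊓ commutant U)
      fun f hUf hf => ⟨by
        have : (⊤ : Submodule k X) ≤ LinearMap.eqLocus (A * f) (f * A) := by
          rw [← hs]
          refine iSup_le fun μ x hx => ?_
          have h1 := hf μ x hx
          rw [Module.End.mem_eigenspace_iff] at h1 hx
          change A (f x) = f (A x)
          rw [h1, hx, map_smul]
        exact LinearMap.ext fun x => this (Submodule.mem_top (x := x)), hUf⟩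
    have hall : ∀ μ : Polynomial.nthRootsFinset q (1 : k),
        finrank k (A.eigenspace (μ : k)) ^ 2 ≤ r * finrank k (commutant (U.restrict (hUW μ))) := by
      intro μ
      refine finrank_sq_le_commutant hr hc ?_
      rw [Module.End.pow_restrict]
      refine LinearMap.ext fun x => Subtype.ext ?_
      change (U ^ r) (x : X) = c • (x : X)
      rw [hU]; rfl
    have ho : finrank k (A.eigenspace 1) ^ 2 = finrank k (commutant (U.restrict (hUW o))) := by
      have : U.restrict (hUW o) = 1 := by
        refine LinearMap.ext fun x => Subtype.ext ?_
        have hx := x.2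
        rw [Module.End.mem_eigenspace_iff] at hx
        exact hfix x (hx.trans (one_smul k _))
      rw [this, finrank_commutant_one]
    refine le_trans ?_ (Nat.mul_le_mul_left r hmain)
    rw [← Finset.add_sum_erase _ _ (Finset.mem_univ o), mul_add, ← ho, Finset.mul_sum]
    exact Nat.add_le_add_left (Finset.sum_le_sum fun μ _ => hall μ) _

end Decomposition

end FittingBound

namespace FittingBound

open Subgroup Module

section Core

theorem prime_dvd_ncard {𝔾 : Type} [Group 𝔾] [Finite 𝔾] {O : Set 𝔾} {a : 𝔾} {q : ℕ} (hq : q.Prime)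
    (hO : ∀ x ∈ O, a * x * a⁻¹ ∈ O) (hpow : ∀ x ∈ O, a ^ q * x = x * a ^ q)
    (hfree : ∀ x ∈ O, a * x ≠ x * a) : q ∣ O.ncard := by
  classical
  have := Fact.mk hq
  have := Fintype.ofFinite O
  let f : Function.End O := fun x => ⟨a * x * a⁻¹, hO x x.2⟩
  have hfn : ∀ (n : ℕ) (x : O), ((f ^ n) x : 𝔾) = a ^ n * x * (a ^ n)⁻¹ := by
    intro n
    induction n with
    | zero => intro x; simp; rfl
    | succ n ih =>
      intro x
      rw [pow_succ' f]
      change a * ((f ^ n) x : 𝔾) * a⁻¹ = _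
      rw [ih, pow_succ' a]; group
  have hf : f ^ q ^ 1 = 1 := by
    funext x
    apply Subtype.ext
    rw [pow_one, hfn, hpow x x.2, mul_inv_cancel_right]; rfl
  have h := Equiv.Perm.card_fixedPoints_modEq hf
  have h0 : Fintype.card (Function.fixedPoints f) = 0 := by
    rw [Fintype.card_eq_zero_iff]
    refine ⟨fun ⟨x, hx⟩ => hfree x x.2 ?_⟩
    have : a * (x : 𝔾) * a⁻¹ = x := congrArg Subtype.val hx
    exact mul_inv_eq_iff_eq_mul.1 this
  rw [h0] at h
  rw [← Nat.card_coe_set_eq, Nat.card_eq_fintype_card]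
  exact (Nat.modEq_zero_iff_dvd).1 h

variable {𝔾 k X : Type} [Group 𝔾] [Field k] [AddCommGroup X] [Module k X]
  [Nontrivial X] {R : 𝔾 → End k X} {P : Subgroup 𝔾}

theorem ProjRep.commute_closure (hR : ProjRep R) {S : Set 𝔾} {f : End k X}
    (h : ∀ s ∈ S, Commute (R s) f) : ∀ δ ∈ closure S, Commute (R δ) f := by
  let H : Subgroup 𝔾 :=
    { carrier := {δ | hR.conjHom δ f = f}
      one_mem' := by simp
      mul_mem' := fun {x y} (hx : hR.conjHom x f = f) (hy : hR.conjHom y f = f) => by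
        change hR.conjHom (x * y) f = f
        rw [map_mul, Module.End.mul_apply, hy, hx]
      inv_mem' := fun {x} (hx : hR.conjHom x f = f) => by
        change hR.conjHom x⁻¹ f = f
        conv_lhs => rw [← hx]
        rw [← Module.End.mul_apply, ← map_mul, inv_mul_cancel, map_one, Module.End.one_apply] }
  have hH : closure S ≤ H := (closure_le _).2 fun s hs => hR.conjHom_eq_iff.2 (h s hs).eq
  exact fun δ hδ => hR.conjHom_eq_iff.1 (hH hδ)

variable [Finite 𝔾]

theorem conj_closure_mem {S : Set 𝔾} (h : ∀ s ∈ S, ∀ x ∈ P, s * x * s⁻¹ ∈ P) :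
    ∀ δ ∈ closure S, ∀ x ∈ P, δ * x * δ⁻¹ ∈ P := by
  have hc : closure S ≤ normalizer (P : Set 𝔾) := by
    rw [closure_le]
    intro s hs
    exact mem_normalizer_fintype fun x hx => h s hs x hx
  exact fun δ hδ x hx => (mem_normalizer_iff.1 (hc hδ) x).1 hx

/-- If the conjugation by `a` is free on `P` and `A` has no fixed vectors then `P` is small. -/
theorem ProjRep.card_le_of_free [IsAlgClosed k] [FiniteDimensional k X] (hR : ProjRep R)
    (hP : ∀ x ∈ P, ∀ y ∈ P, x * y = y * x) (hnd : NonDeg R P) {a : 𝔾} {q : ℕ} (hq : q.Prime)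
    (haP : ∀ x ∈ P, a * x * a⁻¹ ∈ P) (haq : ∀ x ∈ P, a ^ q * x = x * a ^ q)
    (hfree : ∀ x ∈ P, x ≠ 1 → a * x ≠ x * a) {A : End k X} {c : k} (hA : R a = c • A)
    (hAq : A ^ q = 1) (hqk : (q : k) ≠ 0) (hfix : ∀ x, A x = x → x = 0) :
    Nat.card P ≤ q ^ 2 := by
  obtain ⟨S, n', h1, h2, h3, h4, -⟩ := eigen_count hqk hAq
  have hm : finrank k (A.eigenspace 1) = 0 := by
    have : A.eigenspace 1 = ⊥ := by
      rw [eq_bot_iff]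
      intro x hx
      rw [Module.End.mem_eigenspace_iff, one_smul] at hx
      exact hfix x hx
    rw [this, finrank_bot]
  have hnorm := conj_closure_mem (P := P) (S := {a}) (by rintro s rfl; exact haP)
  have h5 := hR.finrank_commutant_le hP hnd hnorm (s := q) ?_ (V := commutant A) ?_
  · have h6 := hR.finrank_sq hP hnd
    have h7 := hR.finrank_weight_pos P
    set l := finrank k (hR.weight P 1)
    set N := Nat.card P
    set n := finrank k X
    rw [hm] at h1 h3 h4
    rw [zero_pow two_ne_zero, zero_add] at h3 h4
    obtain ⟨e, rfl⟩ : ∃ e, q = e + 1 := ⟨q - 1, by have := hq.pos; omega⟩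
    have h8 : (e + 1) * S + l ≤ (e + 1 + N) * l :=
      le_trans (by have := Nat.mul_le_mul_left (e + 1) h3; omega) h5
    have hn : n = n' := by omega
    rw [← hn] at h2
    have h9 : N * l * (e + 1) ≤ e * ((e + N) * l) := by nlinarith
    have h10 : N * l ≤ e ^ 2 * l := by nlinarith
    have h11 : N ≤ e ^ 2 := Nat.le_of_mul_le_mul_right h10 h7
    nlinarith
  · intro y hy hy1
    refine Nat.le_of_dvd ?_ (prime_dvd_ncard hq (a := a) ?_ ?_ ?_)
    · rw [Set.ncard_pos]; exact ⟨y, 1, one_mem _, by simp⟩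
    · rintro _ ⟨δ, hδ, rfl⟩
      exact ⟨a * δ, mul_mem (subset_closure rfl) hδ, by group⟩
    · rintro _ ⟨δ, hδ, rfl⟩
      exact haq _ (hnorm δ hδ y hy)
    · rintro _ ⟨δ, hδ, rfl⟩
      exact hfree _ (hnorm δ hδ y hy) (by simpa using hy1)
  · intro f hf
    refine hR.commute_closure ?_
    rintro s rfl
    rw [hA]; exact (mem_commutant.1 hf).smul_left c

theorem core_arith {q r n n' m S l N : ℕ} (hq : 2 ≤ q) (hr : 2 ≤ r) (hl : 1 ≤ l)
    (h1 : n = m + n') (h2 : n' ^ 2 + S ≤ q * S) (h4 : n ^ 2 ≤ q * (m ^ 2 + S))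
    (h6 : n ^ 2 = N * l) (h5 : q * (m ^ 2 + S) + l ≤ (q + N) * l)
    (h3 : q * (r * m ^ 2 + S) + l ≤ (q * r + N) * l) : N ≤ 10 * q ^ 2 := by
  have hm : m ^ 2 ≤ 2 * l := by
    obtain ⟨e, rfl⟩ : ∃ e, r = e + 2 := ⟨r - 2, by omega⟩
    have h : q * (e + 1) * m ^ 2 + l ≤ q * (e + 2) * l := by nlinarith
    have h' : q * (e + 1) * m ^ 2 ≤ q * (e + 1) * (2 * l) := by
      have : q * (e + 2) * l ≤ q * (e + 1) * (2 * l) := by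
        have : 0 ≤ q * e * l := Nat.zero_le _
        nlinarith
      omega
    exact Nat.le_of_mul_le_mul_left h' (by positivity)
  obtain ⟨e, rfl⟩ : ∃ e, q = e + 1 := ⟨q - 1, by omega⟩
  have h7 : n' ^ 2 ≤ e * S := by nlinarith
  have h8 : (e + 1) * S ≤ (e + N) * l := by nlinarith [Nat.zero_le ((e + 1) * m ^ 2)]
  have h9 : (e + 1) * n' ^ 2 ≤ e * (e * l) + e * n ^ 2 := by
    calc (e + 1) * n' ^ 2 ≤ (e + 1) * (e * S) := Nat.mul_le_mul_left _ h7
      _ = e * ((e + 1) * S) := by ring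
      _ ≤ e * ((e + N) * l) := Nat.mul_le_mul_left _ h8
      _ = _ := by rw [h6]; ring
  have h10 : n ^ 2 ≤ 2 * (e + 1) * (m * n) + e ^ 2 * l := by
    have : (e + 1) * n ^ 2 ≤ (e + 1) * (2 * (m * n)) + (e + 1) * n' ^ 2 := by
      rw [← mul_add]
      refine Nat.mul_le_mul_left _ ?_
      subst h1; nlinarith
    nlinarith
  have h11 : 4 * (e + 1) * (m * n) ≤ n ^ 2 + 4 * (e + 1) ^ 2 * m ^ 2 := by
    zify
    nlinarith [sq_nonneg ((n : ℤ) - 2 * (e + 1) * m)]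
  have h12 : n ^ 2 ≤ 10 * (e + 1) ^ 2 * l := by
    have : 4 * (e + 1) ^ 2 * m ^ 2 ≤ 4 * (e + 1) ^ 2 * (2 * l) := Nat.mul_le_mul_left _ hm
    nlinarith
  rw [h6] at h12
  exact Nat.le_of_mul_le_mul_right h12 hl

theorem ProjRep.card_le_of_free_pair_scalar [IsAlgClosed k] [FiniteDimensional k X] (hR : ProjRep R)
    (hP : ∀ x ∈ P, ∀ y ∈ P, x * y = y * x) (hnd : NonDeg R P) {a u : 𝔾} {q r : ℕ} (hq : q.Prime)
    (hr : r.Prime) (hqr : q ≠ r) (hau : a * u = u * a)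
    (haP : ∀ x ∈ P, a * x * a⁻¹ ∈ P) (haq : ∀ x ∈ P, a ^ q * x = x * a ^ q)
    (huP : ∀ x ∈ P, u * x * u⁻¹ ∈ P) (hur : ∀ x ∈ P, u ^ r * x = x * u ^ r)
    (hfree : ∀ x ∈ P, x ≠ 1 → a * x ≠ x * a) (hfreeu : ∀ x ∈ P, x ≠ 1 → u * x ≠ x * u)
    {A U : End k X} {c c' c'' : k} (hA : R a = c • A) (hU : R u = c' • U) (hAU : Commute A U)
    (hAq : A ^ q = 1) (hqk : (q : k) ≠ 0) (hc'' : c'' ≠ 0) (hUr : U ^ r = c'' • 1)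
    (hfix : ∀ x, A x = x → U x = x) :
    Nat.card P ≤ 10 * q ^ 2 := by
  obtain ⟨S, n', h1, h2, h3, h4, h5⟩ := eigen_count hqk hAq
  have h5 := h5 U r c'' hr hc'' hAU hUr hfix
  have hnorm := conj_closure_mem (P := P) (S := {a}) (by rintro s rfl; exact haP)
  have hnorm2 := conj_closure_mem (P := P) (S := {a, u}) (by rintro s (rfl | rfl) <;> assumption)
  have h6 := hR.finrank_commutant_le hP hnd hnorm (s := q) ?_ (V := commutant A) ?_
  · have h7 := hR.finrank_commutant_le hP hnd hnorm2 (s := q * r) ?_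
      (V := commutant A ⊓ commutant U) ?_
    · refine core_arith hq.two_le hr.two_le (hR.finrank_weight_pos P) h1 h2 h4
        (hR.finrank_sq hP hnd) ?_ ?_
      · exact le_trans (Nat.add_le_add_right (Nat.mul_le_mul_left q h3) _) h6
      · refine le_trans (Nat.add_le_add_right ?_ _) h7
        rw [mul_assoc]
        exact Nat.mul_le_mul_left q h5
    · intro y hy hy1
      refine Nat.le_of_dvd ?_ (Nat.Coprime.mul_dvd_of_dvd_of_dvd ((Nat.coprime_primes hq hr).2 hqr)
        (prime_dvd_ncard hq (a := a) ?_ ?_ ?_) (prime_dvd_ncard hr (a := u) ?_ ?_ ?_))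
      · rw [Set.ncard_pos]; exact ⟨y, 1, one_mem _, by simp⟩
      · rintro _ ⟨δ, hδ, rfl⟩
        exact ⟨a * δ, mul_mem (subset_closure (Set.mem_insert _ _)) hδ, by group⟩
      · rintro _ ⟨δ, hδ, rfl⟩
        exact haq _ (hnorm2 δ hδ y hy)
      · rintro _ ⟨δ, hδ, rfl⟩
        exact hfree _ (hnorm2 δ hδ y hy) (by simpa using hy1)
      · rintro _ ⟨δ, hδ, rfl⟩
        exact ⟨u * δ, mul_mem (subset_closure (Set.mem_insert_of_mem _ rfl)) hδ, by group⟩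
      · rintro _ ⟨δ, hδ, rfl⟩
        exact hur _ (hnorm2 δ hδ y hy)
      · rintro _ ⟨δ, hδ, rfl⟩
        exact hfreeu _ (hnorm2 δ hδ y hy) (by simpa using hy1)
    · intro f hf
      refine hR.commute_closure ?_
      rintro s (rfl | rfl)
      · rw [hA]; exact (mem_commutant.1 hf.1).smul_left c
      · rw [hU]; exact (mem_commutant.1 hf.2).smul_left c'
  · intro y hy hy1
    refine Nat.le_of_dvd ?_ (prime_dvd_ncard hq (a := a) ?_ ?_ ?_)
    · rw [Set.ncard_pos]; exact ⟨y, 1, one_mem _, by simp⟩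
    · rintro _ ⟨δ, hδ, rfl⟩
      exact ⟨a * δ, mul_mem (subset_closure rfl) hδ, by group⟩
    · rintro _ ⟨δ, hδ, rfl⟩
      exact haq _ (hnorm δ hδ y hy)
    · rintro _ ⟨δ, hδ, rfl⟩
      exact hfree _ (hnorm δ hδ y hy) (by simpa using hy1)
  · intro f hf
    refine hR.commute_closure ?_
    rintro s rfl
    rw [hA]; exact (mem_commutant.1 hf).smul_left c

/-- If the conjugations by `a` and by `u` are free on `P`, and `u` acts trivially on the fixed
vectors of `a`, then `P` is small. -/
theorem ProjRep.card_le_of_free_pair [IsAlgClosed k] [FiniteDimensional k X] (hR : ProjRep R)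
    (hP : ∀ x ∈ P, ∀ y ∈ P, x * y = y * x) (hnd : NonDeg R P) {a u : 𝔾} {q r : ℕ} (hq : q.Prime)
    (hr : r.Prime) (hqr : q ≠ r) (hau : a * u = u * a)
    (haP : ∀ x ∈ P, a * x * a⁻¹ ∈ P) (haq : ∀ x ∈ P, a ^ q * x = x * a ^ q)
    (huP : ∀ x ∈ P, u * x * u⁻¹ ∈ P) (hur : ∀ x ∈ P, u ^ r * x = x * u ^ r)
    (hfree : ∀ x ∈ P, x ≠ 1 → a * x ≠ x * a) (hfreeu : ∀ x ∈ P, x ≠ 1 → u * x ≠ x * u)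
    {A U : End k X} {c c' : k} (hA : R a = c • A) (hU : R u = c' • U)
    (hAU : Commute A U) (hAq : A ^ q = 1) (hqk : (q : k) ≠ 0)
    (hUr : ∀ x ∈ P, Commute (R x) (U ^ r)) (hfix : ∀ x, A x = x → U x = x) :
    Nat.card P ≤ 10 * q ^ 2 := by
  have hUunit : IsUnit U := by
    have h := hR.unit u
    rw [hU] at h
    have hc : c' ≠ 0 := by
      rintro rfl
      rw [zero_smul] at h
      exact not_isUnit_zero h
    have := h.smul (Units.mk0 c' hc)⁻¹
    simpa [Units.smul_def, smul_smul, inv_mul_cancel₀ hc] using this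
  obtain ⟨e, he⟩ := Module.End.exists_eigenvalue (U ^ r)
  set Y := (U ^ r).eigenspace e with hY
  have : Nontrivial Y := Submodule.nontrivial_iff_ne_bot.2 he
  have hst : ∀ T : End k X, Commute T (U ^ r) → ∀ x ∈ Y, T x ∈ Y := by
    intro T hT x hx
    rw [Module.End.mem_eigenspace_iff] at hx ⊢
    have := LinearMap.congr_fun hT.eq x
    rw [Module.End.mul_apply, Module.End.mul_apply, hx, map_smul] at this
    exact this.symm
  set H : Subgroup 𝔾 := closure ((P : Set 𝔾) ∪ {a, u}) with hH
  have hHc : ∀ h ∈ H, Commute (R h) (U ^ r) := by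
    refine hR.commute_closure ?_
    rintro s (hs | rfl | rfl)
    · exact hUr s hs
    · rw [hA]; exact (hAU.pow_right r).smul_left c
    · rw [hU]; exact ((Commute.refl U).pow_right r).smul_left c'
  let R' : H → End k Y := fun h => (R h).restrict (hst _ (hHc h h.2))
  have hR' : ProjRep R' := by
    refine ⟨fun h => ?_, fun g h => ?_⟩
    · rw [Module.End.isUnit_iff]
      have hinj : Function.Injective (R' h) := by
        intro x y hxy
        have h1 : R h x = R h y := congrArg Subtype.val hxy
        exact Subtype.ext (((Module.End.isUnit_iff _).1 (hR.unit h)).1 h1)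
      exact ⟨hinj, LinearMap.injective_iff_surjective.1 hinj⟩
    · obtain ⟨z, hz⟩ := hR.mul (g : 𝔾) h
      refine ⟨z, LinearMap.ext fun x => Subtype.ext ?_⟩
      exact LinearMap.congr_fun hz x
  have hPH : P ≤ H := fun x hx => subset_closure (Or.inl hx)
  let a' : H := ⟨a, subset_closure (Or.inr (Or.inl rfl))⟩
  let u' : H := ⟨u, subset_closure (Or.inr (Or.inr rfl))⟩
  have hAY : ∀ x ∈ Y, A x ∈ Y := hst A (hAU.pow_right r)
  have hUY : ∀ x ∈ Y, U x ∈ Y := hst U ((Commute.refl U).pow_right r)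
  have he0 : e ≠ 0 := by
    rintro rfl
    obtain ⟨x, hx, hx0⟩ := he.exists_hasEigenvector
    rw [Module.End.mem_eigenspace_iff, zero_smul] at hx
    exact hx0 (((Module.End.isUnit_iff _).1 (hUunit.pow r)).1 (by rw [hx, map_zero]))
  have key := hR'.card_le_of_free_pair_scalar (P := P.subgroupOf H) (a := a') (u := u')
    (A := A.restrict hAY) (U := U.restrict hUY) (c := c) (c' := c') (c'' := e)
    (fun x hx y hy => Subtype.ext (hP x hx y hy)) ?_ hq hr hqr (Subtype.ext hau)
    (fun x hx => haP x hx) (fun x hx => Subtype.ext (haq x hx)) (fun x hx => huP x hx)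
    (fun x hx => Subtype.ext (hur x hx))
    (fun x hx hx1 h => hfree x hx (fun h' => hx1 (Subtype.ext h')) (congrArg Subtype.val h))
    (fun x hx hx1 h => hfreeu x hx (fun h' => hx1 (Subtype.ext h')) (congrArg Subtype.val h))
    (LinearMap.ext fun x => Subtype.ext (LinearMap.congr_fun hA x))
    (LinearMap.ext fun x => Subtype.ext (LinearMap.congr_fun hU x))
    (LinearMap.ext fun x => Subtype.ext (LinearMap.congr_fun hAU.eq x)) ?_ hqk he0 ?_
    (fun x hx => Subtype.ext (hfix x (congrArg Subtype.val hx)))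
  · rwa [Nat.card_congr (subgroupOfEquivOfLe hPH).toEquiv] at key
  · intro y hy hcomm
    refine Subtype.ext (hnd y hy fun x hx => ?_)
    have hxy := hP x hx y hy
    rw [← hR.pair_eq_one_iff hxy]
    have h1 := hR.conjHom_eq_iff.1 (hR.pair_spec hxy)
    obtain ⟨v, hv⟩ := exists_ne (0 : Y)
    have h2 : R x (R y v) = R y (R x v) :=
      congrArg Subtype.val (LinearMap.congr_fun (hcomm ⟨x, hPH hx⟩ hx).eq v)
    have h3 : R x (R y v) = hR.pair x y • R y (R x v) := LinearMap.congr_fun h1 (v : X)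
    rw [h2] at h3
    have h4 : R y (R x v) ≠ 0 := by
      intro h0
      apply hv
      apply Subtype.ext
      apply ((Module.End.isUnit_iff _).1 (hR.unit x)).1
      apply ((Module.End.isUnit_iff _).1 (hR.unit y)).1
      rw [h0]; simp
    have h5 : (1 - hR.pair x y) • R y (R x v) = 0 := by rw [sub_smul, one_smul, ← h3, sub_self]
    exact (sub_eq_zero.1 ((smul_eq_zero.1 h5).resolve_right h4)).symm
  · rw [Module.End.pow_restrict]
    exact LinearMap.ext fun x => Subtype.ext (LinearMap.congr_fun hAq x)
  · rw [Module.End.pow_restrict]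
    refine LinearMap.ext fun x => Subtype.ext ?_
    exact Module.End.mem_eigenspace_iff.1 x.2

end Core

end FittingBound

namespace FittingBound

open Subgroup Module

section CoprimeAction

variable {𝔾 : Type} [Group 𝔾]

/-- The subgroup generated by the commutators `u x u⁻¹ x⁻¹` with `x ∈ P`. -/
def actCom (P : Subgroup 𝔾) (u : 𝔾) : Subgroup 𝔾 := closure {y | ∃ x ∈ P, y = u * x * u⁻¹ * x⁻¹}

/-- The fixed points of the conjugation by `u` on `P`. -/
def actFix (P : Subgroup 𝔾) (u : 𝔾) : Subgroup 𝔾 := P ⊓ centralizer {u}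

theorem mem_actFix {P : Subgroup 𝔾} {u x : 𝔾} : x ∈ actFix P u ↔ x ∈ P ∧ u * x = x * u := by
  rw [actFix, mem_inf, mem_centralizer_singleton_iff]
  exact and_congr_right fun _ => eq_comm

variable {P : Subgroup 𝔾} {u : 𝔾}

theorem mem_actCom (hP : ∀ x ∈ P, ∀ y ∈ P, x * y = y * x) (hu : ∀ x ∈ P, u * x * u⁻¹ ∈ P) {y : 𝔾} :
    y ∈ actCom P u ↔ ∃ x ∈ P, y = u * x * u⁻¹ * x⁻¹ := by
  refine ⟨fun hy => ?_, fun h => subset_closure h⟩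
  have key : ∀ x ∈ P, ∀ x' ∈ P, u * (x * x') * u⁻¹ * (x * x')⁻¹ =
      u * x * u⁻¹ * x⁻¹ * (u * x' * u⁻¹ * x'⁻¹) := by
    intro x hx x' hx'
    have h1 := hP _ (inv_mem hx) _ (mul_mem (hu x' hx') (inv_mem hx'))
    calc u * (x * x') * u⁻¹ * (x * x')⁻¹
        = u * x * u⁻¹ * ((u * x' * u⁻¹ * x'⁻¹) * x⁻¹) := by group
      _ = _ := by rw [← h1]; group
  induction hy using closure_induction with
  | mem y hy => exact hy
  | one => exact ⟨1, one_mem _, by simp⟩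
  | mul y z _ _ hy hz =>
    obtain ⟨x, hx, rfl⟩ := hy
    obtain ⟨x', hx', rfl⟩ := hz
    exact ⟨x * x', mul_mem hx hx', (key x hx x' hx').symm⟩
  | inv y _ hy =>
    obtain ⟨x, hx, rfl⟩ := hy
    refine ⟨x⁻¹, inv_mem hx, inv_eq_of_mul_eq_one_right ?_⟩
    rw [← key x hx _ (inv_mem hx)]; group

theorem actCom_le (hu : ∀ x ∈ P, u * x * u⁻¹ ∈ P) : actCom P u ≤ P := by
  rw [actCom, closure_le]
  rintro _ ⟨x, hx, rfl⟩
  exact mul_mem (hu x hx) (inv_mem hx)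

theorem actFix_le : actFix P u ≤ P := inf_le_left

theorem conj_mem_actCom {g : 𝔾} (hg : ∀ x ∈ P, g * x * g⁻¹ ∈ P) (hgu : g * u = u * g) :
    ∀ x ∈ actCom P u, g * x * g⁻¹ ∈ actCom P u := by
  intro x hx
  have h : (actCom P u).map (MulAut.conj g).toMonoidHom ≤ actCom P u := by
    rw [actCom, MonoidHom.map_closure, closure_le]
    rintro _ ⟨_, ⟨x, hx, rfl⟩, rfl⟩
    refine subset_closure ⟨g * x * g⁻¹, hg x hx, ?_⟩
    have h2 : g * u * g⁻¹ = u := by rw [hgu]; group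
    change g * (u * x * u⁻¹ * x⁻¹) * g⁻¹ = _
    calc g * (u * x * u⁻¹ * x⁻¹) * g⁻¹
        = (g * u * g⁻¹) * (g * x * g⁻¹) * (g * u * g⁻¹)⁻¹ * (g * x * g⁻¹)⁻¹ := by group
      _ = _ := by rw [h2]
  exact h ⟨x, hx, rfl⟩

theorem conj_mem_actFix {g : 𝔾} (hg : ∀ x ∈ P, g * x * g⁻¹ ∈ P) (hgu : g * u = u * g) :
    ∀ x ∈ actFix P u, g * x * g⁻¹ ∈ actFix P u := by
  intro x hx
  rw [mem_actFix] at hx ⊢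
  refine ⟨hg x hx.1, ?_⟩
  have h2 : u * g⁻¹ = g⁻¹ * u := by
    rw [eq_inv_mul_iff_mul_eq, ← mul_assoc, hgu, mul_inv_cancel_right]
  rw [← mul_assoc, ← mul_assoc, ← hgu, mul_assoc g u x, hx.2, mul_assoc _ g⁻¹ u, ← h2]
  group

theorem pow_conj_of_fixed {x y : 𝔾} (hy : u * x * u⁻¹ = y * x) (huy : u * y = y * u) (n : ℕ) :
    u ^ n * x * (u ^ n)⁻¹ = y ^ n * x := by
  induction n with
  | zero => simp
  | succ n ih =>
    have h : Commute u (y ^ n) := Commute.pow_right huy n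
    calc u ^ (n + 1) * x * (u ^ (n + 1))⁻¹ = u * (u ^ n * x * (u ^ n)⁻¹) * u⁻¹ := by
          rw [pow_succ']; group
      _ = y ^ n * (u * x * u⁻¹) := by rw [ih, ← mul_assoc, h.eq]; group
      _ = _ := by rw [hy, pow_succ]; group

theorem eq_one_of_mem_actCom_of_fixed [Finite 𝔾] (hP : ∀ x ∈ P, ∀ y ∈ P, x * y = y * x)
    (hu : ∀ x ∈ P, u * x * u⁻¹ ∈ P) {s : ℕ} (hs : ∀ x ∈ P, u ^ s * x = x * u ^ s)
    (hcop : (Nat.card P).Coprime s) {y : 𝔾} (hy : y ∈ actCom P u) (huy : u * y = y * u) : y = 1 := by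
  have hyP := actCom_le hu hy
  obtain ⟨x, hx, hxy⟩ := (mem_actCom hP hu).1 hy
  have h1 : u * x * u⁻¹ = y * x := by rw [hxy]; group
  have h2 := pow_conj_of_fixed h1 huy s
  rw [hs x hx, mul_inv_cancel_right] at h2
  have h3 : y ^ s = 1 := by simpa using h2.symm
  have h4 : y ^ Nat.card P = 1 := by
    have := pow_card_eq_one' (x := (⟨y, hyP⟩ : P))
    exact congrArg Subtype.val this
  have h5 := pow_gcd_eq_one.2 ⟨h4, h3⟩
  rwa [hcop, pow_one] at h5

theorem card_actCom_mul (hP : ∀ x ∈ P, ∀ y ∈ P, x * y = y * x)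
    (hu : ∀ x ∈ P, u * x * u⁻¹ ∈ P) :
    Nat.card P = Nat.card (actFix P u) * Nat.card (actCom P u) := by
  let f : P →* 𝔾 := MonoidHom.mk' (fun x => u * x * u⁻¹ * (x : 𝔾)⁻¹) fun x x' => by
    have h1 := hP _ (inv_mem x.2) _ (mul_mem (hu x' x'.2) (inv_mem x'.2))
    calc u * ((x : 𝔾) * x') * u⁻¹ * ((x : 𝔾) * x')⁻¹
        = u * x * u⁻¹ * ((u * x' * u⁻¹ * (x' : 𝔾)⁻¹) * (x : 𝔾)⁻¹) := by group
      _ = _ := by rw [← h1]; group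
  have hrange : f.range = actCom P u := by
    ext y
    rw [mem_actCom hP hu, MonoidHom.mem_range]
    constructor
    · rintro ⟨x, rfl⟩; exact ⟨x, x.2, rfl⟩
    · rintro ⟨x, hx, rfl⟩; exact ⟨⟨x, hx⟩, rfl⟩
  have hker : f.ker = (actFix P u).subgroupOf P := by
    ext x
    rw [MonoidHom.mem_ker, mem_subgroupOf, mem_actFix]
    change u * x * u⁻¹ * (x : 𝔾)⁻¹ = 1 ↔ _
    rw [mul_inv_eq_one, mul_inv_eq_iff_eq_mul]
    exact ⟨fun h => ⟨x.2, h⟩, fun h => h.2⟩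
  have h := Subgroup.card_mul_index f.ker
  rw [← h, Subgroup.index_ker, hrange, hker,
    Nat.card_congr (subgroupOfEquivOfLe (actFix_le (P := P) (u := u))).toEquiv]

theorem exists_actFix_mul_actCom [Finite 𝔾] (hP : ∀ x ∈ P, ∀ y ∈ P, x * y = y * x)
    (hu : ∀ x ∈ P, u * x * u⁻¹ ∈ P) {s : ℕ} (hs : ∀ x ∈ P, u ^ s * x = x * u ^ s)
    (hcop : (Nat.card P).Coprime s) {x : 𝔾} (hx : x ∈ P) :
    ∃ c ∈ actFix P u, ∃ w ∈ actCom P u, x = c * w := by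
  let g : actCom P u → actCom P u := fun w =>
    ⟨u * w * u⁻¹ * (w : 𝔾)⁻¹, (mem_actCom hP hu).2 ⟨w, actCom_le hu w.2, rfl⟩⟩
  have key : ∀ x ∈ P, ∀ x' ∈ P, u * x * u⁻¹ * x⁻¹ = u * x' * u⁻¹ * x'⁻¹ →
      u * (x * x'⁻¹) = x * x'⁻¹ * u := by
    intro x hx x' hx' h
    have h1 : x⁻¹ * x' = x' * x⁻¹ := hP _ (inv_mem hx) _ hx'
    have h2 : u * x * u⁻¹ * (x⁻¹ * x') = u * x' * u⁻¹ := by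
      rw [← mul_assoc, h, inv_mul_cancel_right]
    have h3 := hP _ (hu x hx) _ (mul_mem (inv_mem hx) hx')
    rw [h3] at h2
    have h4 : u * x' * u⁻¹ * (u * x * u⁻¹)⁻¹ = x⁻¹ * x' := by rw [← h2]; group
    have h5 : u * (x' * x⁻¹) * u⁻¹ = x' * x⁻¹ := 
      calc u * (x' * x⁻¹) * u⁻¹ = u * x' * u⁻¹ * (u * x * u⁻¹)⁻¹ := by group
        _ = _ := h4.trans h1
    have h6 := congrArg (·⁻¹) h5
    simp only [mul_inv_rev, inv_inv] at h6
    rw [← mul_assoc, mul_inv_eq_iff_eq_mul] at h6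
    simpa [mul_assoc] using h6
  have hg : Function.Injective g := by
    intro w w' hww
    have h1 := key w (actCom_le hu w.2) w' (actCom_le hu w'.2) (congrArg Subtype.val hww)
    have := eq_one_of_mem_actCom_of_fixed hP hu hs hcop (mul_mem w.2 (inv_mem w'.2)) h1
    exact Subtype.ext (mul_inv_eq_one.1 this)
  obtain ⟨w, hw⟩ := Finite.surjective_of_injective hg
    ⟨u * x * u⁻¹ * x⁻¹, (mem_actCom hP hu).2 ⟨x, hx, rfl⟩⟩
  have h1 := key x hx w (actCom_le hu w.2) (congrArg Subtype.val hw).symm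
  exact ⟨x * (w : 𝔾)⁻¹, mem_actFix.2 ⟨mul_mem hx (inv_mem (actCom_le hu w.2)), h1⟩, w, w.2,
    by group⟩

variable {k X : Type} [Field k] [AddCommGroup X] [Module k X] [Nontrivial X] {R : 𝔾 → End k X}

theorem ProjRep.pair_actFix_actCom (hR : ProjRep R) (hP : ∀ x ∈ P, ∀ y ∈ P, x * y = y * x)
    (hu : ∀ x ∈ P, u * x * u⁻¹ ∈ P) {c w : 𝔾} (hc : c ∈ actFix P u) (hw : w ∈ actCom P u) :
    hR.pair c w = 1 := by
  obtain ⟨x, hx, rfl⟩ := (mem_actCom hP hu).1 hw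
  rw [mem_actFix] at hc
  have h1 := hP c hc.1 x hx
  have h2 := hP c hc.1 _ (hu x hx)
  rw [hR.pair_mul_right h2 (hP c hc.1 _ (inv_mem hx)), hR.pair_inv_right h1]
  have h3 := hR.pair_conj u h1
  rw [hc.2, mul_inv_cancel_right] at h3
  rw [h3, mul_inv_cancel₀ (hR.pair_ne_zero h1)]

theorem ProjRep.nonDeg_of_orth (hR : ProjRep R) (hP : ∀ x ∈ P, ∀ y ∈ P, x * y = y * x)
    (hnd : NonDeg R P) {C W : Subgroup 𝔾} (hC : C ≤ P) (hW : W ≤ P)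
    (hCW : ∀ x ∈ P, ∃ c ∈ C, ∃ w ∈ W, x = c * w) (horth : ∀ c ∈ C, ∀ w ∈ W, hR.pair c w = 1) :
    NonDeg R C ∧ NonDeg R W := by
  constructor
  · intro y hy h
    refine hnd y (hC hy) fun x hx => ?_
    obtain ⟨c, hc, w, hw, rfl⟩ := hCW x hx
    have hcy := hP c (hC hc) y (hC hy)
    have hwy := hP w (hW hw) y (hC hy)
    rw [← hR.pair_eq_one_iff (hP _ hx y (hC hy)), hR.pair_mul_left hcy hwy,
      (hR.pair_eq_one_iff hcy).2 (h c hc), hR.pair_swap hwy.symm, horth y hy w hw, inv_one, one_mul]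
  · intro y hy h
    refine hnd y (hW hy) fun x hx => ?_
    obtain ⟨c, hc, w, hw, rfl⟩ := hCW x hx
    have hcy := hP c (hC hc) y (hW hy)
    have hwy := hP w (hW hw) y (hW hy)
    rw [← hR.pair_eq_one_iff (hP _ hx y (hW hy)), hR.pair_mul_left hcy hwy,
      (hR.pair_eq_one_iff hwy).2 (h w hw), horth c hc y hy, one_mul]

theorem ProjRep.nonDeg_act [Finite 𝔾] (hR : ProjRep R) (hP : ∀ x ∈ P, ∀ y ∈ P, x * y = y * x)
    (hnd : NonDeg R P) (hu : ∀ x ∈ P, u * x * u⁻¹ ∈ P) {s : ℕ}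
    (hs : ∀ x ∈ P, u ^ s * x = x * u ^ s) (hcop : (Nat.card P).Coprime s) :
    NonDeg R (actFix P u) ∧ NonDeg R (actCom P u) :=
  hR.nonDeg_of_orth hP hnd actFix_le (actCom_le hu)
    (fun _ hx => exists_actFix_mul_actCom hP hu hs hcop hx)
    (fun _ hc _ hw => hR.pair_actFix_actCom hP hu hc hw)

theorem ProjRep.pow_eq (hR : ProjRep R) {D : End k X} {c : k} (hD : R u = c • D) (n : ℕ) :
    ∃ c' : k, R (u ^ n) = c' • D ^ n := by
  induction n with
  | zero =>
    obtain ⟨z, -, hz⟩ := hR.one_eq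
    exact ⟨z, by rw [pow_zero, pow_zero, hz]⟩
  | succ n ih =>
    obtain ⟨c', hc'⟩ := ih
    obtain ⟨z, -, hz⟩ := hR.mul_eq (u ^ n) u
    refine ⟨z * (c' * c), ?_⟩
    rw [pow_succ, hz, hc', hD, smul_mul_smul_comm, smul_smul, pow_succ]

/-- An `r`-element acting trivially on all fixed points of `a` has few commutators with `P`. -/
theorem ProjRep.card_actCom_le [Finite 𝔾] [IsAlgClosed k] [FiniteDimensional k X] (hR : ProjRep R)
    (hP : ∀ x ∈ P, ∀ y ∈ P, x * y = y * x) (hnd : NonDeg R P) {a d : 𝔾} {q r e : ℕ} (hq : q.Prime)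
    (hr : r.Prime) (hqr : q ≠ r) (hrP : ¬ r ∣ Nat.card P) (had : a * d = d * a)
    (haP : ∀ x ∈ P, a * x * a⁻¹ ∈ P) (haq : ∀ x ∈ P, a ^ q * x = x * a ^ q)
    (hdP : ∀ x ∈ P, d * x * d⁻¹ ∈ P) (hde : ∀ x ∈ P, d ^ r ^ e * x = x * d ^ r ^ e)
    (hfixP : ∀ x ∈ P, a * x = x * a → d * x = x * d)
    {A D : End k X} {c c' : k} (hA : R a = c • A) (hD : R d = c' • D)
    (hAD : Commute A D) (hAq : A ^ q = 1) (hqk : (q : k) ≠ 0)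
    (hfix : ∀ x, A x = x → D x = x) :
    Nat.card (actCom P d) ≤ (10 * q ^ 2) ^ (10 * q ^ 2) := by
  set β := 10 * q ^ 2 with hβ
  have hβ1 : 1 ≤ β := Nat.mul_pos (by norm_num) (pow_pos hq.pos 2)
  have hdn : ∀ n : ℕ, ∀ x ∈ P, d ^ n * x * (d ^ n)⁻¹ ∈ P := by
    intro n
    induction n with
    | zero => intro x hx; simpa using hx
    | succ n ih =>
      intro x hx
      have := ih _ (hdP x hx)
      rwa [pow_succ, mul_inv_rev, show d ^ n * d * x * (d⁻¹ * (d ^ n)⁻¹) =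
        d ^ n * (d * x * d⁻¹) * (d ^ n)⁻¹ by group]
  have had' : ∀ n : ℕ, a * d ^ n = d ^ n * a := fun n => (Commute.pow_right had n).eq
  have hcop : ∀ n (Q : Subgroup 𝔾), Q ≤ P → (Nat.card Q).Coprime (r ^ n) := fun n Q hQ =>
    Nat.Coprime.pow_right n (((Nat.Prime.coprime_iff_not_dvd hr).2 fun h =>
      hrP (h.trans (card_dvd_of_le hQ))).symm)
  -- commutator subgroups attached to successive powers of `d`
  have step : ∀ j, Nat.card (actCom (actFix P (d ^ r ^ (j + 1))) (d ^ r ^ j)) ≤ β := by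
    intro j
    set u := d ^ r ^ j with hu
    have hur' : d ^ r ^ (j + 1) = u ^ r := by rw [hu, ← pow_mul, pow_succ]
    rw [hur']
    set Q := actFix P (u ^ r) with hQ
    have hQP : Q ≤ P := actFix_le
    have hQc : ∀ x ∈ Q, ∀ y ∈ Q, x * y = y * x := fun x hx y hy => hP x (hQP hx) y (hQP hy)
    have huu : u * u ^ r = u ^ r * u := ((Commute.refl u).pow_right r).eq
    have huQ : ∀ x ∈ Q, u * x * u⁻¹ ∈ Q := conj_mem_actFix (hdn _) huu
    have hau : a * u = u * a := had' _
    have haQ : ∀ x ∈ Q, a * x * a⁻¹ ∈ Q := conj_mem_actFix haP (Commute.pow_right hau r).eq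
    have hQr : ∀ x ∈ Q, u ^ r * x = x * u ^ r := fun x hx => (mem_actFix.1 hx).2
    have hQnd : NonDeg R Q := by
      refine (hR.nonDeg_act hP hnd (u := u ^ r) (s := r ^ e) ?_ ?_ (hcop e P le_rfl)).1
      · rw [← hur']; exact hdn _
      · intro x hx
        have : Commute (d ^ r ^ e) x := hde x hx
        rw [← hur', ← pow_mul, mul_comm, pow_mul]
        exact this.pow_left _
    have hWnd := (hR.nonDeg_act hQc hQnd huQ hQr (by simpa using hcop 1 Q hQP)).2
    have hWQ : actCom Q u ≤ Q := actCom_le huQ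
    have hWone : ∀ y ∈ actCom Q u, u * y = y * u → y = 1 := fun y hy hyu =>
      eq_one_of_mem_actCom_of_fixed hQc huQ hQr (by simpa using hcop 1 Q hQP) hy hyu
    have hdpow : ∀ (n : ℕ) (x : X), D x = x → (D ^ n) x = x := by
      intro n x hx
      induction n with
      | zero => simp
      | succ n ih => rw [pow_succ, Module.End.mul_apply, hx, ih]
    obtain ⟨c'', hc''⟩ := hR.pow_eq hD (r ^ j)
    refine hR.card_le_of_free_pair (P := actCom Q u) (a := a) (u := u) (A := A) (U := D ^ r ^ j)
      (fun x hx y hy => hQc x (hWQ hx) y (hWQ hy)) hWnd hq hr hqr hau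
      (conj_mem_actCom haQ hau) (fun x hx => haq x (hQP (hWQ hx)))
      (conj_mem_actCom huQ rfl) (fun x hx => hQr x (hWQ hx)) ?_
      (fun x hx hx1 h => hx1 (hWone x hx h)) hA hc'' (hAD.pow_right _) hAq hqk ?_
      (fun x hx => hdpow _ x (hfix x hx))
    · intro x hx hx1 h
      refine hx1 (hWone x hx ?_)
      have : Commute d x := hfixP x (hQP (hWQ hx)) h
      exact (this.pow_left _).eq
    · intro x hx
      obtain ⟨c₃, hc₃⟩ := hR.pow_eq hc'' r
      have hc₃0 : c₃ ≠ 0 := by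
        rintro rfl
        rw [zero_smul] at hc₃
        exact hR.ne_zero _ hc₃
      obtain ⟨y, hy, rfl⟩ := (mem_actCom hQc huQ).1 hx
      have h1 := hQr y hy
      have h2 := hQr _ (huQ y hy)
      have h3 : hR.pair (u ^ r) (u * y * u⁻¹ * y⁻¹) = 1 := by
        rw [hR.pair_mul_right h2 (hQr _ (inv_mem hy)), hR.pair_inv_right h1]
        have h4 := hR.pair_conj u h1
        rw [huu, mul_inv_cancel_right] at h4
        rw [h4, mul_inv_cancel₀ (hR.pair_ne_zero h1)]
      have h5 := (hR.pair_eq_one_iff (hQr _ (hWQ hx))).1 h3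
      rw [hc₃] at h5
      have h6 := h5.smul_left c₃⁻¹
      rw [smul_smul, inv_mul_cancel₀ hc₃0, one_smul] at h6
      exact h6.symm
  have chain : ∀ j, Nat.card (actFix P (d ^ r ^ j)) ≤ Nat.card (actFix P d) * β ^ j := by
    intro j
    induction j with
    | zero => simp
    | succ j ih =>
      have huu : d ^ r ^ j * d ^ r ^ (j + 1) = d ^ r ^ (j + 1) * d ^ r ^ j :=
        (Commute.pow_pow_self d _ _).eq
      have h := card_actCom_mul (P := actFix P (d ^ r ^ (j + 1))) (u := d ^ r ^ j)
        (fun x hx y hy => hP x hx.1 y hy.1) (conj_mem_actFix (hdn _) huu)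
      have h2 : actFix (actFix P (d ^ r ^ (j + 1))) (d ^ r ^ j) ≤ actFix P (d ^ r ^ j) :=
        fun x hx => mem_actFix.2 ⟨(mem_actFix.1 (mem_actFix.1 hx).1).1, (mem_actFix.1 hx).2⟩
      rw [h, pow_succ β, ← mul_assoc]
      exact Nat.mul_le_mul ((Subgroup.card_le_of_le h2).trans ih) (step j)
  -- the number of steps
  have hex : ∃ n, ∀ x ∈ P, d ^ r ^ n * x = x * d ^ r ^ n := ⟨e, hde⟩
  classical
  set m := Nat.find hex with hm
  have hmspec : ∀ x ∈ P, d ^ r ^ m * x = x * d ^ r ^ m := Nat.find_spec hex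
  have hfull : actFix P (d ^ r ^ m) = P :=
    le_antisymm actFix_le fun x hx => mem_actFix.2 ⟨hx, hmspec x hx⟩
  have hmβ : m ≤ β := by
    rcases Nat.eq_zero_or_pos m with h0 | hpos
    · rw [h0]; exact Nat.zero_le _
    obtain ⟨n, hn⟩ : ∃ n, m = n + 1 := ⟨m - 1, by omega⟩
    have hnot : ¬ ∀ x ∈ P, d ^ r ^ n * x = x * d ^ r ^ n := Nat.find_min hex (by omega)
    push Not at hnot
    obtain ⟨x, hx, hxne⟩ := hnot
    set u := d ^ r ^ n with hu
    have hst := step n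
    rw [← hn, hfull] at hst
    set y := u * x * u⁻¹ * x⁻¹ with hy
    have hyW : y ∈ actCom P u := (mem_actCom hP (hdn _)).2 ⟨x, hx, rfl⟩
    have hur : ∀ x ∈ P, u ^ r * x = x * u ^ r := by
      rw [hu, ← pow_mul, ← pow_succ, ← hn]; exact hmspec
    have hyne : ¬ u * y = y * u := by
      intro h
      have := eq_one_of_mem_actCom_of_fixed hP (hdn _) hur (by simpa using hcop 1 P le_rfl) hyW h
      rw [hy, mul_inv_eq_one, mul_inv_eq_iff_eq_mul] at this
      exact hxne this
    let f : actCom P u → actCom P u := fun w =>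
      ⟨d * w * d⁻¹, conj_mem_actCom hdP ((Commute.refl d).pow_right _).eq w w.2⟩
    have hfn : ∀ (i : ℕ) (w : actCom P u), (f^[i] w : 𝔾) = d ^ i * w * (d ^ i)⁻¹ := by
      intro i
      induction i with
      | zero => intro w; simp
      | succ i ih =>
        intro w
        rw [Function.iterate_succ_apply']
        change d * (f^[i] w : 𝔾) * d⁻¹ = _
        rw [ih, pow_succ' d]; group
    have := Fact.mk hr
    have hper := Function.minimalPeriod_eq_prime_pow (f := f) (x := ⟨y, hyW⟩) (p := r) (k := n)
      (fun h => hyne (mul_inv_eq_iff_eq_mul.1 ((hfn _ _).symm.trans (congrArg Subtype.val h))))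
      (Subtype.ext (by
        rw [hfn, ← hn, hmspec _ (actCom_le (hdn _) hyW), mul_inv_cancel_right]))
    have := Fintype.ofFinite (actCom P u)
    have hle := Function.minimalPeriod_le_card (f := f) (x := ⟨y, hyW⟩)
    rw [hper, ← Nat.card_eq_fintype_card, ← hn] at hle
    exact ((Nat.lt_pow_self hr.one_lt).le.trans hle).trans hst
  have h1 := card_actCom_mul hP hdP
  have h2 := chain m
  rw [hfull, h1] at h2
  have h3 : Nat.card (actCom P d) ≤ β ^ m := Nat.le_of_mul_le_mul_left h2 Nat.card_pos
  exact h3.trans (Nat.pow_le_pow_right hβ1 hmβ)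

/-- The elements of `P` killed by `s`. -/
def torPart (P : Subgroup 𝔾) (hP : ∀ x ∈ P, ∀ y ∈ P, x * y = y * x) (s : ℕ) : Subgroup 𝔾 where
  carrier := {x | x ∈ P ∧ x ^ s = 1}
  one_mem' := ⟨one_mem _, one_pow _⟩
  mul_mem' := fun {x y} hx hy => ⟨mul_mem hx.1 hy.1, by
    rw [Commute.mul_pow (hP x hx.1 y hy.1), hx.2, hy.2, one_mul]⟩
  inv_mem' := fun {x} hx => ⟨inv_mem hx.1, by rw [inv_pow, hx.2, inv_one]⟩

theorem ProjRep.nonDeg_torPart (hR : ProjRep R) (hP : ∀ x ∈ P, ∀ y ∈ P, x * y = y * x)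
    (hnd : NonDeg R P) {s s' : ℕ} (hss : s.Coprime s') (hcard : Nat.card P = s' * s) :
    NonDeg R (torPart P hP s) := by
  intro y hy h
  refine hnd y hy.1 fun x hx => ?_
  have hxy := hP x hx y hy.1
  rw [← hR.pair_eq_one_iff hxy]
  have h1 : hR.pair x y ^ s' = 1 := by
    rw [← hR.pair_pow_left hxy, hR.pair_eq_one_iff (Commute.pow_left hxy s').eq]
    refine h _ ⟨pow_mem hx _, ?_⟩
    rw [← pow_mul, ← hcard]
    exact congrArg Subtype.val (pow_card_eq_one' (x := (⟨x, hx⟩ : P)))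
  have h2 : hR.pair x y ^ s = 1 := by
    have : hR.pair y x ^ s = 1 := by
      rw [← hR.pair_pow_left hxy.symm, hy.2, hR.pair_swap (by simp), hR.pair_one_right, inv_one]
    rw [hR.pair_swap hxy.symm, inv_pow, this, inv_one]
  have h3 := pow_gcd_eq_one.2 ⟨h2, h1⟩
  rwa [hss, pow_one] at h3

theorem not_dvd_card_torPart [Finite 𝔾] {hP : ∀ x ∈ P, ∀ y ∈ P, x * y = y * x} {r s : ℕ} (hr : r.Prime)
    (hrs : ¬ r ∣ s) : ¬ r ∣ Nat.card (torPart P hP s) := by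
  intro h
  have := Fact.mk hr
  obtain ⟨x, hx⟩ := exists_prime_orderOf_dvd_card' r h
  apply hrs
  rw [← hx, ← Subgroup.orderOf_coe]
  exact orderOf_dvd_of_pow_eq_one x.2.2

end CoprimeAction

end FittingBound

namespace FittingBound

open Subgroup Module
open scoped commutatorElement

section ScalarQuotient

variable {Γ k X : Type} [Group Γ] [Field k] [AddCommGroup X] [Module k X]

/-- The projective representation of the quotient by the scalar elements. -/
noncomputable def scalRep (ρ : Γ →* End k X) : Γ ⧸ scal ρ → End k X := fun g => ρ g.out

theorem scalRep_mk (ρ : Γ →* End k X) (γ : Γ) :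
    ∃ c : k, scalRep ρ (QuotientGroup.mk' (scal ρ) γ) = c • ρ γ := by
  obtain ⟨z, hz⟩ := QuotientGroup.mk_out_eq_mul (scal ρ) γ
  obtain ⟨c, hc⟩ := mem_scal.1 z.2
  refine ⟨c, ?_⟩
  change ρ (Quotient.out (γ : Γ ⧸ scal ρ)) = _
  rw [hz, map_mul, hc, mul_smul_comm, mul_one]

theorem isUnit_rho (ρ : Γ →* End k X) (γ : Γ) : IsUnit (ρ γ) := (Group.isUnit γ).map ρ

theorem scalRep_projRep (ρ : Γ →* End k X) : ProjRep (scalRep ρ) where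
  unit := fun g => isUnit_rho ρ _
  mul := fun g h => by
    obtain ⟨c, hc⟩ := scalRep_mk ρ (g.out * h.out)
    refine ⟨c, ?_⟩
    rw [map_mul, map_mul] at hc
    have e : ∀ g : Γ ⧸ scal ρ, QuotientGroup.mk' (scal ρ) g.out = g := fun g =>
      QuotientGroup.out_eq' g
    rw [e, e] at hc
    exact hc

theorem mk_mem_scal {ρ : Γ →* End k X} {x y : Γ}
    (h : QuotientGroup.mk' (scal ρ) x = QuotientGroup.mk' (scal ρ) y) : x⁻¹ * y ∈ scal ρ :=
  QuotientGroup.eq.1 h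

theorem MaxAb.map_comm {ρ : Γ →* End k X} {G B : Subgroup Γ} (hB : MaxAb ρ G B) :
    ∀ x ∈ B.map (QuotientGroup.mk' (scal ρ)), ∀ y ∈ B.map (QuotientGroup.mk' (scal ρ)),
      x * y = y * x := by
  rintro _ ⟨x, hx, rfl⟩ _ ⟨y, hy, rfl⟩
  have h := hB.comm (commutator_mem_commutator hx hy)
  rw [← QuotientGroup.eq_one_iff] at h
  rw [← commutatorElement_eq_one_iff_mul_comm]
  exact h

theorem MaxAb.map_nonDeg [Finite Γ] [IsAlgClosed k] [FiniteDimensional k X] {ρ : Γ →* End k X}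
    (hρ : Irr ρ) (hp : Prim ρ) {G B : Subgroup Γ} [G.Normal] (hG : Sol G) (hB : MaxAb ρ G B) :
    NonDeg (scalRep ρ) (B.map (QuotientGroup.mk' (scal ρ))) := by
  have := hρ.nontrivial
  rintro _ ⟨y, hy, rfl⟩ h
  refine (QuotientGroup.eq_one_iff y).2 (hB.mem_scal_of_commute hρ hp hG (hB.le hy) fun b hb => ?_)
  obtain ⟨c, hc⟩ := scalRep_mk ρ y
  obtain ⟨c', hc'⟩ := scalRep_mk ρ b
  have hne : ∀ {γ : Γ} {c : k}, scalRep ρ (QuotientGroup.mk' (scal ρ) γ) = c • ρ γ → c ≠ 0 := by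
    rintro γ c h rfl
    rw [zero_smul] at h
    exact (scalRep_projRep ρ).ne_zero _ h
  have h1 := h _ ⟨b, hb, rfl⟩
  rw [hc, hc'] at h1
  have h2 := (h1.smul_left c'⁻¹).smul_right c⁻¹
  rw [smul_smul, smul_smul, inv_mul_cancel₀ (hne hc), inv_mul_cancel₀ (hne hc'), one_smul,
    one_smul] at h2
  exact h2.symm

theorem exists_finset_lift [Finite Γ] {ρ : Γ →* End k X} {G : Subgroup Γ}
    {W : Subgroup (Γ ⧸ scal ρ)} (hW : W ≤ G.map (QuotientGroup.mk' (scal ρ))) :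
    ∃ F : Finset Γ, F.card ≤ Nat.card W ∧ ∀ y ∈ G, QuotientGroup.mk' (scal ρ) y ∈ W →
      ∃ f ∈ F, f⁻¹ * y ∈ G ⊓ scal ρ := by
  classical
  have := Fintype.ofFinite W
  choose f hf hf' using fun w : W => hW w.2
  refine ⟨Finset.univ.image f, ?_, fun y hy hyW => ⟨f ⟨_, hyW⟩, Finset.mem_image_of_mem _
    (Finset.mem_univ _), G.mul_mem (G.inv_mem (hf _)) hy, mk_mem_scal (hf' ⟨_, hyW⟩)⟩⟩
  rw [Nat.card_eq_fintype_card]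
  exact Finset.card_image_le

theorem conj_mem_map {B : Subgroup Γ} (hB : B.Normal) (γ : Γ) {Δ : Type} [Group Δ] (f : Γ →* Δ) :
    ∀ x ∈ B.map f, f γ * x * (f γ)⁻¹ ∈ B.map f := by
  rintro _ ⟨x, hx, rfl⟩
  exact ⟨γ * x * γ⁻¹, hB.conj_mem x hx γ, by simp⟩

variable [Finite Γ] [IsAlgClosed k] [FiniteDimensional k X] {ρ : Γ →* End k X}
  {G B : Subgroup Γ} {a : Γ} {q : ℕ}

theorem Setup.card_map_coprime (h : Setup G a q) (hB : B ≤ G) {Δ : Type} [Group Δ] (f : Γ →* Δ) :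
    (Nat.card (B.map f)).Coprime q := by
  refine ((Nat.Prime.coprime_iff_not_dvd h.prime).2 fun hd => ?_).symm
  exact not_dvd_card_of_le h.cop hB (hd.trans (Subgroup.card_map_dvd B f))

/-- If `a` has no fixed vectors then it has few commutators with an abelian normal section. -/
theorem MaxAb.exists_finset_of_free (hρ : Irr ρ) (hp : Prim ρ) (h : Setup G a q)
    (hB : MaxAb ρ G B) (hqk : (q : k) ≠ 0) (hfix : ∀ x, ρ a x = x → x = 0) :
    ∃ F : Finset Γ, F.card ≤ q ^ 2 ∧ ∀ x ∈ B, ∃ f ∈ F, f⁻¹ * ⁅a, x⁆ ∈ G ⊓ scal ρ := by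
  have := h.normal
  have := hρ.nontrivial
  have hBn := hB.normal
  set π := QuotientGroup.mk' (scal ρ) with hπ
  have hc := hB.map_comm
  have hnd := hB.map_nonDeg hρ hp h.sol
  have hR := scalRep_projRep ρ
  have haB := conj_mem_map hBn a π
  have haq : ∀ x : Γ ⧸ scal ρ, π a ^ q * x = x * π a ^ q := by
    intro x; rw [← map_pow, h.pow, map_one, one_mul, mul_one]
  have hcop := h.card_map_coprime hB.le π
  obtain ⟨c, hca⟩ := scalRep_mk ρ a
  have key := hR.card_le_of_free (P := actCom (B.map π) (π a))
    (fun x hx y hy => hc x (actCom_le haB hx) y (actCom_le haB hy))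
    (hR.nonDeg_act hc hnd haB (fun x _ => haq x) hcop).2 h.prime (conj_mem_actCom haB rfl)
    (fun x _ => haq x)
    (fun x hx hx1 hax => hx1 (eq_one_of_mem_actCom_of_fixed hc haB (fun x _ => haq x) hcop hx hax))
    hca (by rw [← map_pow, h.pow, map_one]) hqk hfix
  obtain ⟨F, hF, hF'⟩ := exists_finset_lift (G := G)
    ((actCom_le haB).trans (Subgroup.map_mono hB.le))
  refine ⟨F, hF.trans key, fun x hx => hF' _ (hB.le ?_) ?_⟩
  · exact commutatorElement_mem_right hBn a hx
  · refine (mem_actCom hc haB).2 ⟨π x, ⟨x, hx, rfl⟩, ?_⟩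
    rw [commutatorElement_def]; simp [hπ]

/-- An `r`-element centralizing the fixed points of `a` has few commutators with a chief factor
of an abelian normal section. -/
theorem MaxAb.exists_finset_of_fixed (hρ : Irr ρ) (hp : Prim ρ) (h : Setup G a q)
    (hB : MaxAb ρ G B) (hqk : (q : k) ≠ 0) {d : Γ} {r e : ℕ} (hr : r.Prime) (hqr : q ≠ r)
    (had : a * d = d * a) (hde : d ^ r ^ e = 1) (hfix : ∀ x, ρ a x = x → ρ d x = x)
    (hfixB : ∀ b ∈ B, a * b = b * a → ⁅d, b⁆ ∈ scal ρ) {N P : Subgroup Γ} (hN : G ⊓ scal ρ ≤ N)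
    (hP : P ≤ B) (hNP : IsChief N P) {t : ℕ} (ht : t.Prime) (htr : t ≠ r)
    (hPt : ∀ x ∈ P, x ^ t ∈ N) :
    ∃ F : Finset Γ, F.card ≤ (10 * q ^ 2) ^ (10 * q ^ 2) ∧ ∀ x ∈ P, ∃ f ∈ F, f⁻¹ * ⁅d, x⁆ ∈ N := by
  have := h.normal
  have := hρ.nontrivial
  have hBn := hB.normal
  have hPn := hNP.normal_right
  have hNn := hNP.normal_left
  set π := QuotientGroup.mk' (scal ρ) with hπ
  have hc := hB.map_comm
  have hnd := hB.map_nonDeg hρ hp h.sol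
  have hR := scalRep_projRep ρ
  obtain ⟨v, s, hs, hcard⟩ := Nat.exists_eq_pow_mul_and_not_dvd
    (Nat.card_pos (α := B.map π)).ne' r hr.ne_one
  set T := torPart (B.map π) hc s with hT
  have hTB : T ≤ B.map π := fun x hx => hx.1
  have hTn : ∀ γ : Γ, ∀ x ∈ T, π γ * x * (π γ)⁻¹ ∈ T := fun γ x hx =>
    ⟨conj_mem_map hBn γ π x hx.1, by rw [conj_pow, hx.2, mul_one, mul_inv_cancel]⟩
  have hTc : ∀ x ∈ T, ∀ y ∈ T, x * y = y * x := fun x hx y hy => hc x hx.1 y hy.1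
  have hsv : s.Coprime (r ^ v) :=
    Nat.Coprime.pow_right v ((Nat.Prime.coprime_iff_not_dvd hr).2 hs).symm
  have hTnd : NonDeg (scalRep ρ) T := hR.nonDeg_torPart hc hnd hsv hcard
  have haq : ∀ x : Γ ⧸ scal ρ, π a ^ q * x = x * π a ^ q := by
    intro x; rw [← map_pow, h.pow, map_one, one_mul, mul_one]
  have hdr : ∀ x : Γ ⧸ scal ρ, π d ^ r ^ e * x = x * π d ^ r ^ e := by
    intro x; rw [← map_pow, hde, map_one, one_mul, mul_one]
  obtain ⟨c, hca⟩ := scalRep_mk ρ a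
  obtain ⟨c', hcd⟩ := scalRep_mk ρ d
  have key := hR.card_actCom_le hTc hTnd (a := π a) (d := π d) h.prime hr hqr
    (not_dvd_card_torPart hr hs) (by rw [← map_mul, had, map_mul]) (hTn a) (fun x _ => haq x)
    (hTn d) (fun x _ => hdr x) ?_ hca hcd
    (by rw [Commute, SemiconjBy, ← map_mul, had, map_mul]) (by rw [← map_pow, h.pow, map_one]) hqk
    hfix
  · obtain ⟨F, hF, hF'⟩ := exists_finset_lift (G := G)
      ((actCom_le (hTn d)).trans (hTB.trans (Subgroup.map_mono hB.le)))
    refine ⟨F, hF.trans key, fun x hx => ?_⟩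
    have htv : (r ^ v).Coprime t :=
      Nat.Coprime.pow_left v ((Nat.coprime_primes hr ht).2 htr.symm)
    obtain ⟨m, hm1, hm2⟩ := Nat.chineseRemainder htv 0 1
    have hxm : x ^ m ∈ P := pow_mem hx m
    have hxN : x⁻¹ * x ^ m ∈ N := by
      have h1 : x ^ m = x * (x ^ t) ^ (m / t) := by
        rw [← pow_mul, ← pow_succ']
        congr 1
        have h3 : m % t = 1 := by
          have : m % t = 1 % t := hm2
          rwa [Nat.mod_eq_of_lt ht.one_lt] at this
        have := Nat.div_add_mod m t
        omega
      rw [h1, inv_mul_cancel_left]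
      exact pow_mem (hPt x hx) _
    obtain ⟨f, hf, hfx⟩ := hF' ⁅d, x ^ m⁆ (hB.le (commutatorElement_mem_right hBn d (hP hxm))) (by
      refine (mem_actCom hTc (hTn d)).2 ⟨π (x ^ m), ⟨⟨_, hP hxm, rfl⟩, ?_⟩, ?_⟩
      · obtain ⟨m', rfl⟩ : r ^ v ∣ m := (Nat.modEq_zero_iff_dvd).1 hm1
        have hx1 : π x ^ Nat.card (B.map π) = 1 := by
          exact congrArg Subtype.val (pow_card_eq_one' (x := (⟨π x, x, hP hx, rfl⟩ : B.map π)))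
        rw [map_pow, ← pow_mul, show r ^ v * m' * s = r ^ v * s * m' by ring, ← hcard, pow_mul,
          hx1, one_pow]
      · rw [commutatorElement_def]; simp [hπ])
    refine ⟨f, hf, ?_⟩
    have h2 := hN hfx
    have h3 : ⁅d, x ^ m⁆ = ⁅d, x⁆ * (x * (d * (x⁻¹ * x ^ m) * d⁻¹ * (x⁻¹ * x ^ m)⁻¹) * x⁻¹) := by
      rw [commutatorElement_def, commutatorElement_def]; group
    have h4 : x * (d * (x⁻¹ * x ^ m) * d⁻¹ * (x⁻¹ * x ^ m)⁻¹) * x⁻¹ ∈ N :=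
      hNn.conj_mem _ (N.mul_mem (hNn.conj_mem _ hxN d) (N.inv_mem hxN)) x
    rw [h3, ← mul_assoc] at h2
    exact (N.mul_mem_cancel_right h4).1 h2
  · rintro _ ⟨⟨b, hb, rfl⟩, -⟩ hab
    have hx : b⁻¹ * (a * b * a⁻¹) ∈ G ⊓ scal ρ := by
      refine ⟨G.mul_mem (G.inv_mem (hB.le hb)) (h.conj_mem (hB.le hb) a), mk_mem_scal ?_⟩
      rw [← map_mul, ← map_mul] at hab
      rw [map_mul, ← hπ, hab, ← map_mul]; simp
    obtain ⟨z, hz, hz2⟩ := exists_fixed_of_coset (H := G ⊓ scal ρ) h.prime h.pow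
      (fun y hy => (inferInstance : (G ⊓ scal ρ).Normal).conj_mem y hy a)
      (not_dvd_card_of_le h.cop inf_le_left) hx
    have h5 := hfixB (b * z) (B.mul_mem hb (hB.scal_le hz)) hz2
    have h6 : π (b * z) = π b := by
      have hz1 : π z = 1 := (QuotientGroup.eq_one_iff z).2 hz.2
      rw [map_mul, hz1, mul_one]
    rw [← h6, ← commutatorElement_eq_one_iff_mul_comm]
    exact (QuotientGroup.eq_one_iff _).2 h5

end ScalarQuotient

end FittingBound

namespace FittingBound

open Subgroup Module
open scoped commutatorElement Nat

section BoundedDegree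

variable {Γ k X : Type} [Group Γ] [Field k] [AddCommGroup X] [Module k X]

theorem L_fixes_of_card_le [Finite Γ] {Ω : Type} [Finite Ω] (f : Γ →* Equiv.Perm Ω)
    {M : Subgroup Γ} (hM : Sol M) {n : ℕ} (hn : Nat.card Ω ≤ n) {γ : Γ} (hγ : γ ∈ L M n !)
    (ω : Ω) : f γ ω = ω := by
  have : γ ∈ f.ker := L_le_ker_of_card_le f hM
    (by rw [Nat.card_perm]; exact Nat.factorial_le hn) hγ
  rw [MonoidHom.mem_ker.1 this, Equiv.Perm.one_apply]

theorem SOI.L_le_ker [Finite Γ] {ρ : Γ →* End k X} {ι : Type} [MulAction Γ ι]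
    {W : ι → Submodule k X} (h : SOI ρ W) {M : Subgroup Γ} {n : ℕ}
    (hM : ∀ i : ι, M ≤ MulAction.stabilizer Γ i)
    (hL : ∀ i, L (M.subgroupOf (MulAction.stabilizer Γ i)) n ≤ (h.sub i).ker) :
    L M n ≤ ρ.ker := by
  intro γ hγ
  refine h.mem_ker_of fun i x hx => ?_
  rw [← L_subgroupOf (hM i)] at hγ
  obtain ⟨s, hs, rfl⟩ := hγ
  have := LinearMap.congr_fun (MonoidHom.mem_ker.1 (hL i hs)) ⟨x, hx⟩
  exact congrArg Subtype.val this

theorem Sol.top_subgroup (h : Sol (⊤ : Subgroup Γ)) (S : Subgroup Γ) :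
    Sol (⊤ : Subgroup S) := by
  have := h.subgroupOf S
  rwa [top_subgroupOf] at this

theorem MaxAb.card_map_le [Finite Γ] [IsAlgClosed k] [FiniteDimensional k X] {ρ : Γ →* End k X}
    (hρ : Irr ρ) (hp : Prim ρ) {G B : Subgroup Γ} [G.Normal] (hG : Sol G) (hB : MaxAb ρ G B) :
    Nat.card (B.map (QuotientGroup.mk' (scal ρ))) ≤ finrank k X ^ 2 := by
  have := hρ.nontrivial
  rw [(scalRep_projRep ρ).finrank_sq hB.map_comm (hB.map_nonDeg hρ hp hG)]
  exact Nat.le_mul_of_pos_right _ ((scalRep_projRep ρ).finrank_weight_pos _)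

/-- A bound for the height of a soluble group of automorphisms of an `n`-dimensional space. -/
def bdBound : ℕ → ℕ
  | 0 => 0
  | n + 1 => (n + 1)! + bdBound n + (((n + 1) ^ 2)! + 1)

theorem L_le_ker_of_finrank_le (n : ℕ) : ∀ {Γ k X : Type} [Group Γ] [Finite Γ] [Field k]
    [IsAlgClosed k] [AddCommGroup X] [Module k X] [FiniteDimensional k X] {ρ : Γ →* End k X},
    Sol (⊤ : Subgroup Γ) → Irr ρ → finrank k X ≤ n → L (⊤ : Subgroup Γ) (bdBound n) ≤ ρ.ker := by
  induction n with
  | zero =>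
    intro Γ k X _ _ _ _ _ _ _ ρ _ hρ hn
    have := hρ.nontrivial
    have : 0 < finrank k X := finrank_pos
    omega
  | succ n ih =>
    intro Γ k X _ _ _ _ _ _ _ ρ hΓ hρ hn
    by_cases hp : Prim ρ
    · obtain ⟨B, hB⟩ := exists_maxAb ρ (⊤ : Subgroup Γ)
      have := hB.normal
      have hcard := (hB.card_map_le hρ hp hΓ).trans (Nat.pow_le_pow_left hn 2)
      set π := QuotientGroup.mk' (scal ρ) with hπ
      have hBn : (B.map π).Normal := hB.normal.map π (QuotientGroup.mk'_surjective _)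
      let f : Γ →* Equiv.Perm (B.map π) :=
        (MulAut.toPerm (B.map π)).comp ((MulAut.conjNormal (H := B.map π)).comp π)
      have hJ : res (L (⊤ : Subgroup Γ) ((n + 1) ^ 2)!) ≤ ρ.ker := by
        refine hB.res_le_ker hρ hp hΓ le_top fun N P _ hN hP => ?_
        rw [Subgroup.commutator_le]
        intro x hx y hy
        apply hN
        refine ⟨trivial, ?_⟩
        have h1 := congrArg Subtype.val
          (L_fixes_of_card_le f hΓ hcard hy ⟨π x, mem_map_of_mem π (hP hx)⟩)
        have h2 : π y * π x * (π y)⁻¹ = π x := h1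
        change ⁅x, y⁆ ∈ scal ρ
        rw [← QuotientGroup.ker_mk' (scal ρ), MonoidHom.mem_ker, map_commutatorElement,
          commutatorElement_eq_one_iff_mul_comm]
        exact (mul_inv_eq_iff_eq_mul.1 h2).symm
      refine L_le_trans (i := ((n + 1) ^ 2)! + 1) ?_ hJ
      rw [bdBound]; omega
    · unfold Prim at hp
      push Not at hp
      obtain ⟨ι, _, W, h⟩ := hp
      have := h.finite
      refine L_le_trans (i := (n + 1)! + bdBound n) (by rw [bdBound]; omega) ?_
      rw [L_add]
      refine h.L_le_ker (fun i γ hγ => ?_) fun i => ?_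
      · exact L_fixes_of_card_le (MulAction.toPermHom Γ ι) hΓ (h.card_le.trans hn) hγ i
      · refine (L_mono le_top _).trans (ih (hΓ.top_subgroup _) (h.sub_irr hρ i) ?_)
        have := h.finrank_lt i
        omega

end BoundedDegree

end FittingBound

namespace FittingBound

open Subgroup Module
open scoped commutatorElement Nat

section Orbits

variable {Γ Ω : Type} [Group Γ] [MulAction Γ Ω]

/-- Being in the same orbit of the subgroup `N`. -/
def OrbRel (N : Subgroup Γ) (x y : Ω) : Prop := ∃ n ∈ N, n • x = y

theorem OrbRel.refl (N : Subgroup Γ) (x : Ω) : OrbRel N x x := ⟨1, N.one_mem, one_smul _ _⟩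

theorem OrbRel.symm {N : Subgroup Γ} {x y : Ω} (h : OrbRel N x y) : OrbRel N y x := by
  obtain ⟨n, hn, rfl⟩ := h
  exact ⟨n⁻¹, N.inv_mem hn, inv_smul_smul _ _⟩

theorem OrbRel.trans {N : Subgroup Γ} {x y z : Ω} (h : OrbRel N x y) (h' : OrbRel N y z) :
    OrbRel N x z := by
  obtain ⟨n, hn, rfl⟩ := h
  obtain ⟨m, hm, rfl⟩ := h'
  exact ⟨m * n, N.mul_mem hm hn, mul_smul _ _ _⟩

theorem OrbRel.smul {N : Subgroup Γ} [hN : N.Normal] {x y : Ω} (h : OrbRel N x y) (γ : Γ) :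
    OrbRel N (γ • x) (γ • y) := by
  obtain ⟨n, hn, rfl⟩ := h
  exact ⟨γ * n * γ⁻¹, hN.conj_mem n hn γ, by simp [mul_smul]⟩

theorem OrbRel.of_smul {N : Subgroup Γ} [N.Normal] {x y : Ω} {γ : Γ}
    (h : OrbRel N (γ • x) (γ • y)) : OrbRel N x y := by
  simpa using h.smul γ⁻¹

theorem OrbRel.swap {N N₁ : Subgroup Γ} (h : ⁅N₁, N₁⁆ ≤ N) {u v : Γ} (hu : u ∈ N₁)
    (hv : v ∈ N₁) (x : Ω) : OrbRel N ((v * u) • x) ((u * v) • x) := by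
  refine ⟨⁅u, v⁆, h (commutator_mem_commutator hu hv), ?_⟩
  rw [smul_smul]
  congr 1
  rw [commutatorElement_def]; group

/-- A subgroup preserving a small set acts on it with bounded height. -/
theorem L_fixes_of_ncard_le [Finite Γ] [Finite Ω] {M : Subgroup Γ} (hM : Sol M) {β : Set Ω}
    (hβ : ∀ m ∈ M, ∀ x ∈ β, m • x ∈ β) {n : ℕ} (hn : β.ncard ≤ n) {γ : Γ} (hγ : γ ∈ L M n !)
    {x : Ω} (hx : x ∈ β) : γ • x = x := by
  let S : SubMulAction M Ω := ⟨β, fun m x hx => hβ m m.2 x hx⟩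
  rw [← L_subgroupOf (le_refl M)] at hγ
  obtain ⟨s, hs, rfl⟩ := hγ
  have := L_fixes_of_card_le (MulAction.toPermHom M S) (hM.subgroupOf M)
    (n := n) hn hs ⟨x, hx⟩
  exact congrArg Subtype.val this

theorem orbRel_of_few_moved [Finite Ω] {N N₁ : Subgroup Γ} [N.Normal] [hN₁ : N₁.Normal]
    (hc : ⁅N₁, N₁⁆ ≤ N) {g : Γ} {s : ℕ} (hg : {x : Ω | g • x ≠ x}.ncard ≤ s) {ω : Ω}
    (hω : 2 * s < {x | OrbRel N₁ ω x}.ncard) : OrbRel N ω (g • ω) := by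
  set β : Set Ω := {x | OrbRel N₁ ω x} with hβ
  by_contra hcon
  have hgω : OrbRel N₁ ω (g • ω) := by
    by_contra hcon'
    have : β ⊆ {x : Ω | g • x ≠ x} := by
      intro x hx he
      refine hcon' (hx.trans ?_)
      have := OrbRel.smul (hx : OrbRel N₁ ω x) g
      rw [he] at this
      exact this.symm
    have := Set.ncard_le_ncard this
    omega
  set T : Set Ω := {x | x ∈ β ∧ OrbRel N x (g • x)} with hT
  have hTβ : T ⊆ β := fun x hx => hx.1
  have hT2 : 2 * T.ncard ≤ β.ncard := by
    rcases T.eq_empty_or_nonempty with h0 | ⟨t, ⟨m, hm, rfl⟩, ht⟩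
    · rw [h0]; simp
    have hdis : Disjoint T ((fun x => m • x) '' T) := by
      rw [Set.disjoint_left]
      rintro _ ⟨-, h1⟩ ⟨x, ⟨⟨u, hu, rfl⟩, hx⟩, rfl⟩
      apply hcon
      have hm' : g * m * g⁻¹ ∈ N₁ := hN₁.conj_mem m hm g
      have e1 : OrbRel N ((m * u) • ω) ((g * m * g⁻¹ * u) • ω) := by
        have h2 : OrbRel N ((g * m * g⁻¹) • u • ω) ((g * m * g⁻¹) • g • u • ω) := hx.smul _
        have h3 : (g * m * g⁻¹) • g • u • ω = g • m • u • ω := by simp [mul_smul]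
        rw [h3] at h2
        rw [mul_smul, mul_smul (g * m * g⁻¹)]
        exact h1.trans h2.symm
      have e2 : OrbRel N ((u * m) • ω) ((u * (g * m * g⁻¹)) • ω) :=
        ((OrbRel.swap hc hm hu ω).trans e1).trans (OrbRel.swap hc hu hm' ω)
      rw [mul_smul, mul_smul u] at e2
      have e3 := e2.of_smul
      have h4 : g • m • ω = (g * m * g⁻¹) • g • ω := by simp [mul_smul]
      rw [h4] at ht
      exact (e3.symm.trans ht).of_smul
    have hsub : T ∪ (fun x => m • x) '' T ⊆ β := by
      refine Set.union_subset hTβ ?_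
      rintro _ ⟨x, hx, rfl⟩
      exact hx.1.trans ⟨m, hm, rfl⟩
    have h1 := Set.ncard_le_ncard hsub
    rw [Set.ncard_union_eq hdis, Set.ncard_image_of_injective _ (MulAction.injective m)] at h1
    omega
  have hmv : β \ T ⊆ {x : Ω | g • x ≠ x} := by
    rintro x ⟨hx, hxT⟩ he
    exact hxT ⟨hx, by rw [he]; exact OrbRel.refl N x⟩
  have h1 := Set.ncard_le_ncard hmv
  have h2 := Set.ncard_sdiff_add_ncard_of_subset hTβ
  omega

/-- A normal subgroup generated by elements moving few points acts with bounded height. -/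
theorem L_fixes_of_few_moved [Finite Γ] [Finite Ω] (hΓ : Sol (⊤ : Subgroup Γ))
    (htr : ∀ x y : Ω, ∃ γ : Γ, γ • x = y) {D : Set Γ} {s : ℕ}
    (hs : ∀ g ∈ D, {x : Ω | g • x ≠ x}.ncard ≤ s) {γ : Γ}
    (hγ : γ ∈ L (closure D) (2 * s + 1)!) (ω : Ω) : γ • ω = ω := by
  obtain ⟨N, ⟨hN, hN2⟩, hmax⟩ := WellFounded.has_min (wellFounded_gt (α := Subgroup Γ))
    {N | N.Normal ∧ ∀ ω : Ω, {x | OrbRel N ω x}.ncard ≤ 2 * s + 1}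
    ⟨⊥, inferInstance, fun ω => by
      have : {x | OrbRel (⊥ : Subgroup Γ) ω x} ⊆ {ω} := by
        rintro x ⟨n, hn, rfl⟩
        rw [mem_bot.1 hn, one_smul]; rfl
      have := Set.ncard_le_ncard this
      rw [Set.ncard_singleton] at this
      omega⟩
  have key : ∀ g ∈ D, ∀ ω : Ω, OrbRel N ω (g • ω) := by
    intro g hg ω
    by_cases hNt : (⊤ : Subgroup Γ) ≤ N
    · exact ⟨g, hNt trivial, rfl⟩
    obtain ⟨i, hi1, hi2⟩ := hΓ.exists_der hNt
    have hle : N < N ⊔ der ⊤ i := lt_of_le_of_ne le_sup_left fun h => hi1 (h ▸ le_sup_right)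
    have hc : ⁅N ⊔ der (⊤ : Subgroup Γ) i, N ⊔ der ⊤ i⁆ ≤ N :=
      sup_commutator_le (commutator_le_left N _)
        (commutator_sup_le (commutator_le_right _ N) hi2)
    have hbig : ∃ ω₀ : Ω, 2 * s + 1 < {x | OrbRel (N ⊔ der (⊤ : Subgroup Γ) i) ω₀ x}.ncard := by
      by_contra hcon
      push Not at hcon
      exact hmax _ ⟨inferInstance, hcon⟩ hle
    obtain ⟨ω₀, hω₀⟩ := hbig
    obtain ⟨δ, rfl⟩ := htr ω₀ ω
    refine orbRel_of_few_moved hc (hs g hg) (((Nat.lt_succ_self _).trans hω₀).trans_le ?_)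
    rw [← Set.ncard_image_of_injective _ (MulAction.injective δ)]
    refine Set.ncard_le_ncard ?_
    rintro _ ⟨x, hx, rfl⟩
    exact OrbRel.smul hx δ
  have key2 : ∀ g ∈ closure D, ∀ ω : Ω, OrbRel N ω (g • ω) := by
    intro g hg
    induction hg using closure_induction with
    | mem g hg => exact key g hg
    | one => intro ω; rw [one_smul]; exact OrbRel.refl N ω
    | mul x y _ _ hx hy =>
      intro ω
      rw [mul_smul]
      exact (hy ω).trans (hx _)
    | inv x _ hx =>
      intro ω
      have := hx (x⁻¹ • ω)
      rw [smul_inv_smul] at this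
      exact this.symm
  exact L_fixes_of_ncard_le (hΓ.mono le_top) (β := {x | OrbRel N ω x})
    (fun m hm x hx => hx.trans (key2 m hm x)) (hN2 ω) hγ (OrbRel.refl N ω)

end Orbits

end FittingBound

namespace FittingBound

open Subgroup Module
open scoped commutatorElement Nat

section SmallCommutators

variable {Γ k X : Type} [Group Γ] [Field k] [AddCommGroup X] [Module k X]

/-- The dimension of `[X, γ]`. -/
noncomputable def defect (ρ : Γ →* End k X) (γ : Γ) : ℕ := finrank k (LinearMap.range (ρ γ - 1))

theorem defect_mul_le [FiniteDimensional k X] (ρ : Γ →* End k X) (x y : Γ) :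
    defect ρ (x * y) ≤ defect ρ x + defect ρ y := by
  have h : LinearMap.range (ρ (x * y) - 1) ≤
      LinearMap.range (ρ x - 1) ⊔ LinearMap.range (ρ y - 1) := by
    rintro _ ⟨v, rfl⟩
    have e : (ρ (x * y) - 1) v = (ρ x - 1) (ρ y v) + (ρ y - 1) v := by
      simp
    rw [e]
    exact add_mem (Submodule.mem_sup_left ⟨_, rfl⟩) (Submodule.mem_sup_right ⟨_, rfl⟩)
  exact (Submodule.finrank_mono h).trans (Submodule.finrank_add_le_finrank_add_finrank _ _)

theorem defect_inv_le [FiniteDimensional k X] (ρ : Γ →* End k X) (x : Γ) :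
    defect ρ x⁻¹ ≤ defect ρ x := by
  refine Submodule.finrank_mono ?_
  rintro _ ⟨v, rfl⟩
  refine ⟨- ρ x⁻¹ v, ?_⟩
  simp [add_comm, sub_eq_add_neg]

theorem finrank_ker_add_defect [FiniteDimensional k X] (ρ : Γ →* End k X) (x : Γ) :
    defect ρ x + finrank k (LinearMap.ker (ρ x - 1)) = finrank k X :=
  LinearMap.finrank_range_add_finrank_ker _

theorem defect_sub_le [FiniteDimensional k X] {ρ : Γ →* End k X} {ι : Type} [MulAction Γ ι]
    {W : ι → Submodule k X} (h : SOI ρ W) (i : ι) (s : MulAction.stabilizer Γ i) :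
    defect (h.sub i) s ≤ defect ρ s := by
  have : (LinearMap.range (h.sub i s - 1)).map (W i).subtype ≤ LinearMap.range (ρ s - 1) := by
    rintro _ ⟨_, ⟨x, rfl⟩, rfl⟩
    exact ⟨x, rfl⟩
  have h2 := Submodule.finrank_mono this
  rwa [← (Submodule.equivMapOfInjective _ (W i).subtype_injective _).finrank_eq] at h2

theorem SOI.finrank_le_defect [FiniteDimensional k X] {ρ : Γ →* End k X} {ι : Type} [MulAction Γ ι]
    {W : ι → Submodule k X} (h : SOI ρ W) {i : ι} {g : Γ} (hg : g • i ≠ i) :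
    finrank k (W i) ≤ defect ρ g := by
  let f : W i →ₗ[k] LinearMap.range (ρ g - 1) := (ρ g - 1).rangeRestrict ∘ₗ (W i).subtype
  refine LinearMap.finrank_le_finrank_of_injective (f := f) ?_
  rw [← LinearMap.ker_eq_bot, eq_bot_iff]
  intro x hx
  have h1 : ρ g x - x = 0 := congrArg Subtype.val (LinearMap.mem_ker.1 hx)
  have h2 := congrArg (h.proj i) h1
  rw [map_sub, map_zero, h.proj_self x.2, h.proj_ne hg (h.smul g i x x.2), zero_sub,
    neg_eq_zero] at h2
  exact Subtype.ext h2

theorem SOI.card_le_defect [FiniteDimensional k X] {ρ : Γ →* End k X} {ι : Type} [MulAction Γ ι]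
    {W : ι → Submodule k X} (h : SOI ρ W) {g : Γ} {R : Finset ι} (hR : ∀ i ∈ R, g • i ∉ R) :
    R.card ≤ defect ρ g := by
  choose w hw hw0 using fun i => Submodule.exists_mem_ne_zero_of_ne_bot (h.ne_bot i)
  let v : R → LinearMap.range (ρ g - 1) := fun i => ⟨(ρ g - 1) (w i), ⟨_, rfl⟩⟩
  have hv : LinearIndependent k v := by
    rw [Fintype.linearIndependent_iff]
    intro c hc i
    have h1 := congrArg (h.proj i) (congrArg Subtype.val hc)
    simp only [AddSubmonoidClass.coe_finsetSum, map_sum, v, Submodule.coe_smul, map_smul,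
      ZeroMemClass.coe_zero, map_zero] at h1
    rw [Finset.sum_eq_single i] at h1
    · rw [LinearMap.sub_apply, map_sub, Module.End.one_apply, h.proj_self (hw i), h.proj_ne
        (fun he => hR i i.2 (by rw [he]; exact i.2)) (h.smul g i _ (hw i)), zero_sub, smul_neg,
        neg_eq_zero] at h1
      exact (smul_eq_zero.1 h1).resolve_right (hw0 i)
    · intro j _ hj
      rw [LinearMap.sub_apply, map_sub, Module.End.one_apply,
        h.proj_ne (fun he => hj (Subtype.ext he)) (hw j),
        h.proj_ne (fun he => hR j j.2 (by rw [he]; exact i.2)) (h.smul g j _ (hw j)), sub_zero,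
        smul_zero]
    · simp
  have := hv.fintype_card_le_finrank
  rwa [Fintype.card_coe] at this

theorem SOI.ncard_moved_le [FiniteDimensional k X] {ρ : Γ →* End k X} {ι : Type} [MulAction Γ ι]
    {W : ι → Submodule k X} (h : SOI ρ W) (g : Γ) :
    {i : ι | g • i ≠ i}.ncard ≤ 3 * defect ρ g := by
  classical
  have := h.finite
  have := Fintype.ofFinite ι
  obtain ⟨R, hR, hmax⟩ := WellFounded.has_min (wellFounded_gt (α := Finset ι))
    {R | ∀ i ∈ R, g • i ∉ R} ⟨∅, by simp⟩
  have hsub : {i : ι | g • i ≠ i} ⊆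
      ((R ∪ (R.image (g • ·)) ∪ R.image (g⁻¹ • ·) : Finset ι) : Set ι) := by
    intro x hx
    by_contra hcon
    simp only [Finset.coe_union, Set.mem_union, Finset.mem_coe, Finset.mem_image, not_or,
      not_exists, not_and] at hcon
    obtain ⟨⟨h1, h2⟩, h3⟩ := hcon
    refine hmax (insert x R) ?_ (Finset.ssubset_insert h1)
    intro i hi hgi
    rw [Finset.mem_insert] at hi hgi
    rcases hi with rfl | hi <;> rcases hgi with hgi | hgi
    · exact hx hgi
    · exact h3 _ hgi (inv_smul_smul _ _)
    · exact h2 _ hi hgi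
    · exact hR i hi hgi
  refine (Set.ncard_le_ncard hsub).trans ?_
  rw [Set.ncard_coe_finset]
  have h1 := Finset.card_union_le (R ∪ (R.image (g • ·))) (R.image (g⁻¹ • ·))
  have h2 := Finset.card_union_le R (R.image (g • ·))
  have h3 := Finset.card_image_le (s := R) (f := (g • ·))
  have h4 := Finset.card_image_le (s := R) (f := (g⁻¹ • ·))
  have h5 := h.card_le_defect hR
  omega

theorem MaxAb.mem_scal_of_defect [Finite Γ] [IsAlgClosed k] [FiniteDimensional k X]
    {ρ : Γ →* End k X} (hρ : Irr ρ) (hp : Prim ρ) {G B : Subgroup Γ} [G.Normal] (hG : Sol G)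
    (hB : MaxAb ρ G B) {d : Γ} (hd : d ∈ G) {δ : ℕ}
    (hδ : ∀ b ∈ B, defect ρ (b * d * b⁻¹) ≤ δ) (hn : 4 * δ < finrank k X) : d ∈ scal ρ := by
  have hBn := hB.normal
  refine hB.mem_scal_of_commute hρ hp hG hd fun b hb => commute_iff_mem_ker.2 ?_
  set y := ⁅d, b⁆ with hy
  have hyB : y ∈ B := commutatorElement_mem_right hBn d hb
  have hyd : defect ρ y ≤ 2 * δ := by
    have e : y = d * (b * d * b⁻¹)⁻¹ := by rw [hy, commutatorElement_def]; group
    rw [e]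
    have h1 := hδ 1 B.one_mem
    have h2 := hδ b hb
    have h3 := defect_inv_le ρ (b * d * b⁻¹)
    have h4 := defect_mul_le ρ d (b * d * b⁻¹)⁻¹
    simp only [one_mul, inv_one, mul_one] at h1
    omega
  have hker := finrank_ker_add_defect ρ y
  by_cases hys : y ∈ scal ρ
  · obtain ⟨c, hc⟩ := hys
    by_cases hc1 : c = 1
    · rw [MonoidHom.mem_ker, hc, hc1, one_smul]
    · have : LinearMap.ker (ρ y - 1) = ⊥ := by
        rw [eq_bot_iff]
        intro v hv
        have h1 : c • v - v = 0 := by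
          have := LinearMap.mem_ker.1 hv
          rwa [hc] at this
        rw [← one_smul k v, smul_smul, mul_one, ← sub_smul, smul_eq_zero] at h1
        exact h1.resolve_left (sub_ne_zero.2 hc1)
      rw [this, finrank_bot] at hker
      omega
  · exfalso
    have : ∃ b' ∈ B, ¬ Commute (ρ y) (ρ b') := by
      by_contra hcon
      push Not at hcon
      exact hys (hB.mem_scal_of_commute hρ hp hG (hB.le hyB) hcon)
    obtain ⟨b', hb', hnc⟩ := this
    obtain ⟨c, hc⟩ := hB.comm (commutator_mem_commutator hyB hb')
    have hc1 : c ≠ 1 := by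
      rintro rfl
      rw [one_smul] at hc
      exact hnc (commute_iff_mem_ker.2 hc)
    have hrel : ∀ v, ρ y (ρ b' v) = c • ρ b' (ρ y v) := by
      intro v
      have e : y * b' = ⁅y, b'⁆ * (b' * y) := by rw [commutatorElement_def]; group
      rw [← rho_mul_apply, e, rho_mul_apply, hc, rho_mul_apply]; rfl
    set K := LinearMap.ker (ρ y - 1) with hK
    have hKm : ∀ {v}, v ∈ K ↔ ρ y v = v := by
      intro v
      rw [hK, LinearMap.mem_ker, LinearMap.sub_apply, sub_eq_zero]; rfl
    have hdis : Disjoint K (K.map (ρ b')) := by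
      rw [Submodule.disjoint_def]
      rintro _ hx ⟨v, hv, rfl⟩
      have h1 := hrel v
      rw [hKm.1 hx, hKm.1 hv] at h1
      have h2 : (c - 1) • ρ b' v = 0 := by rw [sub_smul, one_smul, ← h1, sub_self]
      exact (smul_eq_zero.1 h2).resolve_left (sub_ne_zero.2 hc1)
    have h1 := Submodule.finrank_add_finrank_le_of_disjoint hdis
    rw [← (Submodule.equivMapOfInjective _ (rho_injective ρ b') K).finrank_eq] at h1
    omega

/-- A bound for the height of a normal subgroup generated by elements of small defect. -/
def scBound (δ : ℕ) : ℕ := (2 * (3 * δ) + 1)! + bdBound δ + (bdBound (4 * δ) + 1)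

theorem L_le_ker_of_defect_le (δ n : ℕ) : ∀ {Γ k X : Type} [Group Γ] [Finite Γ] [Field k]
    [IsAlgClosed k] [AddCommGroup X] [Module k X] [FiniteDimensional k X] {ρ : Γ →* End k X}
    {D : Set Γ}, Sol (⊤ : Subgroup Γ) → Irr ρ → (∀ γ, ∀ g ∈ D, γ * g * γ⁻¹ ∈ D) →
    (∀ g ∈ D, defect ρ g ≤ δ) → finrank k X ≤ n → L (closure D) (scBound δ) ≤ ρ.ker := by
  induction n with
  | zero =>
    intro Γ k X _ _ _ _ _ _ _ ρ D _ hρ _ _ hn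
    have := hρ.nontrivial
    have : 0 < finrank k X := finrank_pos
    omega
  | succ n ih =>
    intro Γ k X _ _ _ _ _ _ _ ρ D hΓ hρ hD hδ hn
    by_cases hp : Prim ρ
    · by_cases hdim : finrank k X ≤ 4 * δ
      · exact L_le_trans (by unfold scBound; omega)
          ((L_mono le_top _).trans (L_le_ker_of_finrank_le (4 * δ) hΓ hρ hdim))
      · obtain ⟨B, hB⟩ := exists_maxAb ρ (⊤ : Subgroup Γ)
        have hM : closure D ≤ scal ρ := by
          rw [closure_le]
          exact fun d hd => hB.mem_scal_of_defect hρ hp hΓ trivial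
            (fun b _ => hδ _ (hD b d hd)) (by omega)
        refine L_le_trans (i := 1) (by unfold scBound; omega) ?_
        exact (res_le_commutator _).trans
          ((commutator_mono hM le_top).trans (commutator_scal_le ρ))
    · unfold Prim at hp
      push Not at hp
      obtain ⟨ι, _, W, h⟩ := hp
      have := h.finite
      by_cases hfix : ∀ g ∈ D, ∀ i : ι, g • i = i
      · have hst : ∀ i : ι, closure D ≤ MulAction.stabilizer Γ i := fun i => by
          rw [closure_le]
          exact fun g hg => hfix g hg i
        refine h.L_le_ker hst fun i => ?_
        have hcl : (closure D).subgroupOf (MulAction.stabilizer Γ i) ≤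
            closure ((MulAction.stabilizer Γ i).subtype ⁻¹' D) := by
          rw [← map_subtype_le_map_subtype, subgroupOf_map_subtype, MonoidHom.map_closure]
          refine inf_le_left.trans (closure_mono fun g hg => ?_)
          exact ⟨⟨g, hst i (Subgroup.subset_closure hg)⟩, hg, rfl⟩
        refine (L_mono hcl _).trans (ih (hΓ.top_subgroup _) (h.sub_irr hρ i) ?_ ?_ ?_)
        · exact fun γ g hg => hD γ g hg
        · exact fun g hg => (defect_sub_le h i g).trans (hδ g hg)
        · have := h.finrank_lt i
          omega
      · push Not at hfix
        obtain ⟨d, hd, i₀, hi₀⟩ := hfix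
        have hdim : ∀ i, finrank k (W i) ≤ δ := by
          intro i
          obtain ⟨γ, rfl⟩ := h.trans i₀ i
          refine (h.finrank_le_defect (g := γ * d * γ⁻¹) ?_).trans (hδ _ (hD γ d hd))
          rw [mul_smul, mul_smul, inv_smul_smul]
          exact fun he => hi₀ (MulAction.injective γ he)
        refine L_le_trans (i := (2 * (3 * δ) + 1)! + bdBound δ) (by unfold scBound; omega) ?_
        rw [L_add]
        refine h.L_le_ker (fun i γ hγ => ?_) fun i => ?_
        · exact L_fixes_of_few_moved hΓ h.trans (fun g hg => (h.ncard_moved_le g).trans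
            (Nat.mul_le_mul_left 3 (hδ g hg))) hγ i
        · exact (L_mono le_top _).trans
            (L_le_ker_of_finrank_le δ (hΓ.top_subgroup _) (h.sub_irr hρ i) (hdim i))

end SmallCommutators

end FittingBound

namespace FittingBound

open Subgroup Module
open scoped commutatorElement Nat

section FixedPointFree

variable {Γ k X : Type} [Group Γ] [Field k] [AddCommGroup X] [Module k X]

theorem der_der (M : Subgroup Γ) (m n : ℕ) : der (der M m) n = der M (m + n) := by
  induction n with
  | zero => rfl
  | succ n ih => rw [der_succ, ih, ← add_assoc, der_succ]

theorem Setup.sol_top {G : Subgroup Γ} {a : Γ} {q : ℕ} (h : Setup G a q) :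
    Sol (⊤ : Subgroup Γ) := by
  have := h.normal
  have h1 : ⁅(⊤ : Subgroup Γ), (⊤ : Subgroup Γ)⁆ ≤ G := by
    rw [← h.sup]
    refine sup_commutator_le (commutator_le_left G _)
      (commutator_sup_le (commutator_le_right _ G) ?_)
    rw [Subgroup.commutator_le]
    rintro _ ⟨i, rfl⟩ _ ⟨j, rfl⟩
    have : ⁅a ^ i, a ^ j⁆ = 1 := by
      rw [commutatorElement_eq_one_iff_mul_comm, ← zpow_add, ← zpow_add, add_comm]
    simp only [this]
    exact G.one_mem
  obtain ⟨n, hn⟩ := h.sol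
  exact ⟨1 + n, le_bot_iff.1 (by rw [← der_der, ← hn]; exact der_mono h1 n)⟩

theorem defect_conj_le [FiniteDimensional k X] (ρ : Γ →* End k X) (γ g : Γ) :
    defect ρ (γ * g * γ⁻¹) ≤ defect ρ g := by
  have : LinearMap.range (ρ (γ * g * γ⁻¹) - 1) ≤ (LinearMap.range (ρ g - 1)).map (ρ γ) := by
    rintro _ ⟨v, rfl⟩
    exact ⟨_, ⟨ρ γ⁻¹ v, rfl⟩, by simp⟩
  exact (Submodule.finrank_mono this).trans (Submodule.finrank_map_le _ _)

/-- The sum of the images of a vector under the powers of `a`. -/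
noncomputable def orbSum (ρ : Γ →* End k X) (a : Γ) (q : ℕ) (x : X) : X :=
  ∑ s ∈ Finset.range q, ρ (a ^ s) x

theorem rho_orbSum (ρ : Γ →* End k X) {a : Γ} {q : ℕ} (ha : a ^ q = 1) (x : X) :
    ρ a (orbSum ρ a q x) = orbSum ρ a q x := by
  have h1 := Finset.sum_range_succ (fun s => ρ (a ^ s) x) q
  have h2 := Finset.sum_range_succ' (fun s => ρ (a ^ s) x) q
  rw [h1, ha, pow_zero, add_left_inj] at h2
  unfold orbSum
  rw [map_sum, h2]
  refine Finset.sum_congr rfl fun s _ => ?_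
  rw [← rho_mul_apply, ← pow_succ']

theorem pow_smul_ne {ι : Type} [MulAction Γ ι] {a : Γ} {q : ℕ} (hq : q.Prime) (ha : a ^ q = 1)
    {i : ι} (hi : a • i ≠ i) {s t : ℕ} (hs : s < q) (ht : t < q) (hst : s ≠ t) :
    a ^ s • i ≠ a ^ t • i := by
  have key : ∀ s, 0 < s → s < q → a ^ s • i ≠ i := by
    intro s hs0 hsq he
    apply hi
    have hc : s.Coprime q := (Nat.coprime_of_lt_prime hs0.ne' hsq hq).symm
    have h1 : a ^ s ∈ MulAction.stabilizer Γ i := he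
    have h2 : a ^ q ∈ MulAction.stabilizer Γ i := by rw [ha]; exact one_mem _
    have h3 : a ^ ((s.gcd q : ℕ) : ℤ) ∈ MulAction.stabilizer Γ i := by
      rw [Nat.gcd_eq_gcd_ab, zpow_add, zpow_mul, zpow_mul, zpow_natCast, zpow_natCast]
      exact mul_mem (zpow_mem h1 _) (zpow_mem h2 _)
    rw [hc.gcd_eq_one, Nat.cast_one, zpow_one] at h3
    exact h3
  wlog h : s < t generalizing s t
  · exact (this ht hs hst.symm (by omega)).symm
  intro he
  refine key (t - s) (by omega) (by omega) ?_
  apply MulAction.injective (a ^ s)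
  change a ^ s • a ^ (t - s) • i = a ^ s • i
  rw [smul_smul, ← pow_add, Nat.add_sub_cancel' h.le, he]

theorem SOI.proj_orbSum {ρ : Γ →* End k X} {ι : Type} [MulAction Γ ι] {W : ι → Submodule k X}
    (h : SOI ρ W) {a : Γ} {q : ℕ} (hq : q.Prime) (ha : a ^ q = 1) {i : ι} (hi : a • i ≠ i) {x : X}
    (hx : x ∈ W i) {s : ℕ} (hs : s < q) : h.proj (a ^ s • i) (orbSum ρ a q x) = ρ (a ^ s) x := by
  rw [orbSum, map_sum, Finset.sum_eq_single s]
  · rw [h.proj_self (h.smul _ i x hx)]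
  · intro t ht hts
    exact h.proj_ne (pow_smul_ne hq ha hi (Finset.mem_range.1 ht) hs hts) (h.smul _ i x hx)
  · intro hs'
    exact absurd (Finset.mem_range.2 hs) hs'

theorem SOI.proj_orbSum_self {ρ : Γ →* End k X} {ι : Type} [MulAction Γ ι]
    {W : ι → Submodule k X} (h : SOI ρ W) {a : Γ} {q : ℕ} (hq : q.Prime) (ha : a ^ q = 1) {i : ι}
    (hi : a • i ≠ i) {x : X} (hx : x ∈ W i) : h.proj i (orbSum ρ a q x) = x := by
  have := h.proj_orbSum hq ha hi hx hq.pos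
  rwa [pow_zero, one_smul, map_one, Module.End.one_apply] at this

theorem Setup.comm_subgroupOf_le [Finite Γ] {G : Subgroup Γ} {a : Γ} {q : ℕ} (h : Setup G a q)
    {S : Subgroup Γ} (ha : a ∈ S) (hS : ⁅G, zpowers a⁆ ≤ S) :
    ⁅G, zpowers a⁆.subgroupOf S ≤ ⁅G.subgroupOf S, zpowers (⟨a, ha⟩ : S)⁆ := by
  have := h.normal
  rw [← map_subtype_le_map_subtype, subgroupOf_map_subtype, map_commutator,
    subgroupOf_map_subtype, MonoidHom.map_zpowers]
  refine inf_le_left.trans ?_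
  rw [← h.comm_comm]
  exact commutator_mono (le_inf (commutator_zpowers_le a) hS) le_rfl

theorem IsChief.commutator_L_le_of_defect [Finite Γ] {N P : Subgroup Γ} (h : IsChief N P)
    (hΓ : Sol (⊤ : Subgroup Γ)) {D : Set Γ} (hD : ∀ γ, ∀ g ∈ D, γ * g * γ⁻¹ ∈ D) {δ : ℕ}
    (hF : ∀ g ∈ D, ∃ F : Finset Γ, ∃ γ : Γ, F.card ≤ δ ∧
      ∀ x ∈ P, ∃ f ∈ F, f⁻¹ * ⁅γ * g * γ⁻¹, x⁆ ∈ N) :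
    ⁅P, L (closure D) (scBound δ)⁆ ≤ N := by
  obtain ⟨t, ht, -, -, k, _, _, _, X, _, _, _, ρ, j, hρ⟩ :=
    h.exists_chiefRep (h.comm_le (hΓ.mono le_top))
  refine hρ.commutator_le h.normal_right
    (L_le_ker_of_defect_le δ _ hΓ hρ.irr hD (fun g hg => ?_) le_rfl)
  obtain ⟨F, γ, hFc, hF⟩ := hF g hg
  have e : g = γ⁻¹ * (γ * g * γ⁻¹) * γ⁻¹⁻¹ := by group
  rw [e]
  exact (defect_conj_le ρ _ _).trans
    ((hρ.finrank_range_le h.normal_right h.lt.le hF).trans hFc)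

theorem Setup.comm_le_closure {G : Subgroup Γ} {a : Γ} :
    ⁅G, zpowers a⁆ ≤ closure {x | ∃ γ : Γ, x = γ * a * γ⁻¹} := by
  rw [Subgroup.commutator_le]
  rintro g _ _ ⟨i, rfl⟩
  have h1 : ∀ γ : Γ, γ * a * γ⁻¹ ∈ closure {x | ∃ γ : Γ, x = γ * a * γ⁻¹} := fun γ =>
    Subgroup.subset_closure ⟨γ, rfl⟩
  have h2 := h1 1
  rw [one_mul, inv_one, mul_one] at h2
  change g * a ^ i * g⁻¹ * (a ^ i)⁻¹ ∈ _
  rw [← conj_zpow]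
  exact mul_mem (zpow_mem (h1 g) i) (inv_mem (zpow_mem h2 i))

/-- The height bound for a fixed-point-free action of an automorphism of prime order. -/
def fpfBound (q : ℕ) : ℕ := scBound (q ^ 2) + 1

theorem L_comm_le_ker (q n : ℕ) : ∀ {Γ k X : Type} [Group Γ] [Finite Γ] [Field k]
    [IsAlgClosed k] [AddCommGroup X] [Module k X] [FiniteDimensional k X] {ρ : Γ →* End k X}
    {G : Subgroup Γ} {a : Γ}, Setup G a q → Irr ρ → (q : k) ≠ 0 → (∀ x, ρ a x = x → x = 0) →
    finrank k X ≤ n → L ⁅G, zpowers a⁆ (fpfBound q) ≤ ρ.ker := by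
  induction n with
  | zero =>
    intro Γ k X _ _ _ _ _ _ _ ρ G a _ hρ _ _ hn
    have := hρ.nontrivial
    have : 0 < finrank k X := finrank_pos
    omega
  | succ n ih =>
    intro Γ k X _ _ _ _ _ _ _ ρ G a h hρ hqk hfix hn
    have hG := h.normal
    have hGA := h.comm_normal
    by_cases hp : Prim ρ
    · obtain ⟨B, hB⟩ := exists_maxAb ρ G
      obtain ⟨F, hFc, hF⟩ := hB.exists_finset_of_free hρ hp h hqk hfix
      refine hB.res_le_ker hρ hp h.sol ((L_le _ _).trans (commutator_zpowers_le a))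
        fun N P hNP hN hP => ?_
      refine (commutator_mono le_rfl (L_mono Setup.comm_le_closure _)).trans
        (hNP.commutator_L_le_of_defect h.sol_top ?_ ?_)
      · rintro γ _ ⟨δ, rfl⟩
        exact ⟨γ * δ, by group⟩
      · rintro _ ⟨γ, rfl⟩
        refine ⟨F, γ⁻¹, hFc, fun x hx => ?_⟩
        obtain ⟨f, hf, hfx⟩ := hF x (hP hx)
        have e : γ⁻¹ * (γ * a * γ⁻¹) * γ⁻¹⁻¹ = a := by group
        rw [e]
        exact ⟨f, hf, hN hfx⟩
    · unfold Prim at hp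
      push Not at hp
      obtain ⟨ι, _, W, hW⟩ := hp
      have hai : ∀ i : ι, a • i = i := by
        intro i
        by_contra hi
        obtain ⟨x, hx, hx0⟩ := Submodule.exists_mem_ne_zero_of_ne_bot (hW.ne_bot i)
        apply hx0
        rw [← hW.proj_orbSum_self h.prime h.pow hi hx, hfix _ (rho_orbSum ρ h.pow x), map_zero]
      have hst : ∀ i : ι, ⁅G, zpowers a⁆ ≤ MulAction.stabilizer Γ i := by
        intro i
        have hA : ∀ j : ι, zpowers a ≤ MulAction.stabilizer Γ j := fun j => by
          rw [zpowers_le]; exact hai j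
        rw [Subgroup.commutator_le]
        intro g _ y hy
        rw [MulAction.mem_stabilizer_iff, commutatorElement_def, mul_smul, mul_smul, mul_smul,
          MulAction.mem_stabilizer_iff.1 (inv_mem (hA i hy)),
          MulAction.mem_stabilizer_iff.1 (hA (g⁻¹ • i) hy), smul_inv_smul]
      refine hW.L_le_ker hst fun i => ?_
      refine (L_mono (h.comm_subgroupOf_le (hai i) (hst i)) _).trans
        (ih (h.restrict (hai i)) (hW.sub_irr hρ i) hqk (fun x hx => ?_) ?_)
      · exact Subtype.ext (hfix x (congrArg Subtype.val hx))
      · have := hW.finrank_lt i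
        omega

end FixedPointFree

end FittingBound

namespace FittingBound

open Subgroup Module
open scoped commutatorElement Nat

section Nilpotent

variable {Γ : Type} [Group Γ]

theorem mem_of_pow_mem_coprime {H : Subgroup Γ} {x : Γ} {m n : ℕ} (hm : x ^ m ∈ H)
    (hn : x ^ n ∈ H) (h : m.Coprime n) : x ∈ H := by
  have h3 : x ^ ((m.gcd n : ℕ) : ℤ) ∈ H := by
    rw [Nat.gcd_eq_gcd_ab, zpow_add, zpow_mul, zpow_mul, zpow_natCast, zpow_natCast]
    exact mul_mem (zpow_mem hm _) (zpow_mem hn _)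
  rwa [h.gcd_eq_one, Nat.cast_one, zpow_one] at h3

theorem lcs_top (n : ℕ) : lcs (⊤ : Subgroup Γ) n =
    (⊤ : Subgroup Γ).lowerCentralSeries n := by
  induction n with
  | zero => rfl
  | succ n ih => rw [lcs_succ, ih]; rfl

theorem res_eq_bot_of_isNilpotent (D : Subgroup Γ) [h : Group.IsNilpotent D] : res D = ⊥ := by
  obtain ⟨n, hn⟩ := Subgroup.nilpotent_iff_lowerCentralSeries.1 h
  rw [← lcs_top] at hn
  have h1 := map_lcs D.subtype ⊤ n
  rw [hn, Subgroup.map_bot, ← MonoidHom.range_eq_map, range_subtype] at h1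
  exact le_bot_iff.1 (h1 ▸ res_le_lcs D n)

theorem res_eq_bot_of_pow [Finite Γ] {D : Subgroup Γ} {r : ℕ} (hr : r.Prime)
    (h : ∀ d ∈ D, ∃ e, d ^ r ^ e = 1) : res D = ⊥ := by
  have := Fact.mk hr
  have hD : IsPGroup r D := by
    intro d
    obtain ⟨e, he⟩ := h d d.2
    exact ⟨e, Subtype.ext he⟩
  have := hD.isNilpotent
  exact res_eq_bot_of_isNilpotent D

end Nilpotent

section WData

variable {Γ k X : Type} [Group Γ] [Field k] [AddCommGroup X] [Module k X]

/-- An `r`-subgroup `D` of the centralizer of `a` in `G`, normalized by this centralizer. -/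
structure WData (G : Subgroup Γ) (a : Γ) (q : ℕ) (D : Subgroup Γ) (r : ℕ) : Prop where
  setup : Setup G a q
  prime : r.Prime
  ne : q ≠ r
  le : D ≤ fixedIn G a
  conj : ∀ c ∈ fixedIn G a, ∀ d ∈ D, c * d * c⁻¹ ∈ D
  tor : ∀ d ∈ D, ∃ e, d ^ r ^ e = 1

theorem WData.restrict [Finite Γ] {G : Subgroup Γ} {a : Γ} {q : ℕ} {D : Subgroup Γ} {r : ℕ}
    (h : WData G a q D r) {S : Subgroup Γ} (ha : a ∈ S) :
    WData (G.subgroupOf S) (⟨a, ha⟩ : S) q (D.subgroupOf S) r where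
  setup := h.setup.restrict ha
  prime := h.prime
  ne := h.ne
  le := fun d hd => by
    have := mem_fixedIn.1 (h.le hd)
    exact mem_fixedIn.2 ⟨this.1, Subtype.ext this.2⟩
  conj := fun c hc d hd => by
    have := mem_fixedIn.1 hc
    exact h.conj c (mem_fixedIn.2 ⟨this.1, congrArg Subtype.val this.2⟩) d hd
  tor := fun d hd => by
    obtain ⟨e, he⟩ := h.tor d hd
    exact ⟨e, Subtype.ext he⟩

theorem WData.comm {G : Subgroup Γ} {a : Γ} {q : ℕ} {D : Subgroup Γ} {r : ℕ}
    (h : WData G a q D r) {d : Γ} (hd : d ∈ D) : a * d = d * a := (mem_fixedIn.1 (h.le hd)).2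

theorem WData.mem {G : Subgroup Γ} {a : Γ} {q : ℕ} {D : Subgroup Γ} {r : ℕ}
    (h : WData G a q D r) {d : Γ} (hd : d ∈ D) : d ∈ G := (mem_fixedIn.1 (h.le hd)).1

theorem normalClosure_le_of_conj {D X : Subgroup Γ}
    (h : ∀ γ, ∀ d ∈ D, γ * d * γ⁻¹ ∈ X) : normalClosure (D : Set Γ) ≤ X := by
  unfold normalClosure
  rw [closure_le]
  intro x hx
  obtain ⟨d, hd, hc⟩ := Group.mem_conjugatesOfSet_iff.1 hx
  obtain ⟨γ, rfl⟩ := isConj_iff.1 hc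
  exact h γ d hd

theorem WData.L_one_le [Finite Γ] {G : Subgroup Γ} {a : Γ} {q : ℕ} {D : Subgroup Γ} {r : ℕ}
    (h : WData G a q D r) : L (normalClosure (D : Set Γ)) 1 ≤ ⁅G, zpowers a⁆ := by
  have hQ := h.setup.comm_normal
  have h1 : normalClosure (D : Set Γ) ≤ D ⊔ ⁅G, zpowers a⁆ := by
    refine normalClosure_le_of_conj fun γ d hd => ?_
    obtain ⟨g, hg, i, rfl⟩ := h.setup.exists_mul γ
    obtain ⟨c, hc, y, hy, rfl⟩ := h.setup.exists_fixed_mul hg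
    have e1 : c * y * a ^ i * d * (c * y * a ^ i)⁻¹ =
        c * d * c⁻¹ * (c * (d⁻¹ * y * d⁻¹⁻¹ * y⁻¹) * c⁻¹) := by
      have := fixedIn_comm_zpow (h.le hd) i
      calc c * y * a ^ i * d * (c * y * a ^ i)⁻¹
          = c * y * (a ^ i * d) * (a ^ i)⁻¹ * y⁻¹ * c⁻¹ := by group
        _ = _ := by rw [this]; group
    rw [e1]
    exact mul_mem (mem_sup_left (h.conj c hc d hd))
      (mem_sup_right (hQ.conj_mem _ (mul_mem (hQ.conj_mem y hy _) (inv_mem hy)) c))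
  have h2 := L_le_sup h1 1
  rwa [L_one D, res_eq_bot_of_pow h.prime h.tor, bot_sup_eq] at h2

variable {ρ : Γ →* End k X} {ι : Type} [MulAction Γ ι] {W : ι → Submodule k X}
  {G : Subgroup Γ} {a : Γ} {q : ℕ} {D : Subgroup Γ} {r : ℕ}

theorem SOI.proj_orbSum_ne (h : SOI ρ W) {i j : ι} {x : X} (hx : x ∈ W i)
    (hj : ∀ s, a ^ s • i ≠ j) : h.proj j (orbSum ρ a q x) = 0 := by
  rw [orbSum, map_sum]
  exact Finset.sum_eq_zero fun s _ => h.proj_ne (hj s) (h.smul _ i x hx)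

theorem WData.fix_of_moved (hw : WData G a q D r) (h : SOI ρ W)
    (hfix : ∀ d ∈ D, ∀ x, ρ a x = x → ρ d x = x) {i : ι} (hi : a • i ≠ i) {d : Γ} (hd : d ∈ D) :
    d • i = i ∧ ∀ x ∈ W i, ρ d x = x := by
  have hq := hw.setup.prime
  have ha := hw.setup.pow
  obtain ⟨e, he⟩ := hw.tor d hd
  have hcop : q.Coprime (r ^ e) :=
    Nat.Coprime.pow_right e ((Nat.coprime_primes hq hw.prime).2 hw.ne)
  have key : ∀ x ∈ W i, x ≠ 0 → d • i = i ∧ ρ d x = x := by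
    intro x hx hx0
    have h1 := hfix d hd _ (rho_orbSum ρ ha x)
    have h2 := h.proj_rho d i (orbSum ρ a q x)
    rw [h1, h.proj_orbSum_self hq ha hi hx] at h2
    have h3 : ∃ s, a ^ s • i = d • i := by
      by_contra hcon
      push Not at hcon
      rw [h.proj_orbSum_ne hx hcon] at h2
      exact hx0 (rho_injective ρ d (h2.symm.trans (map_zero _).symm))
    obtain ⟨s, hs⟩ := h3
    have hmod : a ^ (s % q) = a ^ s := by
      conv_rhs => rw [← Nat.div_add_mod s q, pow_add, pow_mul, ha, one_pow, one_mul]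
    rw [← hmod] at hs
    rw [← hs, h.proj_orbSum hq ha hi hx (Nat.mod_lt s hq.pos)] at h2
    set b := a ^ (s % q) with hb
    have hcomm : Commute b d := Commute.pow_left (hw.comm hd) _
    have hbd : (b⁻¹ * d) ^ q = d ^ q := by
      rw [hcomm.inv_left.mul_pow, inv_pow, hb, ← pow_mul, mul_comm, pow_mul, ha, one_pow, inv_one,
        one_mul]
    have hstab : ∀ H : Subgroup Γ, b⁻¹ * d ∈ H → d ∈ H := fun H hH =>
      mem_of_pow_mem_coprime (hbd ▸ pow_mem hH q) (by rw [he]; exact one_mem H) hcop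
    constructor
    · refine hstab (MulAction.stabilizer Γ i) ?_
      rw [MulAction.mem_stabilizer_iff, mul_smul, ← hs, inv_smul_smul]
    · let H : Subgroup Γ :=
        { carrier := {g | ρ g x = x}
          one_mem' := by simp
          mul_mem' := fun {y z} hy hz => by
            rw [Set.mem_ofPred_eq] at hy hz ⊢
            rw [rho_mul_apply, hz, hy]
          inv_mem' := fun {y} hy => by
            rw [Set.mem_ofPred_eq] at hy ⊢
            conv_lhs => rw [← hy, rho_inv_apply] }
      refine hstab H ?_
      change ρ (b⁻¹ * d) x = x
      rw [rho_mul_apply, ← h2, rho_inv_apply]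
  obtain ⟨x₀, hx₀, hx₀'⟩ := Submodule.exists_mem_ne_zero_of_ne_bot (h.ne_bot i)
  refine ⟨(key x₀ hx₀ hx₀').1, fun x hx => ?_⟩
  by_cases hx0 : x = 0
  · rw [hx0, map_zero]
  · exact (key x hx hx0).2

theorem Setup.exists_fixed_transport [Finite Γ] (h : Setup G a q) {i j : ι} (hi : a • i = i)
    (hj : a • j = j) {γ : Γ} (hγ : γ • i = j) : ∃ n ∈ fixedIn G a, n • i = j := by
  obtain ⟨g, hg, s, rfl⟩ := h.exists_mul γ
  have hG := h.normal
  have has : a ^ s • i = i := by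
    have : a ^ s ∈ MulAction.stabilizer Γ i := zpow_mem (K := MulAction.stabilizer Γ i) hi s
    exact this
  rw [mul_smul, has] at hγ
  obtain ⟨n, -, hn, hn2⟩ := h.exists_fixed_smul hj hi le_rfl hg hγ
  exact ⟨n, hn, hn2⟩

theorem WData.normalClosure_subgroupOf_le [Finite Γ] (hw : WData G a q D r) (h : SOI ρ W)
    (hfix : ∀ d ∈ D, ∀ x, ρ a x = x → ρ d x = x) {N : Subgroup Γ} [N.Normal]
    (hN : ∀ n ∈ N, ∀ i : ι, a • i = i → a • n • i = n • i) {i₀ : ι} (hi₀ : a • i₀ = i₀)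
    {S : Subgroup Γ} (hS : ∀ s, s ∈ S ↔ OrbRel N i₀ (s • i₀)) {C : Subgroup S}
    (hC : ∀ s : S, (∀ i, OrbRel N i₀ i → ∀ x ∈ W i, ρ s x = x) → s ∈ C)
    (hDS : normalClosure (D : Set Γ) ≤ S) :
    (normalClosure (D : Set Γ)).subgroupOf S ≤ normalClosure (D.subgroupOf S : Set S) ⊔ C := by
  have hfixN : ∀ i, OrbRel N i₀ i → a • i = i := by
    rintro _ ⟨n, hn, rfl⟩
    exact hN n hn i₀ hi₀
  rw [← map_subtype_le_map_subtype, subgroupOf_map_subtype]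
  refine inf_le_left.trans (normalClosure_le_of_conj fun γ d hd => ?_)
  have hmem : γ * d * γ⁻¹ ∈ S :=
    hDS (normalClosure_normal.conj_mem d (subset_normalClosure hd) γ)
  refine ⟨⟨_, hmem⟩, ?_, rfl⟩
  by_cases hall : ∀ i, OrbRel N i₀ i → a • γ⁻¹ • i ≠ γ⁻¹ • i
  · refine mem_sup_right (hC _ fun i hi x hx => ?_)
    have h1 := (hw.fix_of_moved h hfix (hall i hi) hd).2 _ (h.smul γ⁻¹ i x hx)
    change ρ (γ * d * γ⁻¹) x = x
    rw [rho_mul_apply, rho_mul_apply, h1, rho_apply_inv]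
  · push Not at hall
    obtain ⟨i, hi, hai⟩ := hall
    obtain ⟨n, hn, hni⟩ := hw.setup.exists_fixed_transport hai (hfixN i hi) (smul_inv_smul γ i)
    have hhi : (γ * n⁻¹) • i = i := by
      rw [mul_smul, inv_smul_eq_iff.2 hni.symm, smul_inv_smul]
    have hhS : γ * n⁻¹ ∈ S := by
      rw [hS]
      have h1 := OrbRel.smul hi (γ * n⁻¹)
      rw [hhi] at h1
      exact hi.trans h1.symm
    have hn2 : (n * d * n⁻¹) ∈ D := hw.conj n hn d hd
    have hn3 : n * d * n⁻¹ ∈ S := hDS (subset_normalClosure hn2)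
    refine mem_sup_left ?_
    have e : (⟨γ * d * γ⁻¹, hmem⟩ : S) = ⟨γ * n⁻¹, hhS⟩ * ⟨n * d * n⁻¹, hn3⟩ *
        (⟨γ * n⁻¹, hhS⟩ : S)⁻¹ := by
      ext
      simp only [Subgroup.coe_mul, Subgroup.coe_inv]
      group
    rw [e]
    exact (normalClosure_normal (s := (D.subgroupOf S : Set S))).conj_mem _
      (subset_normalClosure (show (⟨n * d * n⁻¹, hn3⟩ : S) ∈ (D.subgroupOf S : Set S) from hn2)) _

theorem SOI.le_ker_of_trivial (h : SOI ρ W) {J : Subgroup Γ} [hJ : J.Normal] {i : ι}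
    (hi : ∀ g ∈ J, ∀ x ∈ W i, ρ g x = x) : J ≤ ρ.ker := by
  intro g hg
  refine h.mem_ker_of fun j x hx => ?_
  obtain ⟨γ, rfl⟩ := h.trans j i
  have h1 := hi _ (hJ.conj_mem g hg γ) _ (h.smul γ j x hx)
  rw [rho_mul_apply, rho_mul_apply, rho_inv_apply] at h1
  exact rho_injective ρ γ h1

theorem SOI.L_comm_trivial [Finite Γ] [IsAlgClosed k] [FiniteDimensional k X] (h : Setup G a q)
    (hW : SOI ρ W) (hρ : Irr ρ) (hqk : (q : k) ≠ 0) {i : ι} (hi : a • i = i)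
    (hfree : ∀ x ∈ W i, ρ a x = x → x = 0) {g : Γ}
    (hg : g ∈ L ⁅G ⊓ MulAction.stabilizer Γ i, zpowers a⁆ (fpfBound q)) {x : X} (hx : x ∈ W i) :
    ρ g x = x := by
  have h1 := L_comm_le_ker q _ (h.restrict (S := MulAction.stabilizer Γ i) hi) (hW.sub_irr hρ i)
    hqk (fun x hx => Subtype.ext (hfree x x.2 (congrArg Subtype.val hx))) le_rfl
  have e : ⁅G ⊓ MulAction.stabilizer Γ i, zpowers a⁆ =
      (⁅G.subgroupOf (MulAction.stabilizer Γ i),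
        zpowers (⟨a, hi⟩ : MulAction.stabilizer Γ i)⁆).map (MulAction.stabilizer Γ i).subtype := by
    rw [map_commutator, subgroupOf_map_subtype, MonoidHom.map_zpowers]; rfl
  rw [e, ← map_L] at hg
  obtain ⟨s, hs, rfl⟩ := hg
  exact congrArg Subtype.val (LinearMap.congr_fun (MonoidHom.mem_ker.1 (h1 hs)) ⟨x, hx⟩)

end WData

end FittingBound

namespace FittingBound

open Subgroup Module
open scoped commutatorElement Nat

section Blocks

variable {Γ Ω : Type} [Group Γ] [MulAction Γ Ω] {G : Subgroup Γ} {a : Γ} {q : ℕ}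

/-- The elements of `N₁` moving the fixed point `ω` to a fixed point of `a` form a subgroup. -/
def fixedTransporter {N₁ N : Subgroup Γ} (hN : ∀ i j : Ω, OrbRel N i j → a • i = i → a • j = j)
    (hc : ⁅N₁, N₁⁆ ≤ N) {ω : Ω} (hω : a • ω = ω)
    (hex : ∀ n ∈ N₁, a • n • ω = n • ω → ∃ m ∈ N₁, a * m = m * a ∧ m • ω = n • ω) :
    Subgroup Γ where
  carrier := {n | n ∈ N₁ ∧ a • n • ω = n • ω}
  one_mem' := ⟨N₁.one_mem, by rw [one_smul, hω]⟩
  mul_mem' := by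
    rintro n m ⟨hn, hn'⟩ ⟨hm, hm'⟩
    refine ⟨N₁.mul_mem hn hm, ?_⟩
    obtain ⟨m₀, hm₀, hcomm, he⟩ := hex m hm hm'
    have h1 := OrbRel.swap hc hn hm₀ ω
    have h2 := hN _ _ h1 (by rw [smul_smul, ← mul_assoc, hcomm, mul_smul, mul_smul, hn', mul_smul])
    rw [mul_smul n, he, ← mul_smul n] at h2
    exact h2
  inv_mem' := by
    rintro n ⟨hn, hn'⟩
    refine ⟨N₁.inv_mem hn, ?_⟩
    obtain ⟨m₀, hm₀, hcomm, he⟩ := hex n hn hn'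
    have h1 := OrbRel.swap hc hm₀ (N₁.inv_mem hn) ω
    have h2 := hN _ _ h1 (by rw [mul_smul, he, inv_smul_smul, hω])
    rw [smul_smul, ← mul_assoc, hcomm, mul_smul, mul_smul, mul_smul] at h2
    exact MulAction.injective m₀ h2

theorem Setup.orbRel_of_moved [Finite Γ] (h : Setup G a q) {N N₁ : Subgroup Γ} [N.Normal]
    [hN₁ : N₁.Normal] (hN₁G : N₁ ≤ G) (hN : ∀ i j : Ω, OrbRel N i j → a • i = i → a • j = j)
    (hc : ⁅N₁, N₁⁆ ≤ N) {ω : Ω} (hω : a • ω = ω) {u : Γ} (hu : u ∈ N₁) (huω : a • u • ω ≠ u • ω)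
    {d : Γ} (hd : ∀ i : Ω, a • i ≠ i → d • i = i) : OrbRel N ω (d • ω) := by
  have hex : ∀ n ∈ N₁, a • n • ω = n • ω → ∃ m ∈ N₁, a * m = m * a ∧ m • ω = n • ω := by
    intro n hn hn'
    obtain ⟨m, hm, hm2, hm3⟩ := h.exists_fixed_smul hn' hω hN₁G hn rfl
    exact ⟨m, hm, (mem_fixedIn.1 hm2).2, hm3⟩
  let C := fixedTransporter hN hc hω hex
  have hinv : a⁻¹ • ω = ω := by rw [inv_smul_eq_iff, hω]
  have hCN : C ≤ N₁ := fun x hx => hx.1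
  have hCa : ∀ x ∈ C, a * x * a⁻¹ ∈ C := by
    rintro x ⟨hx, hx'⟩
    refine ⟨hN₁.conj_mem x hx a, ?_⟩
    rw [mul_smul, mul_smul, hinv, hx', hx']
  have huC : u ∉ C := fun hu' => huω hu'.2
  have huaC : a * u * a⁻¹ ∉ C := by
    rintro ⟨-, hu'⟩
    rw [mul_smul, mul_smul, hinv] at hu'
    exact huω (MulAction.injective a hu')
  have hv : ∃ v ∈ N₁, v ∉ C ∧ u * v ∉ C := by
    by_contra hcon
    push Not at hcon
    have h1 := hcon u hu huC
    have h2 := hcon _ (hN₁.conj_mem u hu a) huaC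
    have h3 : u⁻¹ * (a * u * a⁻¹) ∈ C := by
      have := mul_mem (inv_mem h1) h2
      rwa [mul_inv_rev, mul_assoc, inv_mul_cancel_left] at this
    obtain ⟨y, hy, hy2⟩ := exists_fixed_of_coset h.prime h.pow hCa
      (not_dvd_card_of_le h.cop (hCN.trans hN₁G)) h3
    have h4 : u * y ∈ C := by
      refine ⟨N₁.mul_mem hu (hCN hy), ?_⟩
      rw [smul_smul, hy2, mul_smul, hω]
    exact huC ((mul_mem_cancel_right hy).1 h4)
  obtain ⟨v, hv, hvC, huvC⟩ := hv
  have fixes : ∀ x ∈ N₁, x ∉ C → d • x • ω = x • ω := fun x hx hxC =>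
    hd _ fun he => hxC ⟨hx, he⟩
  have hu' := hN₁.conj_mem u hu d
  set u' := d * u * d⁻¹ with hu'd
  have e1 : u' • d • ω = u • ω := by
    rw [hu'd, mul_smul, mul_smul, inv_smul_smul, fixes u hu huC]
  have e2 : u' • v • ω = u • v • ω := by
    have h1 := fixes _ (N₁.mul_mem hu hv) huvC
    rw [hu'd, mul_smul, mul_smul]
    conv_lhs => rw [← fixes v hv hvC, inv_smul_smul, smul_smul u v, h1, mul_smul]
  have h1 := OrbRel.swap hc hu' hv ω
  rw [mul_smul v, mul_smul u', e2] at h1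
  have h2 := OrbRel.swap hc hv hu ω
  rw [mul_smul u, mul_smul v, ← e1] at h2
  exact (h1.trans h2).of_smul.of_smul

/-- If `d` fixes all points moved by `a`, then `d` preserves the orbits of a normal subgroup which
maps fixed points of `a` to fixed points of `a`. -/
theorem Setup.exists_normal_orbRel [Finite Γ] (h : Setup G a q)
    (htrans : ∀ i j : Ω, ∃ γ : Γ, γ • i = j) :
    ∃ N : Subgroup Γ, N.Normal ∧ N ≤ G ∧ (∀ i j : Ω, OrbRel N i j → a • i = i → a • j = j) ∧
      ∀ d ∈ G, (∀ i : Ω, a • i ≠ i → d • i = i) → ∀ i : Ω, OrbRel N i (d • i) := by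
  have hG := h.normal
  let P : Set (Subgroup Γ) :=
    {N | N.Normal ∧ N ≤ G ∧ ∀ i j : Ω, OrbRel N i j → a • i = i → a • j = j}
  obtain ⟨N, ⟨hNn, hNG, hN⟩, hmax⟩ := WellFounded.has_min (wellFounded_gt (α := Subgroup Γ)) P
    ⟨⊥, inferInstance, bot_le, by
      rintro i _ ⟨n, hn, rfl⟩ hi
      rw [mem_bot.1 hn, one_smul, hi]⟩
  refine ⟨N, hNn, hNG, hN, fun d hdG hd i => ?_⟩
  by_cases hi : a • i = i
  swap
  · rw [hd i hi]; exact OrbRel.refl N i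
  by_cases hGN : G ≤ N
  · exact ⟨d, hGN hdG, rfl⟩
  obtain ⟨s, hs, hs2⟩ := h.sol.exists_der hGN
  have hlt : N < N ⊔ der G s := left_lt_sup.2 hs
  have hle : N ⊔ der G s ≤ G := sup_le hNG (der_le_self G s)
  have hcomm : ⁅N ⊔ der G s, N ⊔ der G s⁆ ≤ N :=
    sup_commutator_le (commutator_le_left N _) (commutator_sup_le (commutator_le_right _ N) hs2)
  have h1 : N ⊔ der G s ∉ P := fun hP => hmax _ hP hlt
  have h2 : ∃ u ∈ N ⊔ der G s, ∃ j : Ω, a • j = j ∧ a • u • j ≠ u • j := by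
    by_contra hcon
    push Not at hcon
    refine h1 ⟨inferInstance, hle, ?_⟩
    rintro i _ ⟨n, hn, rfl⟩ hi
    exact hcon n hn i hi
  obtain ⟨u, hu, j, hj, huj⟩ := h2
  obtain ⟨γ, hγ⟩ := htrans j i
  obtain ⟨c, hc, rfl⟩ := h.exists_fixed_transport hj hi hγ
  have hn : (N ⊔ der G s).Normal := inferInstance
  refine h.orbRel_of_moved hle hN hcomm hi (hn.conj_mem u hu c) ?_ hd
  intro he
  have hac := (mem_fixedIn.1 hc).2
  rw [mul_smul, mul_smul, inv_smul_smul, smul_smul, hac, mul_smul] at he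
  exact huj (MulAction.injective c he)

end Blocks

end FittingBound

namespace FittingBound

open Subgroup Module
open scoped commutatorElement Nat

section Imprimitive

variable {Γ k X : Type} [Group Γ] [Field k] [AddCommGroup X] [Module k X]
  {ρ : Γ →* End k X} {ι : Type} [MulAction Γ ι] {W : ι → Submodule k X}
  {G : Subgroup Γ} {a : Γ} {q : ℕ} {D : Subgroup Γ} {r : ℕ}

/-- The set stabilizer of the orbit of `x` under a normal subgroup. -/
def orbStab (N : Subgroup Γ) [N.Normal] (x : ι) : Subgroup Γ where
  carrier := {s | OrbRel N x (s • x)}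
  one_mem' := by
    change OrbRel N x ((1 : Γ) • x)
    rw [one_smul]; exact OrbRel.refl N x
  mul_mem' := fun {s t} hs ht => by
    change OrbRel N x ((s * t) • x)
    rw [mul_smul]
    exact OrbRel.trans hs (OrbRel.smul ht s)
  inv_mem' := fun {s} hs => by
    have h1 := OrbRel.smul (show OrbRel N x (s • x) from hs) s⁻¹
    rw [inv_smul_smul] at h1
    exact h1.symm

theorem mem_orbStab {N : Subgroup Γ} [N.Normal] {x : ι} {s : Γ} :
    s ∈ orbStab N x ↔ OrbRel N x (s • x) := Iff.rfl

theorem orbStab_smul {N : Subgroup Γ} [N.Normal] {x i : ι} {s : Γ} (hs : s ∈ orbStab N x)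
    (hi : OrbRel N x i) : OrbRel N x (s • i) := OrbRel.trans hs (hi.smul s)

/-- The elements of the stabilizer of a block acting trivially on the block. -/
def blockKer (ρ : Γ →* End k X) (W : ι → Submodule k X) (N : Subgroup Γ) [N.Normal] (x : ι) :
    Subgroup (orbStab N x) where
  carrier := {s | ∀ i, OrbRel N x i → ∀ y ∈ W i, ρ s y = y}
  one_mem' := fun i _ y _ => by simp
  mul_mem' := fun {s t} hs ht i hi y hy => by
    change ρ ((s : Γ) * t) y = y
    rw [rho_mul_apply, ht i hi y hy, hs i hi y hy]
  inv_mem' := fun {s} hs i hi y hy => by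
    change ρ ((s : Γ)⁻¹) y = y
    conv_lhs => rw [← hs i hi y hy, rho_inv_apply]

theorem SOI.blockKer_normal (h : SOI ρ W) (N : Subgroup Γ) [N.Normal] (x : ι) :
    (blockKer ρ W N x).Normal := by
  refine ⟨fun s hs t i hi y hy => ?_⟩
  change ρ ((t : Γ) * s * (t : Γ)⁻¹) y = y
  rw [rho_mul_apply, rho_mul_apply,
    hs _ (orbStab_smul (inv_mem t.2) hi) _ (h.smul (t : Γ)⁻¹ i y hy), rho_apply_inv]

theorem WData.eq_zero_of_moved [Finite Γ] (hw : WData G a q D r) (h : SOI ρ W)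
    (hfix : ∀ d ∈ D, ∀ x, ρ a x = x → ρ d x = x) {d : Γ} (hd : d ∈ D) {ω : ι} (hω : d • ω ≠ ω)
    {i : ι} (hi : a • i = i) {x : X} (hx : x ∈ W i) (hax : ρ a x = x) : x = 0 := by
  have haω : a • ω = ω := by
    by_contra hcon
    exact hω (hw.fix_of_moved h hfix hcon hd).1
  obtain ⟨γ, hγ⟩ := h.trans i ω
  obtain ⟨c, hc, hcω⟩ := hw.setup.exists_fixed_transport hi haω hγ
  have hac := (mem_fixedIn.1 hc).2
  have h1 : ρ c x ∈ W ω := hcω ▸ h.smul c i x hx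
  have h2 : ρ a (ρ c x) = ρ c x := by rw [← rho_mul_apply, hac, rho_mul_apply, hax]
  have h3 := h.proj_ne hω (h.smul d ω _ h1)
  rw [hfix d hd _ h2, h.proj_self h1] at h3
  exact rho_injective ρ c (h3.trans (map_zero _).symm)

theorem WData.L_le_ker_of_moved [Finite Γ] [IsAlgClosed k] [FiniteDimensional k X]
    (hw : WData G a q D r) (h : SOI ρ W) (hρ : Irr ρ) (hqk : (q : k) ≠ 0)
    (hfix : ∀ d ∈ D, ∀ x, ρ a x = x → ρ d x = x) {d : Γ} (hd : d ∈ D) {ω : ι} (hω : d • ω ≠ ω) :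
    L (normalClosure (D : Set Γ)) (1 + fpfBound q) ≤ ρ.ker := by
  have haω : a • ω = ω := by
    by_contra hcon
    exact hω (hw.fix_of_moved h hfix hcon hd).1
  obtain ⟨N, hNn, hNG, hN, hND⟩ := hw.setup.exists_normal_orbRel h.trans
  have hMS : normalClosure (D : Set Γ) ≤ orbStab N ω := by
    refine normalClosure_le_of_conj fun γ d hd => ?_
    have h1 := (hND d (hw.mem hd)
      (fun i hi => (hw.fix_of_moved h hfix hi hd).1) (γ⁻¹ • ω)).smul γ
    rw [mem_orbStab, mul_smul, mul_smul]
    rwa [smul_inv_smul] at h1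
  have haS : a ∈ orbStab N ω := by
    rw [mem_orbStab, haω]; exact OrbRel.refl N ω
  have hCn := h.blockKer_normal N ω
  have h1 := hw.normalClosure_subgroupOf_le h hfix (N := N)
    (fun n hn i hi => hN i _ ⟨n, hn, rfl⟩ hi) haω (S := orbStab N ω) (fun s => mem_orbStab)
    (C := blockKer ρ W N ω) (fun s hs => hs) hMS
  have hwS := hw.restrict haS
  have hSn := hwS.setup.normal
  set Q := ⁅G.subgroupOf (orbStab N ω), zpowers (⟨a, haS⟩ : orbStab N ω)⁆ with hQ
  have hQL : L Q (fpfBound q) ≤ blockKer ρ W N ω := by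
    intro g hg i hi x hx
    have hai := hN ω i hi haω
    have hAi : ∀ j, OrbRel N ω j → zpowers a ≤ MulAction.stabilizer Γ j := fun j hj => by
      rw [zpowers_le]; exact hN ω j hj haω
    have hQi : Q.map (orbStab N ω).subtype ≤ G ⊓ MulAction.stabilizer Γ i := by
      refine le_inf ?_ ?_
      · rintro _ ⟨y, hy, rfl⟩
        exact (commutator_zpowers_le (⟨a, haS⟩ : orbStab N ω) hy :
          y ∈ G.subgroupOf (orbStab N ω))
      · rw [hQ, map_commutator, subgroupOf_map_subtype, MonoidHom.map_zpowers,
          Subgroup.commutator_le]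
        rintro s ⟨-, hs⟩ y hy
        have hsi := orbStab_smul (inv_mem hs) hi
        rw [MulAction.mem_stabilizer_iff, commutatorElement_def, mul_smul, mul_smul, mul_smul,
          MulAction.mem_stabilizer_iff.1 (inv_mem (hAi i hi hy)),
          MulAction.mem_stabilizer_iff.1 (hAi (s⁻¹ • i) hsi hy), smul_inv_smul]
    have hQ2 : Q.map (orbStab N ω).subtype ≤ ⁅G ⊓ MulAction.stabilizer Γ i, zpowers a⁆ := by
      have e := congrArg (Subgroup.map (orbStab N ω).subtype) hwS.setup.comm_comm
      rw [← hQ, map_commutator, MonoidHom.map_zpowers] at e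
      rw [← e]
      exact commutator_mono hQi le_rfl
    refine SOI.L_comm_trivial hw.setup h hρ hqk hai
      (fun y hy hay => hw.eq_zero_of_moved h hfix hd hω hai hy hay) ?_ hx
    refine L_mono hQ2 _ ?_
    rw [← map_L]
    exact ⟨g, hg, rfl⟩
  have h2 : L ((normalClosure (D : Set Γ)).subgroupOf (orbStab N ω)) (1 + fpfBound q) ≤
      blockKer ρ W N ω := by
    refine (L_le_sup h1 _).trans (sup_le ?_ le_rfl)
    rw [L_add]
    exact (L_mono hwS.L_one_le _).trans hQL
  refine h.le_ker_of_trivial (i := ω) fun g hg x hx => ?_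
  rw [← L_subgroupOf hMS] at hg
  obtain ⟨s, hs, rfl⟩ := hg
  exact h2 hs ω (OrbRel.refl N ω) x hx

theorem WData.L_le_ker_of_fixed [Finite Γ] (hw : WData G a q D r) (h : SOI ρ W)
    (hfix : ∀ d ∈ D, ∀ x, ρ a x = x → ρ d x = x) (hD : ∀ d ∈ D, ∀ i : ι, d • i = i)
    {i : ι} (hi : a • i = i) {w : ℕ}
    (hS : L (normalClosure (D.subgroupOf (MulAction.stabilizer Γ i) : Set _)) w ≤
      (h.sub i).ker) : L (normalClosure (D : Set Γ)) w ≤ ρ.ker := by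
  have hMS : normalClosure (D : Set Γ) ≤ MulAction.stabilizer Γ i := by
    refine normalClosure_le_of_conj fun γ d hd => ?_
    rw [MulAction.mem_stabilizer_iff, mul_smul, mul_smul, hD d hd, smul_inv_smul]
  have h1 := hw.normalClosure_subgroupOf_le h hfix (N := ⊥)
    (fun n hn i hi => by rw [mem_bot.1 hn, one_smul, hi]) hi (S := MulAction.stabilizer Γ i)
    (fun s => ⟨fun hs => ⟨1, one_mem _, by rw [one_smul, MulAction.mem_stabilizer_iff.1 hs]⟩, by
      rintro ⟨n, hn, hn2⟩
      rw [mem_bot.1 hn, one_smul] at hn2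
      exact hn2.symm⟩)
    (C := (h.sub i).ker) (fun s hs => MonoidHom.mem_ker.2 (LinearMap.ext fun x =>
      Subtype.ext (hs i (OrbRel.refl _ i) x x.2))) hMS
  have h2 := (L_le_sup h1 w).trans (sup_le hS le_rfl)
  refine h.le_ker_of_trivial (i := i) fun g hg x hx => ?_
  rw [← L_subgroupOf hMS] at hg
  obtain ⟨s, hs, rfl⟩ := hg
  exact congrArg Subtype.val (LinearMap.congr_fun (MonoidHom.mem_ker.1 (h2 hs)) ⟨x, hx⟩)

end Imprimitive

end FittingBound

namespace FittingBound

open Subgroup Module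
open scoped commutatorElement Nat

section Chief

variable {Γ k X : Type} [Group Γ] [Finite Γ] [Field k] [AddCommGroup X] [Module k X]
  {ρ : Γ →* End k X} {G N P : Subgroup Γ} {a : Γ} {q : ℕ} {j : Γ → X}

theorem Setup.cast_ne_zero (h : Setup G a q) (hP : P ≤ G) {t : ℕ} [CharP k t] (ht : t.Prime)
    (htd : t ∣ N.relIndex P) : (q : k) ≠ 0 := by
  intro h0
  have h1 := (CharP.cast_eq_zero_iff k t q).1 h0
  rw [(Nat.prime_dvd_prime_iff_eq ht h.prime).1 h1] at htd
  exact not_dvd_card_of_le h.cop hP (htd.trans (N.relIndex_dvd_card P))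

theorem ChiefRep.fix_of_fixed (hρ : ChiefRep N P ρ j) (hNP : IsChief N P) (h : Setup G a q)
    (hP : P ≤ G) (hqk : (q : k) ≠ 0) {d : Γ} (hd : ∀ x ∈ P, a * x = x * a → ⁅d, x⁆ ∈ N) {v : X}
    (hv : ρ a v = v) : ρ d v = v := by
  have h1 := hρ.fixed_mem_span hNP.normal_left hNP.normal_right hNP.lt.le h.prime h.pow
    (not_dvd_card_of_le h.cop (hNP.lt.le.trans hP)) hqk hv
  have h2 : Submodule.span k (j '' {x | x ∈ P ∧ a * x = x * a}) ≤
      LinearMap.eqLocus (ρ d) LinearMap.id := by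
    rw [Submodule.span_le]
    rintro _ ⟨x, ⟨hx, hax⟩, rfl⟩
    exact (hρ.comm_mem_iff hNP.normal_right d hx).1 (hd x hx hax)
  exact h2 h1

end Chief

section Primitive

variable {Γ k X : Type} [Group Γ] [Field k] [AddCommGroup X] [Module k X]
  {ρ : Γ →* End k X} {G B : Subgroup Γ} {a : Γ} {q : ℕ} {D : Subgroup Γ} {r : ℕ}

theorem mem_ker_of_mem_scal {d : Γ} (hd : d ∈ scal ρ) {x : X} (hx : x ≠ 0) (hdx : ρ d x = x) :
    d ∈ ρ.ker := by
  obtain ⟨c, hc⟩ := hd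
  rw [hc, LinearMap.smul_apply, Module.End.one_apply] at hdx
  have h1 : (c - 1) • x = 0 := by rw [sub_smul, one_smul, hdx, sub_self]
  have h2 := sub_eq_zero.1 ((smul_eq_zero.1 h1).resolve_right hx)
  rw [MonoidHom.mem_ker, hc, h2, one_smul]

theorem WData.commutator_mem (hw : WData G a q D r) {d b : Γ} (hd : d ∈ D)
    (hb : b ∈ fixedIn G a) : ⁅d, b⁆ ∈ D := by
  have e : ⁅d, b⁆ = d * (b * d⁻¹ * b⁻¹) := by rw [commutatorElement_def]; group
  rw [e]
  exact D.mul_mem hd (hw.conj b hb _ (D.inv_mem hd))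

theorem WData.closure_le (hw : WData G a q D r) : normalClosure (D : Set Γ) ≤ G := by
  have := hw.setup.normal
  exact normalClosure_le_normal fun d hd => hw.mem hd

theorem WData.inf_maxAb_le_ker [Finite Γ] [IsAlgClosed k] [FiniteDimensional k X] (hw : WData G a q D r)
    (hρ : Irr ρ) (hp : Prim ρ) (hB : MaxAb ρ G B)
    (hfix : ∀ d ∈ D, ∀ x, ρ a x = x → ρ d x = x) {x₀ : X} (hx₀ : x₀ ≠ 0) (hax₀ : ρ a x₀ = x₀) :
    D ⊓ B ≤ ρ.ker := by
  rintro e ⟨heD, heB⟩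
  have hG := hw.setup.normal
  have hscal : ∀ d ∈ D, d ∈ scal ρ → d ∈ ρ.ker := fun d hd hs =>
    mem_ker_of_mem_scal hs hx₀ (hfix d hd x₀ hax₀)
  refine hscal e heD (hB.mem_scal_of_commute hρ hp hw.setup.sol (hB.le heB) fun b hb => ?_)
  let Z : Subgroup Γ := (centralizer {ρ.toHomUnits e}).comap ρ.toHomUnits
  have hZ : ∀ c, c ∈ Z ↔ Commute (ρ e) (ρ c) := fun c => by
    rw [mem_comap, mem_centralizer_singleton_iff, Units.ext_iff]
    exact eq_comm
  have haZ : a ∈ Z := by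
    rw [hZ, Commute, SemiconjBy, ← map_mul, ← map_mul, hw.comm heD]
  have hbZ : b⁻¹ * (a * b * a⁻¹) ∈ Z := by
    have hs : ⁅e, b⁆ ∈ scal ρ := hB.comm (commutator_mem_commutator heB hb)
    rw [hZ, commute_iff_mem_ker]
    have e1 : ⁅e, b⁻¹ * (a * b * a⁻¹)⁆ = b⁻¹ * (⁅e, b⁆⁻¹ * ⁅a, ⁅e, b⁆⁆ * ⁅e, b⁆⁻¹⁻¹) * b⁻¹⁻¹ := by
      have h1 : a * e * a⁻¹ = e := by rw [hw.comm heD, mul_inv_cancel_right]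
      have h2 : a * e⁻¹ * a⁻¹ = e⁻¹ := by rw [← conj_inv, h1]
      calc ⁅e, b⁻¹ * (a * b * a⁻¹)⁆ = e * b⁻¹ * (a * b * a⁻¹) * e⁻¹ * a * b⁻¹ * a⁻¹ * b := by
            rw [commutatorElement_def]; group
        _ = e * b⁻¹ * e⁻¹ * (a * e * a⁻¹) * (a * b * a⁻¹) * (a * e⁻¹ * a⁻¹) *
            a * b⁻¹ * a⁻¹ * b := by rw [h1, h2]; group
        _ = e * b⁻¹ * e⁻¹ * (a * (e * b * e⁻¹ * b⁻¹) * a⁻¹) * b := by group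
        _ = _ := by simp only [commutatorElement_def]; group
    rw [e1]
    have hk : ⁅a, ⁅e, b⁆⁆ ∈ ρ.ker := by
      have := commutator_scal_le ρ (commutator_mem_commutator hs (mem_top a))
      rw [← commutatorElement_inv]
      exact inv_mem this
    have hkn : ρ.ker.Normal := inferInstance
    exact hkn.conj_mem _ (hkn.conj_mem _ hk _) _
  have hBn := hB.normal
  obtain ⟨y, ⟨hyB, hyZ⟩, hy⟩ := exists_fixed_of_coset (H := B ⊓ Z) (x := b) hw.setup.prime
    hw.setup.pow
    (fun y hy => ⟨hBn.conj_mem y hy.1 a, Z.mul_mem (Z.mul_mem haZ hy.2) (Z.inv_mem haZ)⟩)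
    (not_dvd_card_of_le hw.setup.cop (inf_le_left.trans hB.le))
    ⟨B.mul_mem (B.inv_mem hb) (hBn.conj_mem b hb a), hbZ⟩
  have hby : b * y ∈ B := B.mul_mem hb hyB
  have h1 : b * y ∈ Z := by
    rw [hZ, commute_iff_mem_ker]
    exact hscal _ (hw.commutator_mem heD (mem_fixedIn.2 ⟨hB.le hby, hy⟩))
      (hB.comm (commutator_mem_commutator heB hby))
  exact (hZ b).1 ((Z.mul_mem_cancel_right hyZ).1 h1)

end Primitive

section Core

/-- For representations of `q`-by-coprime soluble groups in which an `r`-subgroup `D` fixes all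
fixed vectors of `a`, the normal closure of `D` acts with height at most `w`; if `modular` holds
then only representations in characteristic `r` are considered. -/
def WStmt (q w : ℕ) (modular : Prop) : Prop :=
  ∀ {Γ k X : Type} [Group Γ] [Finite Γ] [Field k] [IsAlgClosed k] [AddCommGroup X] [Module k X]
    [FiniteDimensional k X] {ρ : Γ →* End k X} {G : Subgroup Γ} {a : Γ} {D : Subgroup Γ} {r : ℕ},
    (modular → CharP k r) → WData G a q D r → Irr ρ → (q : k) ≠ 0 →
    (∀ d ∈ D, ∀ x, ρ a x = x → ρ d x = x) → L (normalClosure (D : Set Γ)) w ≤ ρ.ker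

/-- The height bound in `WStmt`. -/
def wBound (q w₀ : ℕ) : ℕ := scBound ((10 * q ^ 2) ^ (10 * q ^ 2)) + w₀ + 1 + fpfBound q

variable {Γ k X : Type} [Group Γ] [Finite Γ] [Field k] [AddCommGroup X] [Module k X]
  [IsAlgClosed k] [FiniteDimensional k X] {ρ : Γ →* End k X} {G B : Subgroup Γ} {a : Γ} {q : ℕ}
  {D : Subgroup Γ} {r : ℕ}

theorem MaxAb.mem_of_pow_mem (hρ : Irr ρ) (hp : Prim ρ) [G.Normal] (hG : Sol G)
    (hB : MaxAb ρ G B) [CharP k r] (hr : r.Prime) {N : Subgroup Γ} (hN : G ⊓ scal ρ ≤ N) {x : Γ}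
    (hx : x ∈ B) (hxr : x ^ r ∈ N) : x ∈ N := by
  have := hρ.nontrivial
  have h0 := (scalRep_projRep ρ).card_ne_zero hB.map_comm (hB.map_nonDeg hρ hp hG)
  rw [Ne, CharP.cast_eq_zero_iff k r, ← Nat.Prime.coprime_iff_not_dvd hr] at h0
  refine mem_of_pow_mem_coprime hxr (hN ⟨G.pow_mem (hB.le hx) _, ?_⟩) h0
  have h1 : (⟨_, mem_map_of_mem (QuotientGroup.mk' (scal ρ)) hx⟩ :
    B.map (QuotientGroup.mk' (scal ρ))) ^ Nat.card (B.map (QuotientGroup.mk' (scal ρ))) = 1 :=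
    pow_card_eq_one'
  exact (QuotientGroup.eq_one_iff _).1 (congrArg Subtype.val h1)

theorem WData.L_le_ker_of_prim {modular : Prop} {w₀ : ℕ} (hm : modular ∨ WStmt q w₀ True)
    (hw : WData G a q D r) (hmod : modular → CharP k r) (hρ : Irr ρ) (hp : Prim ρ)
    (hqk : (q : k) ≠ 0) (hfix : ∀ d ∈ D, ∀ x, ρ a x = x → ρ d x = x) :
    L (normalClosure (D : Set Γ)) (wBound q w₀) ≤ ρ.ker := by
  have hG := hw.setup.normal
  by_cases hfree : ∀ x, ρ a x = x → x = 0
  · refine L_le_trans (i := 1 + fpfBound q) (by unfold wBound; omega) ?_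
    rw [L_add]
    exact (L_mono hw.L_one_le _).trans (L_comm_le_ker q _ hw.setup hρ hqk hfree le_rfl)
  push Not at hfree
  obtain ⟨x₀, hax₀, hx₀⟩ := hfree
  obtain ⟨B, hB⟩ := exists_maxAb ρ G
  have hDB := hw.inf_maxAb_le_ker hρ hp hB hfix hx₀ hax₀
  have hBn := hB.normal
  refine L_le_trans (i := scBound ((10 * q ^ 2) ^ (10 * q ^ 2)) + w₀ + 1)
    (by unfold wBound; omega) ?_
  rw [L_succ]
  have hfixB : ∀ d ∈ D, ∀ b ∈ B, a * b = b * a → ⁅d, b⁆ ∈ ρ.ker := fun d hd b hb hab =>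
    hDB ⟨hw.commutator_mem hd (mem_fixedIn.2 ⟨hB.le hb, hab⟩), commutatorElement_mem_right hBn d hb⟩
  refine hB.res_le_ker hρ hp hw.setup.sol ((L_le _ _).trans hw.closure_le) fun N P hNP hN hP => ?_
  have hPG := hP.trans hB.le
  obtain ⟨t, ht, htd, htp, k', _, _, _, X', _, _, _, ρ', j, hρ'⟩ :=
    hNP.exists_chiefRep (hNP.comm_le (hw.setup.sol.mono hPG))
  by_cases htr : t = r
  · subst htr
    by_cases hmo : modular
    · have := hmod hmo
      exact absurd (fun x hx => hB.mem_of_pow_mem hρ hp hw.setup.sol ht hN (hP hx) (htp x hx))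
        (not_le_of_gt hNP.lt)
    · have hqk' := hw.setup.cast_ne_zero (k := k') hPG ht htd
      have h1 := hm.resolve_left hmo (ρ := ρ') (fun _ => inferInstance) hw hρ'.irr hqk'
        fun d hd v hv => hρ'.fix_of_fixed hNP hw.setup hPG hqk' (fun x hx hax =>
          hN ⟨hPG (commutatorElement_mem_right hNP.normal_right d hx),
            ker_le_scal ρ (hfixB d hd x (hP hx) hax)⟩) hv
      exact (commutator_mono le_rfl (L_antitone _ (by omega))).trans
        (hρ'.commutator_le hNP.normal_right h1)
  · refine (commutator_mono le_rfl (L_antitone _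
      (Nat.le_add_right (scBound ((10 * q ^ 2) ^ (10 * q ^ 2))) w₀))).trans
      (hNP.commutator_L_le_of_defect (D := Group.conjugatesOfSet (D : Set Γ)) hw.setup.sol_top
        (fun γ g hg => Group.conj_mem_conjugatesOfSet hg) fun g hg => ?_)
    obtain ⟨d, hd, hc⟩ := Group.mem_conjugatesOfSet_iff.1 hg
    obtain ⟨γ, rfl⟩ := isConj_iff.1 hc
    obtain ⟨e, he⟩ := hw.tor d hd
    obtain ⟨F, hFc, hF⟩ := MaxAb.exists_finset_of_fixed hρ hp hw.setup hB hqk hw.prime hw.ne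
      (hw.comm hd) he (hfix d hd) (fun b hb hab => ker_le_scal ρ (hfixB d hd b hb hab)) hN hP hNP
      ht htr htp
    refine ⟨F, γ⁻¹, hFc, ?_⟩
    have e : γ⁻¹ * (γ * d * γ⁻¹) * γ⁻¹⁻¹ = d := by group
    rwa [e]

theorem wStmt_of_modular {modular : Prop} {q w₀ : ℕ} (hm : modular ∨ WStmt q w₀ True) :
    WStmt q (wBound q w₀) modular := by
  suffices H : ∀ n : ℕ, ∀ {Γ k X : Type} [Group Γ] [Finite Γ] [Field k] [IsAlgClosed k]
      [AddCommGroup X] [Module k X] [FiniteDimensional k X] {ρ : Γ →* End k X} {G : Subgroup Γ}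
      {a : Γ} {D : Subgroup Γ} {r : ℕ}, (modular → CharP k r) → WData G a q D r → Irr ρ →
      (q : k) ≠ 0 → (∀ d ∈ D, ∀ x, ρ a x = x → ρ d x = x) → finrank k X ≤ n →
      L (normalClosure (D : Set Γ)) (wBound q w₀) ≤ ρ.ker by
    intro Γ k X _ _ _ _ _ _ _ ρ G a D r hmod hw hρ hqk hfix
    exact H _ hmod hw hρ hqk hfix le_rfl
  intro n
  induction n with
  | zero =>
    intro Γ k X _ _ _ _ _ _ _ ρ G a D r _ _ hρ _ _ hn
    have := hρ.nontrivial
    have : 0 < finrank k X := finrank_pos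
    omega
  | succ n ih =>
    intro Γ k X _ _ _ _ _ _ _ ρ G a D r hmod hw hρ hqk hfix hn
    by_cases hp : Prim ρ
    · exact hw.L_le_ker_of_prim hm hmod hρ hp hqk hfix
    unfold Prim at hp
    push Not at hp
    obtain ⟨ι, _, W, hW⟩ := hp
    by_cases hD : ∀ d ∈ D, ∀ i : ι, d • i = i
    · by_cases hfixed : ∃ i : ι, a • i = i
      · obtain ⟨i, hi⟩ := hfixed
        refine hw.L_le_ker_of_fixed hW hfix hD hi (ih hmod (hw.restrict hi) (hW.sub_irr hρ i) hqk
          (fun d hd x hx => Subtype.ext (hfix d hd x (congrArg Subtype.val hx))) ?_)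
        have := hW.finrank_lt i
        omega
      · push Not at hfixed
        refine (L_le _ _).trans (normalClosure_le_normal fun d hd => ?_)
        exact hW.mem_ker_of fun i x hx => (hw.fix_of_moved hW hfix (hfixed i) hd).2 x hx
    · push Not at hD
      obtain ⟨d, hd, i, hi⟩ := hD
      exact L_le_trans (by unfold wBound; omega) (hw.L_le_ker_of_moved hW hρ hqk hfix hd hi)

/-- The height bound for the action of normal closures of `r`-groups fixing all fixed vectors. -/
def wBound' (q : ℕ) : ℕ := wBound q (wBound q 0)

theorem wStmt (q : ℕ) : WStmt q (wBound' q) False :=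
  wStmt_of_modular (Or.inr (wStmt_of_modular (w₀ := 0) (Or.inl trivial)))

end Core

end FittingBound

namespace FittingBound

open Subgroup Module
open scoped commutatorElement Nat

section CentralChief

variable {Γ : Type} [Group Γ] [Finite Γ]

theorem mul_pow_of_central {J T : Subgroup Γ} (hc : ⁅T, J⁆ = ⊥) {x y : Γ}
    (hx : x ∈ J) (hy : y ∈ J) : (x * y) ^ T.relIndex J = x ^ T.relIndex J * y ^ T.relIndex J := by
  have h1 : T.subgroupOf J ≤ center J := by
    intro t ht
    rw [mem_center_iff]
    intro g
    have h2 := commutator_mem_commutator (show (t : Γ) ∈ T from ht) g.2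
    rw [hc, mem_bot, commutatorElement_eq_one_iff_mul_comm] at h2
    exact Subtype.ext h2.symm
  obtain ⟨l, hl⟩ := index_dvd_of_le h1
  have h3 : ((⟨x, hx⟩ * ⟨y, hy⟩ : J) ^ (center J).index) =
      (⟨x, hx⟩ : J) ^ (center J).index * (⟨y, hy⟩ : J) ^ (center J).index :=
    congrArg (Subtype.val : center J → J)
      (map_mul (MonoidHom.transferCenterPow J) (⟨x, hx⟩ : J) ⟨y, hy⟩)
  have h4 : Commute ((⟨x, hx⟩ : J) ^ (center J).index) ((⟨y, hy⟩ : J) ^ (center J).index) :=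
    (mem_center_iff.1 ((center J).pow_index_mem (⟨y, hy⟩ : J)) _)
  have h5 := congrArg (· ^ l) h3
  simp only [h4.mul_pow, ← pow_mul, ← hl] at h5
  exact congrArg Subtype.val h5

theorem pow_eq_one_of_le_commutator {J N T : Subgroup Γ} [hJ : J.Normal] [T.Normal] (hJN : J ≤ N)
    (hTN : ⁅T, N⁆ = ⊥) (hJ' : J ≤ ⁅J, N⁆) {x : Γ} (hx : x ∈ J) :
    x ^ T.relIndex J = 1 := by
  have hc : ⁅T, J⁆ = ⊥ := le_bot_iff.1 (hTN ▸ commutator_mono le_rfl hJN)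
  set m := T.relIndex J with hm
  have hmul : ∀ x ∈ J, ∀ y ∈ J, (x * y) ^ m = x ^ m * y ^ m := fun x hx y hy =>
    mul_pow_of_central hc hx hy
  let E : Subgroup Γ :=
    { carrier := {x | x ∈ J ∧ x ^ m = 1}
      one_mem' := ⟨J.one_mem, one_pow m⟩
      mul_mem' := fun {x y} hx hy => ⟨J.mul_mem hx.1 hy.1, by
        rw [hmul x hx.1 y hy.1, hx.2, hy.2, one_mul]⟩
      inv_mem' := fun {x} hx => ⟨J.inv_mem hx.1, by rw [inv_pow, hx.2, inv_one]⟩ }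
  suffices h : ⁅J, N⁆ ≤ E from (h (hJ' hx)).2
  rw [Subgroup.commutator_le]
  intro x hx n hn
  have h1 : n * x⁻¹ * n⁻¹ ∈ J := hJ.conj_mem _ (J.inv_mem hx) n
  have e : ⁅x, n⁆ = x * (n * x⁻¹ * n⁻¹) := by rw [commutatorElement_def]; group
  rw [e]
  refine ⟨J.mul_mem hx h1, ?_⟩
  have h2 : x ^ m ∈ T := (T.subgroupOf J).pow_index_mem (⟨x, hx⟩ : J)
  have h3 := commutator_mem_commutator h2 hn
  rw [hTN, mem_bot, commutatorElement_def] at h3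
  rw [hmul _ hx _ h1, conj_pow, inv_pow, ← h3]
  group

theorem exists_pow_mem_of_dvd_relIndex {N P : Subgroup Γ} [N.Normal] {t : ℕ} (ht : t.Prime)
    (h : t ∣ N.relIndex P) : ∃ y ∈ P, y ∉ N ∧ y ^ t ∈ N := by
  have := Fact.mk ht
  obtain ⟨z, hz⟩ := exists_prime_orderOf_dvd_card' (G := P ⧸ N.subgroupOf P) t h
  obtain ⟨y, rfl⟩ := QuotientGroup.mk_surjective z
  refine ⟨y, y.2, fun hy => ?_, ?_⟩
  · rw [(QuotientGroup.eq_one_iff y).2 hy, orderOf_one] at hz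
    exact ht.one_lt.ne hz
  · have h1 := pow_orderOf_eq_one (y : P ⧸ N.subgroupOf P)
    rw [hz, ← QuotientGroup.mk_pow, QuotientGroup.eq_one_iff] at h1
    exact h1

theorem dvd_card_imp_of_central {J N : Subgroup Γ} [J.Normal] [N.Normal] (hJs : Sol J)
    (hJ : J ≤ ⁅J, N⁆) (π : ℕ → Prop)
    (h : ∀ A B, IsChief A B → B ≤ J → ∀ t : ℕ, t.Prime → (∀ x ∈ B, x ^ t ∈ A) → ¬ π t → ⁅B, N⁆ ≤ A)
    {t : ℕ} (ht : t.Prime) (htJ : t ∣ Nat.card J) : π t := by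
  have hJN : J ≤ N := hJ.trans (commutator_le_right _ _)
  obtain ⟨T, ⟨hTn, hTJ, hTπ⟩, hmin⟩ := WellFounded.has_min (wellFounded_lt (α := Subgroup Γ))
    {T | T.Normal ∧ T ≤ J ∧ ∀ t : ℕ, t.Prime → t ∣ T.relIndex J → π t}
    ⟨J, inferInstance, le_rfl, fun t ht htd => by
      rw [relIndex_self, Nat.dvd_one] at htd
      exact absurd htd ht.ne_one⟩
  by_cases hT : T = ⊥
  · rw [hT, relIndex_bot_left] at hTπ
    exact hTπ t ht htJ
  exfalso
  obtain ⟨T', -, hch⟩ := exists_chief_le (bot_lt_iff_ne_bot.2 hT)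
  have hT'n := hch.normal_left
  have h1 : ∃ s : ℕ, s.Prime ∧ s ∣ T'.relIndex J ∧ ¬ π s := by
    by_contra hcon
    push Not at hcon
    exact hmin T' ⟨hT'n, hch.lt.le.trans hTJ, hcon⟩ hch.lt
  obtain ⟨s, hs, hsd, hsπ⟩ := h1
  rw [← relIndex_mul_relIndex T' T J hch.lt.le hTJ, hs.dvd_mul] at hsd
  have hsm : ¬ s ∣ T.relIndex J := fun hd => hsπ (hTπ s hs hd)
  obtain ⟨y, hyT, hyT', hys⟩ := exists_pow_mem_of_dvd_relIndex hs (hsd.resolve_right hsm)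
  obtain ⟨t', ht', -, htp⟩ := hch.exists_prime (hch.comm_le (hJs.mono hTJ))
  have e : t' = s := by
    by_contra hne
    exact hyT' (mem_of_pow_mem_coprime (htp y hyT) hys ((Nat.coprime_primes ht' hs).2 hne))
  subst e
  have hcen := h T' T hch hTJ t' hs htp hsπ
  let f := QuotientGroup.mk' T'
  have hf : Function.Surjective f := QuotientGroup.mk'_surjective T'
  have hk : f.ker = T' := QuotientGroup.ker_mk' T'
  have hJf : (J.map f).Normal := Normal.map inferInstance f hf
  have hTf : (T.map f).Normal := Normal.map inferInstance f hf
  have h2 : f y ^ (T.map f).relIndex (J.map f) = 1 := by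
    refine pow_eq_one_of_le_commutator (N := N.map f) (map_mono hJN) ?_ ?_
      (mem_map_of_mem f (hTJ hyT))
    · rw [← map_commutator, Subgroup.map_eq_bot_iff, hk]
      exact hcen
    · rw [← map_commutator]
      exact map_mono hJ
  rw [relIndex_map_map, hk, sup_of_le_left hch.lt.le, sup_of_le_left (hch.lt.le.trans hTJ),
    ← map_pow, ← MonoidHom.mem_ker, hk] at h2
  exact hyT' (mem_of_pow_mem_coprime hys h2 ((Nat.Prime.coprime_iff_not_dvd hs).2 hsm))

theorem eq_bot_of_central {J N : Subgroup Γ} [J.Normal] [N.Normal] (hJs : Sol J)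
    (hJ : J ≤ ⁅J, N⁆) (h : ∀ A B, IsChief A B → B ≤ J → ⁅B, N⁆ ≤ A) : J = ⊥ := by
  by_contra hne
  have h1 : Nat.card J ≠ 1 := fun h1 => hne (Subgroup.card_eq_one.1 h1)
  obtain ⟨t, ht, htd⟩ := Nat.exists_prime_and_dvd h1
  exact dvd_card_imp_of_central hJs hJ (fun _ => False) (fun A B hAB hB _ _ _ _ => h A B hAB hB)
    ht htd

theorem res_eq_bot_of_prime {J N : Subgroup Γ} [J.Normal] [N.Normal] (hJs : Sol J)
    (hJ : J ≤ ⁅J, N⁆) {r : ℕ} (hr : r.Prime)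
    (h : ∀ A B, IsChief A B → B ≤ J → ∀ t : ℕ, t.Prime → (∀ x ∈ B, x ^ t ∈ A) → t ≠ r → ⁅B, N⁆ ≤ A) :
    res J = ⊥ := by
  have h1 : ∀ {t : ℕ}, t.Prime → t ∣ Nat.card J → t = r := fun ht htd =>
    dvd_card_imp_of_central hJs hJ (fun t => t = r) h ht htd
  have h2 := Nat.eq_prime_pow_of_unique_prime_dvd (Nat.card_pos (α := J)).ne' h1
  refine res_eq_bot_of_pow hr fun d hd => ⟨(Nat.card J).primeFactorsList.length, ?_⟩
  rw [← h2]
  exact congrArg Subtype.val (pow_card_eq_one' (x := (⟨d, hd⟩ : J)))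

theorem IsChief.commutator_le_of_res_eq_bot {A B N : Subgroup Γ} (h : IsChief A B) [N.Normal]
    (hN : res N = ⊥) : ⁅B, N⁆ ≤ A := by
  have hA := h.normal_left
  have hB := h.normal_right
  rcases h.eq_or (A ⊔ ⁅B, N⁆) inferInstance le_sup_left
    (sup_le h.lt.le (commutator_le_left _ _)) with h1 | h1
  · exact sup_eq_left.1 h1
  · exfalso
    have h2 : ∀ n, B ≤ A ⊔ lcs N n := by
      intro n
      induction n with
      | zero =>
        conv_lhs => rw [← h1]
        exact sup_le_sup_left (commutator_le_right _ _) _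
      | succ n ih =>
        conv_lhs => rw [← h1]
        refine sup_le le_sup_left ((commutator_mono ih le_rfl).trans ?_)
        exact sup_commutator_le ((commutator_le_left _ _).trans le_sup_left)
          (by rw [lcs_succ]; exact le_sup_right)
    obtain ⟨n, hn⟩ := exists_res_eq N
    have h3 := h2 n
    rw [← hn n le_rfl, hN, sup_bot_eq] at h3
    exact h.lt.not_ge h3

theorem res_sup_eq_bot (hΓ : Sol (⊤ : Subgroup Γ)) {N₁ N₂ : Subgroup Γ} [N₁.Normal] [N₂.Normal]
    (h₁ : res N₁ = ⊥) (h₂ : res N₂ = ⊥) : res (N₁ ⊔ N₂) = ⊥ :=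
  eq_bot_of_central (N := N₁ ⊔ N₂) (hΓ.mono le_top) (commutator_res _).ge fun A B hAB _ => by
    have := hAB.normal_left
    exact commutator_sup_le (hAB.commutator_le_of_res_eq_bot h₁)
      (hAB.commutator_le_of_res_eq_bot h₂)

theorem exists_isNilpotent_of_res {N : Subgroup Γ} (h : res N = ⊥) : Group.IsNilpotent N := by
  obtain ⟨n, hn⟩ := exists_res_eq N
  refine Subgroup.nilpotent_iff_lowerCentralSeries.2 ⟨n, ?_⟩
  rw [← lcs_top]
  have h1 := map_lcs N.subtype ⊤ n
  rw [← MonoidHom.range_eq_map, range_subtype, ← hn n le_rfl, h] at h1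
  exact (map_eq_bot_iff_of_injective _ N.subtype_injective).1 h1

/-- A nilpotent subgroup is generated by its primary components. -/
theorem exists_primary {N : Subgroup Γ} (h : res N = ⊥) : ∃ D : ℕ → Subgroup Γ,
    (∀ r : ℕ, r.Prime → ∀ x, x ∈ D r ↔ x ∈ N ∧ ∃ e, x ^ r ^ e = 1) ∧
    ∀ H : Subgroup Γ, (∀ r : ℕ, r.Prime → r ∣ Nat.card N → D r ≤ H) → N ≤ H := by
  have hnil := exists_isNilpotent_of_res h
  have hsyl := ((Group.isNilpotent_of_finite_tfae (G := N)).out 0 3).1 hnil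
  classical
  let D : ℕ → Subgroup Γ := fun r => if hr : r.Prime then
    haveI := Fact.mk hr
    ((default : Sylow r N) : Subgroup N).map N.subtype else ⊥
  refine ⟨D, fun r hr x => ?_, fun H hH => ?_⟩
  · have := Fact.mk hr
    have hn := hsyl r this default
    have hD : D r = ((default : Sylow r N) : Subgroup N).map N.subtype := dif_pos hr
    rw [hD]
    constructor
    · rintro ⟨y, hy, rfl⟩
      obtain ⟨e, he⟩ := (default : Sylow r N).isPGroup' ⟨y, hy⟩
      exact ⟨y.2, e, congrArg (fun z : ((default : Sylow r N) : Subgroup N) => ((z : N) : Γ)) he⟩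
    · rintro ⟨hx, e, he⟩
      have hp : IsPGroup r (zpowers (⟨x, hx⟩ : N)) := by
        rintro ⟨_, i, rfl⟩
        refine ⟨e, Subtype.ext (Subtype.ext ?_)⟩
        change (x ^ i) ^ r ^ e = 1
        rw [← zpow_natCast, zpow_comm, zpow_natCast, he, one_zpow]
      obtain ⟨P, hP⟩ := hp.exists_le_sylow
      have := Sylow.unique_of_normal (default : Sylow r N) hn
      have e2 : P = default := Subsingleton.elim _ _
      exact ⟨⟨x, hx⟩, e2 ▸ hP (mem_zpowers _), rfl⟩
  · rw [← subgroupOf_eq_top, ← Subgroup.index_eq_one]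
    by_contra hne
    obtain ⟨r, hr, hrd⟩ := Nat.exists_prime_and_dvd hne
    have := Fact.mk hr
    have hn := hsyl r this default
    have hD : D r = ((default : Sylow r N) : Subgroup N).map N.subtype := dif_pos hr
    have h1 := hH r hr (hrd.trans (index_dvd_card _))
    rw [hD, map_le_iff_le_comap] at h1
    exact (default : Sylow r N).not_dvd_index (hrd.trans (index_dvd_of_le h1))

end CentralChief

theorem L_sup_eq_bot (c : ℕ) : ∀ {Γ : Type} [Group Γ] [Finite Γ], Sol (⊤ : Subgroup Γ) →
    ∀ {N₁ N₂ : Subgroup Γ} [N₁.Normal] [N₂.Normal], L N₁ c = ⊥ → L N₂ c = ⊥ →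
    L (N₁ ⊔ N₂) c = ⊥ := by
  induction c with
  | zero =>
    intro Γ _ _ _ N₁ N₂ _ _ h₁ h₂
    rw [L_zero] at *
    rw [h₁, h₂, sup_bot_eq]
  | succ c ih =>
    intro Γ _ _ hΓ N₁ N₂ _ _ h₁ h₂
    let R := L N₁ c ⊔ L N₂ c
    let f := QuotientGroup.mk' R
    have hf : Function.Surjective f := QuotientGroup.mk'_surjective R
    have hk : f.ker = R := QuotientGroup.ker_mk' R
    have hn₁ : (N₁.map f).Normal := Normal.map inferInstance f hf
    have hn₂ : (N₂.map f).Normal := Normal.map inferInstance f hf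
    have hR : res R = ⊥ := res_sup_eq_bot hΓ h₁ h₂
    have htop : Sol (⊤ : Subgroup (Γ ⧸ R)) := by
      have := hΓ.map f
      rwa [map_top_of_surjective f hf] at this
    have h3 : L ((N₁ ⊔ N₂).map f) c = ⊥ := by
      rw [Subgroup.map_sup]
      refine ih htop ?_ ?_
      · rw [← L_le_ker, hk]; exact le_sup_left
      · rw [← L_le_ker, hk]; exact le_sup_right
    rw [← L_le_ker, hk] at h3
    exact le_bot_iff.1 (hR ▸ res_mono h3)

end FittingBound

namespace FittingBound

open Subgroup Module
open scoped commutatorElement Nat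

section PrimeOrder

variable {Γ : Type} [Group Γ] [Finite Γ] {G : Subgroup Γ} {a : Γ} {q : ℕ}

theorem Setup.L_eq_bot_of_fixedIn_eq_bot (h : Setup G a q) (hfix : fixedIn G a = ⊥) :
    L G (fpfBound q + 1) = ⊥ := by
  have hG := h.normal
  have hle : G ≤ ⁅G, zpowers a⁆ := fun g hg => by
    obtain ⟨k, hk, y, hy, rfl⟩ := h.exists_fixed_mul hg
    rw [hfix, mem_bot] at hk
    rwa [hk, one_mul]
  refine eq_bot_of_central (N := L G (fpfBound q)) (h.sol.mono (L_le _ _)) (commutator_res _).ge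
    fun A B hAB hB => ?_
  have hBG : B ≤ G := hB.trans (L_le _ _)
  obtain ⟨t, ht, htd, htp, k, _, _, _, X, _, _, _, ρ, j, hρ⟩ :=
    hAB.exists_chiefRep (hAB.comm_le (h.sol.mono hBG))
  have hqk : (q : k) ≠ 0 := h.cast_ne_zero hBG ht htd
  refine hρ.commutator_le hAB.normal_right ((L_mono hle _).trans
    (L_comm_le_ker q _ h hρ.irr hqk (fun v hv => ?_) le_rfl))
  have h1 := hρ.fixed_mem_span hAB.normal_left hAB.normal_right hAB.lt.le h.prime h.pow
    (not_dvd_card_of_le h.cop (hAB.lt.le.trans hBG)) hqk hv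
  have h2 : Submodule.span k (j '' {x | x ∈ B ∧ a * x = x * a}) ≤ ⊥ := by
    rw [Submodule.span_le]
    rintro _ ⟨x, ⟨hx, hax⟩, rfl⟩
    have h3 : x ∈ fixedIn G a := mem_fixedIn.2 ⟨hBG hx, hax⟩
    rw [hfix, mem_bot] at h3
    rw [h3, hρ.map_one]
    exact Submodule.zero_mem _
  exact h2 h1

theorem WData.L_eq_bot {D : Subgroup Γ} {r : ℕ} (hw : WData G a q D r) :
    L (normalClosure (D : Set Γ)) (wBound' q + 2) = ⊥ := by
  have hle := hw.closure_le
  rw [← add_assoc (wBound' q) 1 1, L_succ]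
  refine res_eq_bot_of_prime (N := L (normalClosure (D : Set Γ)) (wBound' q))
    (hw.setup.sol.mono ((L_le _ _).trans hle)) (commutator_res _).ge hw.prime
    fun A B hAB hB t ht htp htr => ?_
  have hBG : B ≤ G := hB.trans ((L_le _ _).trans hle)
  obtain ⟨t', ht', htd', htp', k, _, _, _, X, _, _, _, ρ, j, hρ⟩ :=
    hAB.exists_chiefRep (hAB.comm_le (hw.setup.sol.mono hBG))
  have hqk : (q : k) ≠ 0 := hw.setup.cast_ne_zero hBG ht' htd'
  refine hρ.commutator_le hAB.normal_right (wStmt q (fun hf => hf.elim) hw hρ.irr hqk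
    fun d hd v hv => hρ.fix_of_fixed hAB hw.setup hBG hqk (fun x hx hax => ?_) hv)
  have h1 := hw.commutator_mem hd (mem_fixedIn.2 ⟨hBG hx, hax⟩)
  obtain ⟨e, he⟩ := hw.tor _ h1
  refine mem_of_pow_mem_coprime (htp _ (commutatorElement_mem_right hAB.normal_right d hx))
    (he ▸ A.one_mem) (Nat.Coprime.pow_right _ ((Nat.coprime_primes ht hw.prime).2 htr))

theorem fixedIn_conj_L {c x : Γ} (hc : c ∈ fixedIn G a) (n : ℕ) (hx : x ∈ L (fixedIn G a) n) :
    c * x * c⁻¹ ∈ L (fixedIn G a) n := by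
  have h1 : (fixedIn G a).map (MulAut.conj c).toMonoidHom ≤ fixedIn G a := by
    rintro _ ⟨y, hy, rfl⟩
    exact mul_mem (mul_mem hc hy) (inv_mem hc)
  have h2 := mem_map_of_mem (MulAut.conj c).toMonoidHom hx
  rw [map_L] at h2
  exact L_mono h1 n h2

theorem Setup.exists_normal (h : Setup G a q) {k : ℕ} (hk : L (fixedIn G a) (k + 1) = ⊥) :
    ∃ M : Subgroup Γ, M.Normal ∧ M ≤ G ∧ L (fixedIn G a) k ≤ M ∧ L M (wBound' q + 2) = ⊥ := by
  classical
  have hG := h.normal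
  have hNG : L (fixedIn G a) k ≤ G := (L_le _ _).trans (fixedIn_le G a)
  obtain ⟨D, hD, hgen⟩ := exists_primary (N := L (fixedIn G a) k) hk
  have hw : ∀ r : ℕ, r.Prime → r ∣ Nat.card (L (fixedIn G a) k) → WData G a q (D r) r := by
    intro r hr hrd
    refine ⟨h, hr, ?_, fun d hd => L_le _ _ ((hD r hr d).1 hd).1, fun c hc d hd => ?_,
      fun d hd => ((hD r hr d).1 hd).2⟩
    · rintro rfl
      exact not_dvd_card_of_le h.cop hNG hrd
    · obtain ⟨h1, e, he⟩ := (hD r hr d).1 hd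
      exact (hD r hr _).2 ⟨fixedIn_conj_L hc k h1, e, by rw [conj_pow, he, mul_one, mul_inv_cancel]⟩
  have key : ∀ s : Finset ℕ, (∀ r ∈ s, r.Prime ∧ r ∣ Nat.card (L (fixedIn G a) k)) →
      ∃ M : Subgroup Γ, M.Normal ∧ M ≤ G ∧ (∀ r ∈ s, D r ≤ M) ∧ L M (wBound' q + 2) = ⊥ := by
    intro s
    induction s using Finset.induction_on with
    | empty =>
      exact fun _ => ⟨⊥, inferInstance, bot_le, fun r hr => absurd hr (Finset.notMem_empty r),
        le_bot_iff.1 (L_le _ _)⟩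
    | insert r s _ ih =>
      intro hs
      obtain ⟨M, hM1, hM2, hM3, hM4⟩ := ih fun r hr => hs r (Finset.mem_insert_of_mem hr)
      obtain ⟨hr, hrd⟩ := hs r (Finset.mem_insert_self r s)
      refine ⟨M ⊔ normalClosure (D r : Set Γ), inferInstance, sup_le hM2 (hw r hr hrd).closure_le,
        fun r' hr' => ?_, L_sup_eq_bot _ h.sol_top hM4 (hw r hr hrd).L_eq_bot⟩
      rcases Finset.mem_insert.1 hr' with rfl | hr'
      · exact le_normalClosure.trans le_sup_right
      · exact (hM3 r' hr').trans le_sup_left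
  obtain ⟨M, hM1, hM2, hM3, hM4⟩ := key (Nat.card (L (fixedIn G a) k)).primeFactors fun r hr =>
    ⟨Nat.prime_of_mem_primeFactors hr, Nat.dvd_of_mem_primeFactors hr⟩
  exact ⟨M, hM1, hM2, hgen M fun r hr hrd =>
    hM3 r (Nat.mem_primeFactors.2 ⟨hr, hrd, Nat.card_pos.ne'⟩), hM4⟩

end PrimeOrder

/-- The height bound for a coprime automorphism of prime order `q` whose centralizer has lower
nilpotent series of length `k`. -/
def tBound (q k : ℕ) : ℕ := fpfBound q + 1 + k * (wBound' q + 2)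

theorem Setup.L_eq_bot (q k : ℕ) : ∀ {Γ : Type} [Group Γ] [Finite Γ] {G : Subgroup Γ} {a : Γ},
    Setup G a q → L (fixedIn G a) k = ⊥ → L G (tBound q k) = ⊥ := by
  induction k with
  | zero =>
    intro Γ _ _ G a h hk
    rw [tBound, zero_mul, add_zero]
    exact h.L_eq_bot_of_fixedIn_eq_bot hk
  | succ k ih =>
    intro Γ _ _ G a h hk
    obtain ⟨M, hMn, hMG, hkM, hM⟩ := h.exists_normal hk
    let f := QuotientGroup.mk' M
    have hf : Function.Surjective f := QuotientGroup.mk'_surjective M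
    have hker : f.ker = M := QuotientGroup.ker_mk' M
    have h1 : fixedIn (G.map f) (f a) ≤ (fixedIn G a).map f := by
      intro y hy
      obtain ⟨⟨x, hx, rfl⟩, hax⟩ := mem_fixedIn.1 hy
      obtain ⟨m, hm, hm2⟩ := exists_fixed_of_coset (H := M) (x := x) h.prime h.pow
        (fun m hm => hMn.conj_mem m hm a) (not_dvd_card_of_le h.cop hMG) (by
          rw [← hker, MonoidHom.mem_ker, map_mul, map_mul, map_mul, hax, map_inv, map_inv]
          group)
      refine ⟨x * m, mem_fixedIn.2 ⟨mul_mem hx (hMG hm), hm2⟩, ?_⟩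
      rw [map_mul, show f m = 1 from MonoidHom.mem_ker.1 (hker.symm ▸ hm), mul_one]
    have h2 : L (fixedIn (G.map f) (f a)) k = ⊥ := by
      refine le_bot_iff.1 ((L_mono h1 k).trans ?_)
      rw [L_le_ker.1 (hker.symm ▸ hkM)]
    have h3 := ih (h.map hf) h2
    rw [← L_le_ker, hker] at h3
    rw [show tBound q (k + 1) = tBound q k + (wBound' q + 2) by unfold tBound; ring, L_add]
    exact le_bot_iff.1 (hM ▸ L_mono h3 _)

end FittingBound

namespace FittingBound

open Subgroup Module
open scoped commutatorElement

section Aut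

variable {G : Type} [Group G]

/-- The subgroup of fixed points of an automorphism. -/
def fixSub (φ : MulAut G) : Subgroup G where
  carrier := {g | φ g = g}
  one_mem' := map_one φ
  mul_mem' := fun {x y} hx hy => by
    change φ (x * y) = x * y
    rw [map_mul, show φ x = x from hx, show φ y = y from hy]
  inv_mem' := fun {x} hx => by
    change φ x⁻¹ = x⁻¹
    rw [map_inv, show φ x = x from hx]

theorem mem_fixSub {φ : MulAut G} {g : G} : g ∈ fixSub φ ↔ φ g = g := Iff.rfl

/-- The restriction of an automorphism to an invariant subgroup. -/
def restrictAut (φ : MulAut G) (H : Subgroup G) (h : ∀ x, φ x ∈ H ↔ x ∈ H) : MulAut H where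
  toFun x := ⟨φ x, (h x).2 x.2⟩
  invFun x := ⟨φ.symm x, (h _).1 (by rw [MulEquiv.apply_symm_apply]; exact x.2)⟩
  left_inv x := Subtype.ext (φ.symm_apply_apply x)
  right_inv x := Subtype.ext (φ.apply_symm_apply x)
  map_mul' x y := Subtype.ext (map_mul φ (x : G) y)

theorem restrictAut_apply (φ : MulAut G) (H : Subgroup G) (h : ∀ x, φ x ∈ H ↔ x ∈ H) (x : H) :
    (restrictAut φ H h x : G) = φ x := rfl

theorem restrictAut_pow_apply (φ : MulAut G) (H : Subgroup G) (h : ∀ x, φ x ∈ H ↔ x ∈ H) (n : ℕ)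
    (x : H) : ((restrictAut φ H h ^ n) x : G) = (φ ^ n) x := by
  induction n with
  | zero => rfl
  | succ n ih => rw [pow_succ', pow_succ', MulAut.mul_apply, MulAut.mul_apply, restrictAut_apply, ih]

theorem map_fixSub_restrictAut (φ : MulAut G) (H : Subgroup G) (h : ∀ x, φ x ∈ H ↔ x ∈ H) :
    (fixSub (restrictAut φ H h)).map H.subtype ≤ fixSub φ := by
  rintro _ ⟨x, hx, rfl⟩
  exact congrArg Subtype.val hx

theorem L_fixSub_restrictAut [Finite G] {φ : MulAut G} {H : Subgroup G}
    {h : ∀ x, φ x ∈ H ↔ x ∈ H} {k : ℕ} (hk : L (fixSub φ) k = ⊥) :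
    L (fixSub (restrictAut φ H h)) k = ⊥ := by
  rw [← map_eq_bot_iff_of_injective _ H.subtype_injective, map_L]
  exact le_bot_iff.1 (hk ▸ L_mono (map_fixSub_restrictAut φ H h) k)

theorem L_top_subgroup [Finite G] {H : Subgroup G} {n : ℕ} (h : L (⊤ : Subgroup H) n = ⊥) :
    L H n = ⊥ := by
  have h1 := map_L H.subtype ⊤ n
  rw [h, Subgroup.map_bot, ← MonoidHom.range_eq_map, range_subtype] at h1
  exact h1.symm

theorem apply_mem_fixSub_pow (φ : MulAut G) (n : ℕ) (x : G) :
    φ x ∈ fixSub (φ ^ n) ↔ x ∈ fixSub (φ ^ n) := by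
  rw [mem_fixSub, mem_fixSub, ← MulAut.mul_apply, ← pow_succ, pow_succ', MulAut.mul_apply,
    φ.injective.eq_iff]

/-- The semidirect product of a group by a cyclic group of automorphisms. -/
abbrev Semi (φ : MulAut G) : Type := G ⋊[(zpowers φ).subtype] (zpowers φ)

/-- The element of the semidirect product inducing the automorphism. -/
def semiGen (φ : MulAut G) : Semi φ := SemidirectProduct.inr ⟨φ, mem_zpowers φ⟩

/-- The embedding of the group in the semidirect product. -/
abbrev semiInl (φ : MulAut G) : G →* Semi φ := SemidirectProduct.inl

instance [Finite G] (φ : MulAut G) : Finite (Semi φ) :=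
  Finite.of_equiv _ SemidirectProduct.equivProd.symm

theorem semiGen_conj (φ : MulAut G) (g : G) :
    semiGen φ * semiInl φ g * (semiGen φ)⁻¹ = semiInl φ (φ g) := by
  rw [semiGen, ← map_inv]
  exact (SemidirectProduct.inl_aut (φ := (zpowers φ).subtype) ⟨φ, mem_zpowers φ⟩ g).symm

theorem semiInl_injective (φ : MulAut G) : Function.Injective (semiInl φ) :=
  SemidirectProduct.inl_injective

theorem semiGen_pow {φ : MulAut G} {n : ℕ} (h : φ ^ n = 1) : semiGen φ ^ n = 1 := by
  rw [semiGen, ← map_pow, show (⟨φ, mem_zpowers φ⟩ : zpowers φ) ^ n = 1 from Subtype.ext h, map_one]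

instance semi_normal (φ : MulAut G) : (semiInl φ).range.Normal := by
  rw [SemidirectProduct.range_inl_eq_ker_rightHom]
  infer_instance

theorem semi_sup (φ : MulAut G) : (semiInl φ).range ⊔ zpowers (semiGen φ) = ⊤ := by
  rw [eq_top_iff]
  rintro x -
  rw [← SemidirectProduct.inl_left_mul_inr_right x]
  refine mul_mem (mem_sup_left ⟨x.left, rfl⟩) (mem_sup_right ?_)
  obtain ⟨i, hi⟩ := mem_zpowers_iff.1 x.right.2
  refine mem_zpowers_iff.2 ⟨i, ?_⟩
  rw [semiGen, ← map_zpow]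
  exact congrArg _ (Subtype.ext hi)

theorem semi_sol (φ : MulAut G) (h : Sol (⊤ : Subgroup G)) : Sol (semiInl φ).range := by
  rw [MonoidHom.range_eq_map]
  exact h.map _

theorem fixedIn_semi (φ : MulAut G) :
    fixedIn (semiInl φ).range (semiGen φ) = (fixSub φ).map (semiInl φ) := by
  ext x
  rw [mem_fixedIn]
  constructor
  · rintro ⟨⟨g, rfl⟩, hg⟩
    refine ⟨g, semiInl_injective φ ?_, rfl⟩
    rw [← semiGen_conj, hg, mul_inv_cancel_right]
  · rintro ⟨g, hg, rfl⟩
    refine ⟨⟨g, rfl⟩, ?_⟩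
    rw [← mul_inv_eq_iff_eq_mul, semiGen_conj, show φ g = g from hg]

theorem L_top_of_semi [Finite G] {φ : MulAut G} {n : ℕ} (h : L (semiInl φ).range n = ⊥) :
    L (⊤ : Subgroup G) n = ⊥ := by
  rwa [MonoidHom.range_eq_map, ← map_L, map_eq_bot_iff_of_injective _ (semiInl_injective φ)] at h

theorem exists_bound_of_coprime (s : ℕ) : ∀ k : ℕ, ∃ n : ℕ, ∀ (G : Type) [Group G] [Finite G]
    (φ : MulAut G), Sol (⊤ : Subgroup G) → φ ^ s = 1 → s.Coprime (Nat.card G) →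
    L (fixSub φ) k = ⊥ → L (⊤ : Subgroup G) n = ⊥ := by
  induction s using induction_on_primes with
  | zero =>
    intro k
    refine ⟨0, fun G _ _ φ hG _ hs _ => ?_⟩
    rw [Nat.coprime_zero_left] at hs
    rw [L_zero, ← Subgroup.card_eq_one, Subgroup.card_top, hs]
  | one =>
    intro k
    refine ⟨k, fun G _ _ φ hG hφ _ hk => ?_⟩
    rw [pow_one] at hφ
    have : fixSub φ = ⊤ := eq_top_iff.2 fun x _ => by rw [mem_fixSub, hφ]; rfl
    rwa [this] at hk
  | prime_mul q s hq ih =>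
    intro k
    obtain ⟨n, hn⟩ := ih k
    refine ⟨tBound q n, fun G _ _ φ hG hφ hs hk => ?_⟩
    let H := fixSub (φ ^ s)
    let φ' := restrictAut φ H (apply_mem_fixSub_pow φ s)
    have h1 : L (⊤ : Subgroup H) n = ⊥ := by
      refine hn H φ' ?_ ?_ ?_ (L_fixSub_restrictAut hk)
      · have := hG.subgroupOf H
        rwa [top_subgroupOf] at this
      · ext x
        rw [restrictAut_pow_apply]
        exact x.2
      · exact (hs.coprime_dvd_left (dvd_mul_left s q)).coprime_dvd_right (card_subgroup_dvd_card H)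
    have h2 : Setup (semiInl (φ ^ s)).range (semiGen (φ ^ s)) q := by
      refine ⟨inferInstance, semi_sol _ hG, hq, semiGen_pow ?_, semi_sup _, ?_⟩
      · rw [← pow_mul, mul_comm, hφ]
      · rw [← Nat.card_congr (MonoidHom.ofInjective (semiInl_injective (φ ^ s))).toEquiv,
          ← Nat.Prime.coprime_iff_not_dvd hq]
        exact hs.coprime_dvd_left (dvd_mul_right q s)
    refine L_top_of_semi (Setup.L_eq_bot q n h2 ?_)
    rw [fixedIn_semi, ← map_L, L_top_subgroup h1, Subgroup.map_bot]

end Aut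

end FittingBound

namespace FittingBound

open Subgroup Module
open scoped commutatorElement Nat

section PPart

theorem card_le_mul_of_fiber {α β : Type*} [Finite α] [Finite β] (f : α → β) {m : ℕ}
    (h : ∀ x₀, Nat.card {x // f x = f x₀} ≤ m) : Nat.card α ≤ m * Nat.card β := by
  classical
  have := Fintype.ofFinite α
  have := Fintype.ofFinite β
  rw [Nat.card_eq_fintype_card, Nat.card_eq_fintype_card]
  refine (Finset.card_le_mul_card_image (f := f) Finset.univ m ?_).trans
    (Nat.mul_le_mul_left m (Finset.card_le_univ _))
  intro y hy
  obtain ⟨x₀, -, rfl⟩ := Finset.mem_image.1 hy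
  have h1 := h x₀
  rwa [Nat.card_eq_fintype_card, Fintype.card_subtype] at h1

theorem card_le_pow_of_unipotent {V : Type} [AddCommGroup V] [Finite V] {p e m : ℕ}
    (hp : p.Prime) (hV : ∀ v : V, p • v = 0) {c : AddMonoid.End V} (hc : c ^ p ^ e = 1)
    (hm : Nat.card {v // c v = v} ≤ m) : Nat.card V ≤ m ^ p ^ e := by
  rcases subsingleton_or_nontrivial V with hs | hn
  · rw [Nat.card_of_subsingleton (0 : V)]
    have : 0 < Nat.card {v // c v = v} :=
      haveI : Nonempty {v // c v = v} := ⟨0, map_zero c⟩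
      Nat.card_pos
    exact Nat.one_le_pow _ _ (this.trans_le hm)
  have hpe : (p : AddMonoid.End V) = 0 := by
    ext v
    rw [AddMonoid.End.natCast_apply, hV]
    rfl
  have := Fact.mk hp
  have hnt : Nontrivial (AddMonoid.End V) := by
    obtain ⟨v, hv⟩ := exists_ne (0 : V)
    exact ⟨1, 0, fun h => hv (DFunLike.congr_fun h v)⟩
  have hchar : CharP (AddMonoid.End V) p := (CharP.charP_iff_prime_eq_zero hp).2 hpe
  have hδ : (c - 1) ^ p ^ e = 0 := by
    rw [sub_pow_char_pow_of_commute (p := p) _ (Commute.one_right c), hc, one_pow, sub_self]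
  have key : ∀ i : ℕ, Nat.card {v // ((c - 1) ^ i) v = 0} ≤ m ^ i := by
    intro i
    induction i with
    | zero =>
      have : Subsingleton {v : V // ((c - 1) ^ 0 : AddMonoid.End V) v = 0} :=
        ⟨fun x y => Subtype.ext ((show (x : V) = 0 from x.2).trans (show (y : V) = 0 from y.2).symm)⟩
      rw [pow_zero]
      exact Finite.card_le_one_iff_subsingleton.2 this
    | succ i ih =>
      let f : {v // ((c - 1) ^ (i + 1)) v = 0} → {v // ((c - 1) ^ i) v = 0} := fun v =>
        ⟨(c - 1) v, (DFunLike.congr_fun (pow_succ (c - 1) i) v.1).symm.trans v.2⟩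
      refine (card_le_mul_of_fiber f fun x₀ => ?_).trans
        ((Nat.mul_le_mul_left m ih).trans (by rw [pow_succ']))
      refine le_trans (Nat.card_le_card_of_injective
        (fun x => (⟨x.1.1 - x₀.1, ?_⟩ : {v // c v = v})) fun x y hxy => ?_) hm
      · have h1 : (c - 1) x.1.1 = (c - 1) x₀.1 := congrArg Subtype.val x.2
        have h2 : c x.1.1 - x.1.1 = c x₀.1 - x₀.1 := h1
        rw [map_sub, ← sub_eq_zero, sub_sub_sub_comm, h2, sub_self]
      · exact Subtype.ext (Subtype.ext (sub_left_injective (congrArg Subtype.val hxy)))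
  refine le_trans (le_of_eq ?_) (key (p ^ e))
  exact Nat.card_congr (Equiv.subtypeUnivEquiv fun v => by rw [hδ]; rfl).symm

variable {Γ : Type} [Group Γ] [Finite Γ]

theorem card_fixed_map_le {A B : Subgroup Γ} (hAB : A ≤ B) (a : Γ)
    {m : ℕ} (hm : Nat.card (fixedIn B a) ≤ m) {Δ : Type} [Group Δ] [Finite Δ] (f : Γ →* Δ)
    (hf : f.ker = A) : Nat.card (fixedIn (B.map f) (f a)) ≤ m := by
  let B' : Subgroup Γ := B ⊓ (fixedIn (B.map f) (f a)).comap f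
  have hAB' : A ≤ B' := fun x hx => ⟨hAB hx, by
    change f x ∈ fixedIn (B.map f) (f a)
    rw [show f x = 1 from MonoidHom.mem_ker.1 (hf.symm ▸ hx)]
    exact one_mem _⟩
  have hmap : fixedIn (B.map f) (f a) ≤ B'.map f := by
    intro y hy
    obtain ⟨x, hx, rfl⟩ := (mem_fixedIn.1 hy).1
    exact ⟨x, ⟨hx, hy⟩, rfl⟩
  let g : B' → A := fun x => ⟨⁅a, (x : Γ)⁆, by
    rw [← hf, MonoidHom.mem_ker, map_commutatorElement, commutatorElement_eq_one_iff_mul_comm]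
    exact (mem_fixedIn.1 x.2.2).2⟩
  have h1 : Nat.card B' ≤ m * Nat.card A := by
    refine card_le_mul_of_fiber g fun x₀ => le_trans (Nat.card_le_card_of_injective
      (fun x => (⟨(x₀ : Γ)⁻¹ * x.1.1, ?_⟩ : fixedIn B a)) fun x y hxy => ?_) hm
    · refine mem_fixedIn.2 ⟨mul_mem (inv_mem x₀.2.1) x.1.2.1, ?_⟩
      have h2 : ⁅a, (x.1 : Γ)⁆ = ⁅a, (x₀ : Γ)⁆ := congrArg Subtype.val x.2
      have h3 : (x.1 : Γ) * a * (x.1 : Γ)⁻¹ = x₀ * a * (x₀ : Γ)⁻¹ := by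
        rw [commutatorElement_def, commutatorElement_def, mul_assoc, mul_assoc, mul_assoc,
          mul_assoc, mul_left_cancel_iff] at h2
        have h4 := congrArg (·⁻¹) h2
        simpa [mul_assoc] using h4
      have h4 : (x₀ : Γ)⁻¹ * x.1 * a = (x₀ : Γ)⁻¹ * ((x.1 : Γ) * a * (x.1 : Γ)⁻¹) * x.1 := by group
      rw [h4, h3]
      group
    · exact Subtype.ext (Subtype.ext (mul_left_cancel (congrArg Subtype.val hxy)))
  have h2 : Nat.card (B'.map f) * Nat.card A = Nat.card B' := by
    rw [← relIndex_ker, hf, ← relIndex_bot_left, ← relIndex_bot_left, mul_comm,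
      relIndex_mul_relIndex ⊥ A B' bot_le hAB']
  refine (Subgroup.card_le_of_le hmap).trans (Nat.le_of_mul_le_mul_right (h2.trans_le h1)
    Nat.card_pos)

theorem IsChief.card_map_le {A B : Subgroup Γ} (h : IsChief A B) (hc : ⁅B, B⁆ ≤ A) {p e m : ℕ}
    (hp : p.Prime) (hBp : ∀ x ∈ B, x ^ p ∈ A) {a : Γ} (ha : a ^ p ^ e = 1)
    (hm : Nat.card (fixedIn B a) ≤ m) {Δ : Type} [Group Δ] [Finite Δ] (f : Γ →* Δ)
    (hf : f.ker = A) (hB : (B.map f).Normal) : Nat.card (B.map f) ≤ m ^ p ^ e := by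
  have hA := h.normal_left
  have hBn := h.normal_right
  have hker : ∀ x, f x = 1 ↔ x ∈ A := fun x => by rw [← hf, MonoidHom.mem_ker]
  have hcomm : ∀ x y : B.map f, x * y = y * x := by
    rintro ⟨_, x, hx, rfl⟩ ⟨_, y, hy, rfl⟩
    refine Subtype.ext ?_
    change f x * f y = f y * f x
    rw [← commutatorElement_eq_one_iff_mul_comm, ← map_commutatorElement, hker]
    exact hc (commutator_mem_commutator hx hy)
  let _ : CommGroup (B.map f) := { (inferInstance : Group (B.map f)) with mul_comm := hcomm }
  let c : AddMonoid.End (Additive (B.map f)) :=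
    MonoidHom.toAdditive (MulAut.conjNormal (H := B.map f) (f a)).toMonoidHom
  have hcp : ∀ (n : ℕ) (v : B.map f), (c ^ n) (Additive.ofMul v) =
      Additive.ofMul (MulAut.conjNormal (H := B.map f) (f a ^ n) v) := by
    intro n v
    induction n with
    | zero => simp
    | succ n ih =>
      rw [pow_succ', pow_succ', map_mul, MulAut.mul_apply]
      change c ((c ^ n) (Additive.ofMul v)) = _
      rw [ih]
      rfl
  refine card_le_pow_of_unipotent (V := Additive (B.map f)) (c := c) hp ?_ ?_ ?_
  · rintro ⟨_, x, hx, rfl⟩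
    refine congrArg Additive.ofMul (Subtype.ext ?_)
    change f x ^ p = 1
    rw [← map_pow, hker]
    exact hBp x hx
  · ext v
    have h1 := hcp (p ^ e) v.toMul
    rw [← map_pow, ha, map_one, map_one] at h1
    exact congrArg (fun w : Additive (B.map f) => (w.toMul : Δ)) h1
  · refine le_trans (le_of_eq ?_) (card_fixed_map_le h.lt.le a hm f hf)
    refine Nat.card_congr
      { toFun := fun v => ⟨(v.1.toMul : Δ), mem_fixedIn.2 ⟨v.1.toMul.2, ?_⟩⟩
        invFun := fun y => ⟨Additive.ofMul ⟨y.1, (mem_fixedIn.1 y.2).1⟩,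
          congrArg Additive.ofMul (Subtype.ext ?_)⟩
        left_inv := fun _ => rfl
        right_inv := fun _ => rfl }
    · have h1 : f a * (v.1.toMul : Δ) * (f a)⁻¹ = (v.1.toMul : Δ) :=
        congrArg (fun w : Additive (B.map f) => (w.toMul : Δ)) v.2
      rwa [mul_inv_eq_iff_eq_mul] at h1
    · change f a * y.1 * (f a)⁻¹ = y.1
      rw [(mem_fixedIn.1 y.2).2, mul_inv_cancel_right]

theorem IsChief.commutator_L_le {A B G : Subgroup Γ} (h : IsChief A B) (hG : Sol G) (hBG : B ≤ G)
    {p e m : ℕ} (hp : p.Prime) (hBp : ∀ x ∈ B, x ^ p ∈ A) {a : Γ} (ha : a ^ p ^ e = 1)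
    (hm : Nat.card (fixedIn G a) ≤ m) : ⁅B, L G (m ^ p ^ e)!⁆ ≤ A := by
  have hA := h.normal_left
  have hBn := h.normal_right
  let f := QuotientGroup.mk' A
  have hf : Function.Surjective f := QuotientGroup.mk'_surjective A
  have hker : f.ker = A := QuotientGroup.ker_mk' A
  have hBf : (B.map f).Normal := hBn.map f hf
  have h1 : fixedIn B a ≤ fixedIn G a := inf_le_inf_right _ hBG
  have h2 := h.card_map_le (h.comm_le (hG.mono hBG)) hp hBp ha
    ((Subgroup.card_le_of_le h1).trans hm) f hker hBf
  have h3 : Nat.card (MulAut (B.map f)) ≤ (m ^ p ^ e)! := by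
    refine le_trans (Nat.card_le_card_of_injective
      (fun θ : MulAut (B.map f) => (θ.toEquiv : Equiv.Perm (B.map f)))
      fun _ _ h => MulEquiv.toEquiv_injective h) ?_
    rw [Nat.card_perm]
    exact Nat.factorial_le h2
  have h4 := L_le_ker_of_card_le ((MulAut.conjNormal (H := B.map f)).comp f) hG h3
  rw [commutator_comm, Subgroup.commutator_le]
  intro g hg x hx
  have h5 : MulAut.conjNormal (H := B.map f) (f g) = 1 := h4 hg
  have h6 : f g * f x * (f g)⁻¹ = f x :=
    congrArg Subtype.val (DFunLike.congr_fun h5 (⟨f x, mem_map_of_mem f hx⟩ : B.map f))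
  rw [← hker, MonoidHom.mem_ker, map_commutatorElement, commutatorElement_def, h6, mul_inv_cancel]

end PPart

section PPartAut

theorem exists_bound_of_prime_power {p : ℕ} (hp : p.Prime) (e m : ℕ) : ∃ n : ℕ, ∀ (K : Type)
    [Group K] [Finite K] (ψ : MulAut K), Sol (⊤ : Subgroup K) → ψ ^ p ^ e = 1 →
    Nat.card (fixSub ψ) ≤ m → L (⊤ : Subgroup K) n = ⊥ := by
  obtain ⟨n, hn⟩ := exists_bound_of_coprime (p ^ e) m
  refine ⟨(m ^ p ^ e)! + 1 + n, fun K _ _ ψ hK hψ hm => ?_⟩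
  set j := (m ^ p ^ e)! with hj
  have hsol := semi_sol ψ hK
  have hcard : Nat.card (fixedIn (semiInl ψ).range (semiGen ψ)) ≤ m := by
    rw [fixedIn_semi]
    exact (Nat.card_congr ((fixSub ψ).equivMapOfInjective _ (semiInl_injective ψ)).toEquiv).ge.trans hm
  have h1 : ¬ p ∣ Nat.card (L (semiInl ψ).range (j + 1)) := fun hd =>
    dvd_card_imp_of_central (N := L (semiInl ψ).range j) (hsol.mono (L_le _ _))
      (commutator_res _).ge (fun t => t ≠ p) (fun A B hAB hB t ht hBt htp =>
        hAB.commutator_L_le hsol (hB.trans (L_le _ _)) hp (not_not.1 htp ▸ hBt) (semiGen_pow hψ)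
          hcard) hp hd rfl
  rw [MonoidHom.range_eq_map, ← map_L,
    ← Nat.card_congr ((L ⊤ (j + 1)).equivMapOfInjective _ (semiInl_injective ψ)).toEquiv] at h1
  have hinv : ∀ x, ψ x ∈ L (⊤ : Subgroup K) (j + 1) ↔ x ∈ L (⊤ : Subgroup K) (j + 1) := by
    intro x
    have h2 : (L (⊤ : Subgroup K) (j + 1)).map ψ.toMonoidHom = L ⊤ (j + 1) := by
      rw [map_L, map_top_of_surjective _ ψ.surjective]
    conv_lhs => rw [← h2]
    exact mem_map_iff_mem ψ.injective
  rw [L_add]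
  refine L_top_subgroup (hn _ (restrictAut ψ _ hinv) ?_ ?_ ?_ (L_fixSub_restrictAut ?_))
  · have := hK.subgroupOf (L ⊤ (j + 1))
    rwa [top_subgroupOf] at this
  · ext x
    rw [restrictAut_pow_apply, hψ]
    rfl
  · exact Nat.Coprime.pow_left _ ((Nat.Prime.coprime_iff_not_dvd hp).2 h1)
  · exact L_eq_bot_of_card_le (hK.mono le_top) hm

theorem exists_bound (n m p : ℕ) : ∃ N : ℕ, ∀ (G : Type) [Group G] [Finite G] (ψ : MulAut G),
    Sol (⊤ : Subgroup G) → n ≠ 0 → ψ ^ n = 1 →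
    (∀ r : ℕ, r.Prime → r ∣ n → r ∣ Nat.card G → r = p) → Nat.card (fixSub ψ) ≤ m →
    L (⊤ : Subgroup G) N = ⊥ := by
  by_cases hp : p.Prime
  · rcases eq_or_ne n 0 with rfl | hn0
    · exact ⟨0, fun _ _ _ _ _ h => absurd rfl h⟩
    obtain ⟨e, s, hs, rfl⟩ := Nat.exists_eq_pow_mul_and_not_dvd hn0 p hp.ne_one
    obtain ⟨k, hk⟩ := exists_bound_of_prime_power hp e m
    obtain ⟨N, hN⟩ := exists_bound_of_coprime s k
    refine ⟨N, fun G _ _ ψ hG _ hψ hr hm => ?_⟩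
    refine hN G (ψ ^ p ^ e) hG (by rw [← pow_mul, hψ]) ?_ (L_top_subgroup ?_)
    · refine Nat.coprime_of_dvd fun r hr1 hrs hrG => hs ?_
      rwa [← hr r hr1 (hrs.trans (dvd_mul_left _ _)) hrG]
    · refine hk _ (restrictAut ψ _ (apply_mem_fixSub_pow ψ (p ^ e))) ?_ ?_ ?_
      · have := hG.subgroupOf (fixSub (ψ ^ p ^ e))
        rwa [top_subgroupOf] at this
      · ext x
        rw [restrictAut_pow_apply]
        exact x.2
      · refine le_trans ?_ hm
        rw [Nat.card_congr (equivMapOfInjective _ _ (subtype_injective _)).toEquiv]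
        exact Subgroup.card_le_of_le (map_fixSub_restrictAut ψ _ _)
  · obtain ⟨N, hN⟩ := exists_bound_of_coprime n m
    refine ⟨N, fun G _ _ ψ hG _ hψ hr hm => hN G ψ hG hψ ?_ ?_⟩
    · exact Nat.coprime_of_dvd fun r hr1 hrs hrG => hp (hr r hr1 hrs hrG ▸ hr1)
    · exact L_eq_bot_of_card_le (hG.mono le_top) hm

end PPartAut

end FittingBound

namespace FittingBound

open Subgroup

theorem isNilpotent_quotient_res {Γ : Type} [Group Γ] [Finite Γ] {M R : Subgroup Γ} (h : R = res M)
    [hn : (R.subgroupOf M).Normal] : Group.IsNilpotent (M ⧸ R.subgroupOf M) := by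
  obtain ⟨n, hn⟩ := exists_res_eq M
  refine Subgroup.nilpotent_iff_lowerCentralSeries.2 ⟨n, ?_⟩
  have hs : Function.Surjective (QuotientGroup.mk' (R.subgroupOf M)) :=
    QuotientGroup.mk'_surjective _
  rw [← lcs_top, ← map_top_of_surjective _ hs, ← map_lcs, Subgroup.map_eq_bot_iff,
    QuotientGroup.ker_mk']
  have h1 := map_lcs M.subtype ⊤ n
  rw [← MonoidHom.range_eq_map, range_subtype, ← hn n le_rfl, ← h] at h1
  intro x hx
  exact mem_subgroupOf.2 (h1 ▸ mem_map_of_mem M.subtype hx)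

theorem fittingHeightLE_of_L_eq_bot {G : Type} [Group G] [Finite G] {N : ℕ}
    (h : L (⊤ : Subgroup G) N = ⊥) : FittingHeightLE G N := by
  refine ⟨fun i => L ⊤ (N - i), h, by simp only [Nat.sub_self, L_zero], fun i => inferInstance,
    fun i => L_antitone _ (by omega), fun i hi hn => ?_⟩
  exact isNilpotent_quotient_res (by rw [← L_succ, show N - (i + 1) + 1 = N - i by omega])

end FittingBound

theorem fittingHeight_bounded_of_automorphism_with_at_most_one_common_prime :
    ∃ f : ℕ × ℕ → ℕ, ∀ (G : Type) [Group G] [Finite G], IsSolvable G →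
      ∀ ψ : MulAut G,
        (∃ p : ℕ, ∀ r : ℕ, r.Prime → r ∣ orderOf ψ → r ∣ Nat.card G → r = p) →
        FittingHeightLE G (f (orderOf ψ, autFixedCard ψ)) := by
  choose N hN using FittingBound.exists_bound
  refine ⟨fun x => ∑ p ∈ Finset.range (x.1 + 1), N x.1 x.2 p, fun G _ _ hG ψ ⟨p, hp⟩ => ?_⟩
  apply FittingBound.fittingHeightLE_of_L_eq_bot
  have hpos : 0 < orderOf ψ := orderOf_pos ψ
  have key : ∃ p' ≤ orderOf ψ, ∀ r : ℕ, r.Prime → r ∣ orderOf ψ → r ∣ Nat.card G → r = p' := by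
    by_cases hle : p ≤ orderOf ψ
    · exact ⟨p, hle, hp⟩
    · exact ⟨0, Nat.zero_le _, fun r hr hrn hrG =>
        absurd (hp r hr hrn hrG ▸ Nat.le_of_dvd hpos hrn) hle⟩
  obtain ⟨p', hp', hr⟩ := key
  exact FittingBound.L_eq_bot_mono
    (Finset.single_le_sum (f := N (orderOf ψ) (autFixedCard ψ)) (fun _ _ => Nat.zero_le _)
      (Finset.mem_range.2 (Nat.lt_succ_of_le hp')))
    (hN _ _ p' G ψ (FittingBound.Sol.top (h := hG)) hpos.ne' (pow_orderOf_eq_one ψ) hr le_rfl)
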